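/- arXiv:1703.10540 — 4 statements merged into one kernel-verified Lean document; each statement's English description precedes it below -/
import Mathlib

section
/- Let H be Hall's universal group and let G be a subgroup of Aut(H) whose index (the cardinality of the coset space Aut(H)/G) is strictly less than 2^ℵ₀. Then there exists a unique finite subgroup A of H such that the pointwise stabilizer of A is contained in G and G is contained in the setwise stabilizer of A. -/
/-- The pointwise stabilizer of a subgroup `A` of `H` inside `Aut(H)`. -/
def pointwiseStabilizer {H : Type} [Group H] (A : Subgroup H) : Subgroup (MulAut H) where
  carrier := {f | ∀ a ∈ A, f a = a}
  one_mem' := fun _ _ => rfl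
  mul_mem' := by
    intro f g hf hg a ha
    show f (g a) = a
    rw [hg a ha, hf a ha]
  inv_mem' := by
    intro f hf a ha
    show f⁻¹ a = a
    rw [MulAut.inv_def]
    exact (MulEquiv.symm_apply_eq f).mpr (hf a ha).symm

/-- The setwise stabilizer of a subgroup `A` of `H` inside `Aut(H)`. -/
def setwiseStabilizer {H : Type} [Group H] (A : Subgroup H) : Subgroup (MulAut H) where
  carrier := {f | f '' (A : Set H) = (A : Set H)}
  one_mem' := by
    show (1 : MulAut H) '' (A : Set H) = (A : Set H)
    simp
  mul_mem' := by
    intro f g hf hg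
    show (f * g) '' (A : Set H) = (A : Set H)
    rw [show ((f * g : MulAut H) : H → H) = (f : H → H) ∘ (g : H → H) from rfl,
      Set.image_comp, hg, hf]
  inv_mem' := by
    intro f hf
    show (f⁻¹ : MulAut H) '' (A : Set H) = (A : Set H)
    rw [MulAut.inv_def]
    conv_lhs => rw [← hf]
    ext x
    simp

/-- Hall's universal group, without the countability assumption. -/
structure IsHall (H : Type) [Group H] : Prop where
  finite_closure : ∀ s : Finset H, ((Subgroup.closure (s : Set H) : Subgroup H) : Set H).Finite
  exists_embedding : ∀ (G : Type) [Group G] [Finite G], ∃ e : G →* H, Function.Injective e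
  exists_inner : ∀ K L : Subgroup H, (K : Set H).Finite → (L : Set H).Finite →
    ∀ φ : ↥K ≃* ↥L, ∃ h : H, ∀ k : K, (φ k : H) = h * (k : H) * h⁻¹

/-- Among continuum many elements, two lie in the same left coset of `G`. -/
def HasSmallIndex {Γ : Type} [Group Γ] (G : Subgroup Γ) : Prop :=
  ∀ φ : (ℕ → Bool) → Γ, ∃ a b, a ≠ b ∧ (φ a)⁻¹ * φ b ∈ G

theorem hasSmallIndex_of_mk_lt {Γ : Type} [Group Γ] (G : Subgroup Γ)
    (hG : Cardinal.mk (Γ ⧸ G) < Cardinal.continuum) : HasSmallIndex G := by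
  intro φ
  by_contra! h
  have hinj : Function.Injective fun a => (QuotientGroup.mk (φ a) : Γ ⧸ G) := by
    intro a b hab
    by_contra hne
    exact h a b hne (QuotientGroup.eq.mp hab)
  have h1 := Cardinal.mk_le_of_injective hinj
  have h2 : Cardinal.mk (ℕ → Bool) = Cardinal.continuum := by simp
  rw [h2] at h1
  exact absurd hG (not_lt.mpr h1)

theorem exists_ne_ne {α : Type} {x y z : α} (hxy : x ≠ y) (hxz : x ≠ z) (hyz : y ≠ z) (a b : α) :
    ∃ c, c ≠ a ∧ c ≠ b := by
  by_contra! h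
  by_cases hx : x = a
  · exact hyz ((h y fun e => hxy (hx.trans e.symm)).trans (h z fun e => hxz (hx.trans e.symm)).symm)
  · by_cases hy : y = a
    · exact hxz ((h x hx).trans (h z fun e => hyz (hy.trans e.symm)).symm)
    · exact hxy ((h x hx).trans (h y hy).symm)

theorem eq_one_of_forall_commute_perm {α : Type} (hα : ∀ a b : α, ∃ c, c ≠ a ∧ c ≠ b)
    (σ : Equiv.Perm α) (hσ : ∀ τ, σ * τ = τ * σ) : σ = 1 := by
  classical
  refine Equiv.ext fun a => ?_
  by_contra hne
  change σ a ≠ a at hne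
  obtain ⟨c, hca, hcb⟩ := hα a (σ a)
  have := congrArg (fun τ : Equiv.Perm α => τ a) (hσ (Equiv.swap (σ a) c))
  simp only [Equiv.Perm.mul_apply, Equiv.swap_apply_left] at this
  rw [Equiv.swap_apply_of_ne_of_ne (Ne.symm hne) hca.symm] at this
  exact hcb this.symm

namespace IsHall

variable {H : Type} [Group H]

theorem finite_closure_set (hH : IsHall H) {s : Set H} (hs : s.Finite) :
    Finite (Subgroup.closure s) := by
  have := hH.finite_closure hs.toFinset
  rw [hs.coe_toFinset] at this
  exact this.to_subtype

theorem finite_sup (hH : IsHall H) (K L : Subgroup H) [hK : Finite K] [hL : Finite L] :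
    Finite (K ⊔ L : Subgroup H) := by
  rw [Subgroup.sup_eq_closure]
  exact hH.finite_closure_set (Set.Finite.union (Set.toFinite _) (Set.toFinite _))

theorem finite_iSup (hH : IsHall H) {ι : Type} [Finite ι] (K : ι → Subgroup H)
    (hK : ∀ i, Finite (K i)) : Finite (⨆ i, K i : Subgroup H) := by
  rw [Subgroup.iSup_eq_closure]
  exact hH.finite_closure_set (Set.finite_iUnion fun i => Set.toFinite _)

theorem exists_conj (hH : IsHall H) {F : Type} [Group F] [Finite F] (i j : F →* H)
    (hi : Function.Injective i) (hj : Function.Injective j) :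
    ∃ h : H, ∀ x, j x = h * i x * h⁻¹ := by
  obtain ⟨h, hh⟩ := hH.exists_inner i.range j.range (Set.finite_range i) (Set.finite_range j)
    ((MonoidHom.ofInjective hi).symm.trans (MonoidHom.ofInjective hj))
  refine ⟨h, fun x => ?_⟩
  have := hh (MonoidHom.ofInjective hi x)
  simp only [MulEquiv.trans_apply, MulEquiv.symm_apply_apply] at this
  exact this

theorem exists_extend (hH : IsHall H) (K : Subgroup H) [Finite K] {F : Type} [Group F] [Finite F]
    (i : K →* F) (hi : Function.Injective i) :
    ∃ e : F →* H, Function.Injective e ∧ ∀ k : K, e (i k) = k := by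
  obtain ⟨e, he⟩ := hH.exists_embedding F
  obtain ⟨h, hh⟩ := hH.exists_conj (e.comp i) K.subtype (he.comp hi) K.subtype_injective
  refine ⟨(MulAut.conj h).toMonoidHom.comp e, (MulAut.conj h).injective.comp he, fun k => ?_⟩
  simpa using (hh k).symm

theorem exists_centerless (hH : IsHall H) (K : Subgroup H) [Finite K] :
    ∃ L : Subgroup H, Finite L ∧ K ≤ L ∧ L ⊓ Subgroup.centralizer L = ⊥ := by
  classical
  let i : K →* Equiv.Perm (K ⊕ Fin 3) :=
    (Equiv.Perm.sumCongrHom K (Fin 3)).comp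
      ((MonoidHom.inl _ _).comp (MulAction.toPermHom K K))
  have hi : Function.Injective i := by
    rw [injective_iff_map_eq_one]
    intro k hk
    have := congrArg (fun τ : Equiv.Perm (K ⊕ Fin 3) => τ (Sum.inl 1)) hk
    simpa [i] using this
  obtain ⟨e, he, hek⟩ := hH.exists_extend K i hi
  refine ⟨e.range, Finite.of_surjective _ e.rangeRestrict_surjective,
    fun k hk => ⟨i ⟨k, hk⟩, hek _⟩, ?_⟩
  rw [eq_bot_iff]
  rintro _ ⟨⟨σ, rfl⟩, hσ⟩
  have : σ = 1 := by
    apply eq_one_of_forall_commute_perm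
    · intro a b
      exact exists_ne_ne (x := Sum.inr 0) (y := Sum.inr 1) (z := Sum.inr 2) (by simp) (by simp)
        (by simp) a b
    · intro τ
      apply he
      have := Subgroup.mem_centralizer_iff.mp hσ (e τ) ⟨τ, rfl⟩
      simpa using this.symm
  simp [this]

end IsHall

theorem exists_seq_of_step {X : Type} (Q : ℕ → X → Prop) (P : ℕ → X → X → Prop) (x₀ : X)
    (h₀ : Q 0 x₀) (step : ∀ n x, Q n x → ∃ y, Q (n + 1) y ∧ P n x y) :
    ∃ s : ℕ → X, s 0 = x₀ ∧ (∀ n, Q n (s n)) ∧ ∀ n, P n (s n) (s (n + 1)) := by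
  choose F hF using step
  let t : ∀ n, {x // Q n x} := fun n =>
    Nat.rec ⟨x₀, h₀⟩ (fun n x => ⟨F n x.1 x.2, (hF n x.1 x.2).1⟩) n
  exact ⟨fun n => (t n).1, rfl, fun n => (t n).2, fun n => (hF n (t n).1 (t n).2).2⟩

theorem HasSmallIndex.exists_conj_mem {Γ : Type} [Group Γ] {G : Subgroup Γ}
    (hG : HasSmallIndex G) (S : ℕ → Subgroup Γ)
    (glue : ∀ f : ℕ → Γ, (∀ k, f k ∈ S k) → ∀ a : ℕ → Bool, ∃ h, ∀ k, ∀ x ∈ S k,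
      h * x * h⁻¹ = if a k then f k * x * (f k)⁻¹ else x) :
    ∃ k, ∀ x ∈ S k, x ∈ G → ∀ f ∈ S k, f * x * f⁻¹ ∈ G := by
  by_contra! hcon
  choose x hxS hxG f hfS hn using hcon
  choose h hh using glue f hfS
  have key : ∀ a b k, (h a)⁻¹ * h b ∈ G → a k = false → b k = true → False := by
    intro a b k hab ha hb
    have h1 : h b * x k * (h b)⁻¹ = f k * x k * (f k)⁻¹ := by simpa [hb] using hh b k _ (hxS k)
    have h2 : h a * (f k * x k * (f k)⁻¹) * (h a)⁻¹ = f k * x k * (f k)⁻¹ := by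
      simpa [ha] using hh a k _ ((S k).mul_mem ((S k).mul_mem (hfS k) (hxS k))
        ((S k).inv_mem (hfS k)))
    apply hn k
    have h3 := G.mul_mem (G.mul_mem hab (hxG k)) (G.inv_mem hab)
    have h4 : (h a)⁻¹ * h b * x k * ((h a)⁻¹ * h b)⁻¹ = f k * x k * (f k)⁻¹ := by
      calc (h a)⁻¹ * h b * x k * ((h a)⁻¹ * h b)⁻¹
          = (h a)⁻¹ * (h b * x k * (h b)⁻¹) * h a := by group
        _ = (h a)⁻¹ * (h a * (f k * x k * (f k)⁻¹) * (h a)⁻¹) * h a := by rw [h1, h2]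
        _ = f k * x k * (f k)⁻¹ := by group
    rwa [h4] at h3
  obtain ⟨a, b, hab, hmem⟩ := hG h
  obtain ⟨k, hk⟩ := Function.ne_iff.mp hab
  have hmem' : (h b)⁻¹ * h a ∈ G := by simpa using G.inv_mem hmem
  rcases ha : a k with _ | _ <;> rcases hb : b k with _ | _
  · simp [ha, hb] at hk
  · exact key a b k hmem ha hb
  · exact key b a k hmem' hb ha
  · simp [ha, hb] at hk

section Layers

variable {H : Type} [Group H]

/-- The elements of `A (n + 1)` commuting with `A n`. -/
abbrev layer (A : ℕ → Subgroup H) (n : ℕ) : Subgroup H :=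
  A (n + 1) ⊓ Subgroup.centralizer (A n)

/-- The product `r 0 * ⋯ * r (n - 1)`. -/
def partialProd {A : ℕ → Subgroup H} (r : ∀ n, layer A n) : ℕ → H
  | 0 => 1
  | n + 1 => partialProd r n * r n

variable {A : ℕ → Subgroup H}

theorem layer_commute {n : ℕ} (r : layer A n) {x : H} (hx : x ∈ A n) : Commute x r :=
  Subgroup.mem_centralizer_iff.mp r.2.2 x hx

theorem partialProd_mem (hA : Monotone A) (r : ∀ n, layer A n) (n : ℕ) :
    partialProd r n ∈ A n := by
  induction n with
  | zero => exact one_mem _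
  | succ n ih => exact mul_mem (hA n.le_succ ih) (r n).2.1

theorem partialProd_mem_centralizer (hA : Monotone A) (r : ∀ n, layer A n) (n : ℕ) :
    partialProd r n ∈ Subgroup.centralizer (A 0 : Set H) := by
  induction n with
  | zero => exact one_mem _
  | succ n ih => exact mul_mem ih (Subgroup.centralizer_le (hA n.zero_le) (r n).2.2)

theorem partialProd_mul (hA : Monotone A) (r s : ∀ n, layer A n) (n : ℕ) :
    partialProd (r * s) n = partialProd r n * partialProd s n := by
  induction n with
  | zero => simp [partialProd]
  | succ n ih =>
    have := (layer_commute (r n) (partialProd_mem hA s n)).eq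
    simp only [partialProd, ih, Pi.mul_apply, Subgroup.coe_mul]
    rw [mul_assoc, mul_assoc, ← mul_assoc (partialProd s n), this]
    simp only [mul_assoc]

theorem partialProd_one (n : ℕ) : partialProd (1 : ∀ n, layer A n) n = 1 := by
  induction n with
  | zero => rfl
  | succ n ih => simp [partialProd, ih]

theorem partialProd_eq_one {r : ∀ n, layer A n} {n : ℕ} (h : ∀ i < n, r i = 1) :
    partialProd r n = 1 := by
  induction n with
  | zero => rfl
  | succ n ih => simp [partialProd, ih fun i hi => h i (hi.trans n.lt_succ_self), h n]

theorem partialProd_conj_eq (hA : Monotone A) (r : ∀ n, layer A n) {n m : ℕ} (hnm : n ≤ m)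
    {x : H} (hx : x ∈ A n) :
    partialProd r m * x * (partialProd r m)⁻¹ = partialProd r n * x * (partialProd r n)⁻¹ := by
  induction m, hnm using Nat.le_induction with
  | base => rfl
  | succ m hm ih =>
    rw [← ih]
    have := (layer_commute (r m) (hA hm hx)).eq
    simp only [partialProd, mul_inv_rev]
    rw [mul_assoc _ _ x, ← this]
    group

theorem partialProd_eq_of_le {r : ∀ n, layer A n} {N m : ℕ} (h : ∀ n ≥ N, r n = 1) (hm : N ≤ m) :
    partialProd r m = partialProd r N := by
  induction m, hm using Nat.le_induction with
  | base => rfl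
  | succ m hm ih => simp [partialProd, ih, h m hm]

theorem layerFun_eq (hA : Monotone A) (r : ∀ n, layer A n) {n m : ℕ} {x : H} (hn : x ∈ A n)
    (hm : x ∈ A m) :
    partialProd r m * x * (partialProd r m)⁻¹ = partialProd r n * x * (partialProd r n)⁻¹ := by
  rcases le_total n m with h | h
  · exact partialProd_conj_eq hA r h hn
  · exact (partialProd_conj_eq hA r h hm).symm

theorem exists_common_level (hA : Monotone A) (hex : ∀ x, ∃ n, x ∈ A n) (x y : H) :
    ∃ n, x ∈ A n ∧ y ∈ A n := by
  obtain ⟨n, hn⟩ := hex x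
  obtain ⟨m, hm⟩ := hex y
  exact ⟨max n m, hA (le_max_left _ _) hn, hA (le_max_right _ _) hm⟩

/-- The automorphism of `H` acting on each `A n` as conjugation by `r 0 * ⋯ * r (n - 1)`. -/
noncomputable def layerAut (hA : Monotone A) (hex : ∀ x, ∃ n, x ∈ A n) :
    (∀ n, layer A n) →* MulAut H :=
  let F : (∀ n, layer A n) → H → H := fun r x =>
    partialProd r (hex x).choose * x * (partialProd r (hex x).choose)⁻¹
  have hF : ∀ r n x, x ∈ A n → F r x = partialProd r n * x * (partialProd r n)⁻¹ :=
    fun r _ x hx => layerFun_eq hA r hx (hex x).choose_spec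
  have hcomp : ∀ r s x, F r (F s x) = F (r * s) x := by
    intro r s x
    obtain ⟨n, hn⟩ := hex x
    rw [hF s n x hn, hF (r * s) n x hn, hF r n, partialProd_mul hA]
    · group
    · exact mul_mem (mul_mem (partialProd_mem hA s n) hn) (inv_mem (partialProd_mem hA s n))
  have hone : ∀ x, F 1 x = x := fun x => by simp [F, partialProd_one]
  { toFun := fun r =>
      { toFun := F r
        invFun := F r⁻¹
        left_inv := fun x => by rw [hcomp, inv_mul_cancel, hone]
        right_inv := fun x => by rw [hcomp, mul_inv_cancel, hone]
        map_mul' := fun x y => by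
          obtain ⟨n, hx, hy⟩ := exists_common_level hA hex x y
          rw [hF r n x hx, hF r n y hy, hF r n _ (mul_mem hx hy)]
          group }
    map_one' := MulEquiv.ext hone
    map_mul' := fun r s => MulEquiv.ext fun x => (hcomp r s x).symm }

variable (hA : Monotone A) (hex : ∀ x, ∃ n, x ∈ A n)

theorem layerAut_apply (r : ∀ n, layer A n) {n : ℕ} {x : H} (hx : x ∈ A n) :
    layerAut hA hex r x = partialProd r n * x * (partialProd r n)⁻¹ :=
  layerFun_eq hA r hx (hex x).choose_spec

theorem layerAut_eq_conj {r : ∀ n, layer A n} {N : ℕ} (h : ∀ n ≥ N, r n = 1) :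
    layerAut hA hex r = MulAut.conj (partialProd r N) := by
  ext x
  obtain ⟨n, hn⟩ := hex x
  rw [layerAut_apply hA hex r (hA (le_max_left n N) hn),
    partialProd_eq_of_le h (le_max_right n N), MulAut.conj_apply]

theorem layerAut_mulSingle (n : ℕ) (d : layer A n) :
    layerAut hA hex (Pi.mulSingle n d) = MulAut.conj (d : H) := by
  rw [layerAut_eq_conj hA hex (N := n + 1), partialProd, partialProd_eq_one]
  · simp
  · exact fun i hi => Pi.mulSingle_eq_of_ne hi.ne _
  · exact fun i hi => Pi.mulSingle_eq_of_ne (Nat.lt_of_succ_le hi).ne' _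

end Layers

section Commutator

open scoped commutatorElement

/-- The diagonal embedding of `D` in the base group of `D ≀ᵣ Q`. -/
def wreathDiag (D Q : Type) [Group D] [Group Q] : D →* D ≀ᵣ Q where
  toFun d := ⟨fun _ => d, 1⟩
  map_one' := rfl
  map_mul' a b := by ext <;> simp

theorem wreathDiag_injective (D Q : Type) [Group D] [Group Q] :
    Function.Injective (wreathDiag D Q) := fun _ _ h =>
  congrFun (congrArg RegularWreathProduct.left h) 1

theorem wreath_commutator {D Q : Type} [Group D] [Group Q] (ψ : Q →* D) (c : Q) :
    ⁅(⟨ψ, 1⟩ : D ≀ᵣ Q), ⟨1, c⟩⁆ = wreathDiag D Q (ψ c) := by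
  ext x <;> simp [commutatorElement_def, wreathDiag]

theorem IsHall.exists_commutator_eq {H : Type} [Group H] (hH : IsHall H) (B : Subgroup H)
    [Finite B] {γ : H} (hγ : γ ∈ Subgroup.centralizer (B : Set H)) :
    ∃ f ∈ Subgroup.centralizer (B : Set H), ∃ z ∈ Subgroup.centralizer (B : Set H),
      ⁅f, z⁆ = γ := by
  have := hH.finite_closure_set (Set.finite_singleton γ)
  have := hH.finite_sup B (Subgroup.closure {γ})
  let K := B ⊔ Subgroup.closure {γ}
  have hγK : γ ∈ K := (le_sup_right : _ ≤ K) (Subgroup.mem_closure_singleton_self γ)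
  let C := (Subgroup.centralizer (B : Set H)).subgroupOf K
  obtain ⟨e, he, heK⟩ := hH.exists_extend K (wreathDiag K C) (wreathDiag_injective K C)
  have hcomm : ∀ w : K ≀ᵣ C, (∀ b (hb : b ∈ B),
      wreathDiag K C ⟨b, (le_sup_left : _ ≤ K) hb⟩ * w =
        w * wreathDiag K C ⟨b, (le_sup_left : _ ≤ K) hb⟩) →
      e w ∈ Subgroup.centralizer (B : Set H) := by
    intro w hw
    rw [Subgroup.mem_centralizer_iff]
    intro b hb
    have := congrArg e (hw b hb)
    rwa [map_mul, map_mul, heK] at this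
  let c : C := ⟨⟨γ, hγK⟩, hγ⟩
  refine ⟨e ⟨C.subtype, 1⟩, hcomm _ ?_, e ⟨1, c⟩, hcomm _ ?_, ?_⟩
  · intro b hb
    ext x
    · simpa [wreathDiag] using Subgroup.mem_centralizer_iff.mp x.2 b hb
    · simp [wreathDiag]
  · intro b hb
    ext x <;> simp [wreathDiag]
  · rw [← map_commutatorElement, wreath_commutator, heK]
    rfl

end Commutator

section Inner

open scoped commutatorElement

theorem HasSmallIndex.exists_inv_mul_mem {Γ : Type} [Group Γ] {G : Subgroup Γ}
    (hG : HasSmallIndex G) (φ : (ℕ → Bool) → Γ) :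
    ∃ a b k, a k = false ∧ b k = true ∧ (φ a)⁻¹ * φ b ∈ G := by
  obtain ⟨a, b, hab, hmem⟩ := hG φ
  obtain ⟨k, hk⟩ := Function.ne_iff.mp hab
  have hmem' : (φ b)⁻¹ * φ a ∈ G := by simpa using G.inv_mem hmem
  rcases ha : a k with _ | _ <;> rcases hb : b k with _ | _
  · simp [ha, hb] at hk
  · exact ⟨a, b, k, ha, hb, hmem⟩
  · exact ⟨b, a, k, hb, ha, hmem'⟩
  · simp [ha, hb] at hk

variable {H : Type} [Group H] {A : ℕ → Subgroup H}

theorem exists_conj_commutator_mem (hA : Monotone A) (hex : ∀ x, ∃ n, x ∈ A n)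
    {G : Subgroup (MulAut H)} (hG : HasSmallIndex G) (f z : ∀ n, layer A n) :
    ∃ n, MulAut.conj ((⁅f n, z n⁆ : layer A n) : H) ∈ G := by
  let R : ℕ → Subgroup (∀ n, layer A n) := fun k =>
    Subgroup.pi {n | (Nat.unpair n).1 ≠ k} fun _ => ⊥
  have hR : ∀ k r, r ∈ R k ↔ ∀ n, (Nat.unpair n).1 ≠ k → r n = 1 := fun k r => by
    simp [R, Subgroup.mem_pi]
  let Φ := layerAut hA hex
  obtain ⟨k, hk⟩ := hG.exists_conj_mem (fun k => (R k).map Φ) (by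
    intro g hg a
    choose ρ hρ hρg using hg
    refine ⟨Φ fun n => if a (Nat.unpair n).1 then ρ (Nat.unpair n).1 n else 1, ?_⟩
    rintro k _ ⟨s, hs, rfl⟩
    rw [← hρg k]
    have hs' := (hR k s).mp hs
    by_cases ha : a k
    · simp only [ha, if_true, ← map_inv, ← map_mul]
      congr 1
      ext n : 1
      by_cases hn : (Nat.unpair n).1 = k
      · simp [hn, ha]
      · simp [hs' n hn]
    · simp only [ha, ← map_inv, ← map_mul]
      congr 1
      ext n : 1
      by_cases hn : (Nat.unpair n).1 = k
      · simp [hn, ha]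
      · simp [hs' n hn])
  let w : (ℕ → Bool) → ∀ n, layer A n := fun a n =>
    if (Nat.unpair n).1 = k ∧ a (Nat.unpair n).2 then z n else 1
  have hw : ∀ a, w a ∈ R k := fun a => (hR k _).mpr fun n hn => by simp [w, hn]
  obtain ⟨a, b, j, ha, hb, hmem⟩ := hG.exists_inv_mul_mem fun a => Φ (w a)
  refine ⟨Nat.pair k j, ?_⟩
  set n := Nat.pair k j with hn
  have hfR : Pi.mulSingle n (f n) ∈ R k := (hR k _).mpr fun i hi =>
    Pi.mulSingle_eq_of_ne (fun h => hi (by simp [h, hn])) _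
  rw [← map_inv, ← map_mul] at hmem
  have h1 := hk _ ⟨_, (R k).mul_mem ((R k).inv_mem (hw a)) (hw b), rfl⟩ hmem _ ⟨_, hfR, rfl⟩
  have h2 := G.mul_mem h1 (G.inv_mem hmem)
  rw [← map_inv, ← map_inv, ← map_mul, ← map_mul, ← map_mul] at h2
  rw [← layerAut_mulSingle hA hex]
  convert h2 using 2
  ext i : 1
  by_cases hi : i = n
  · subst hi
    simp [w, hn, ha, hb, commutatorElement_def]
  · simp [Pi.mulSingle_eq_of_ne hi]

theorem IsHall.exists_conj_centralizer_mem (hH : IsHall H) [Countable H]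
    {G : Subgroup (MulAut H)} (hG : HasSmallIndex G) :
    ∃ B : Subgroup H, Finite B ∧ ∀ c ∈ Subgroup.centralizer (B : Set H), MulAut.conj c ∈ G := by
  by_contra! hcon
  obtain ⟨e, he⟩ := exists_surjective_nat H
  obtain ⟨A, -, -, hstep⟩ := exists_seq_of_step (fun _ (K : Subgroup H) => Finite K)
    (fun n K L => K ≤ L ∧ e n ∈ L ∧ ∃ f ∈ L ⊓ Subgroup.centralizer (K : Set H),
      ∃ z ∈ L ⊓ Subgroup.centralizer (K : Set H), MulAut.conj ⁅f, z⁆ ∉ G) ⊥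
    inferInstance (by
      intro n K hK
      obtain ⟨c, hc, hcG⟩ := hcon K hK
      obtain ⟨f, hf, z, hz, hfz⟩ := hH.exists_commutator_eq K hc
      have := hH.finite_closure_set (Set.toFinite {e n, f, z})
      have hsub : ({e n, f, z} : Set H) ⊆ (K ⊔ Subgroup.closure {e n, f, z} : Subgroup H) :=
        Subgroup.subset_closure.trans (SetLike.coe_subset_coe.mpr le_sup_right)
      exact ⟨K ⊔ Subgroup.closure {e n, f, z}, hH.finite_sup _ _, le_sup_left,
        hsub (by simp), f, ⟨hsub (by simp), hf⟩, z, ⟨hsub (by simp), hz⟩, by rwa [hfz]⟩)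
  choose hle hmem f hf z hz hfz using hstep
  have hex : ∀ x, ∃ n, x ∈ A n := fun x => by
    obtain ⟨n, rfl⟩ := he x
    exact ⟨n + 1, hmem n⟩
  obtain ⟨n, hn⟩ := exists_conj_commutator_mem (monotone_nat_of_le_succ hle) hex hG
    (fun n => ⟨f n, hf n⟩) (fun n => ⟨z n, hz n⟩)
  exact hfz n hn

end Inner

section Room

open scoped commutatorElement

/-- The inclusion of the base group in `D ≀ᵣ Q`. -/
def wreathBase (D Q : Type) [Group D] [Group Q] : (Q → D) →* D ≀ᵣ Q where
  toFun g := ⟨g, 1⟩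
  map_one' := rfl
  map_mul' a b := by ext <;> simp

theorem wreathBase_injective (D Q : Type) [Group D] [Group Q] :
    Function.Injective (wreathBase D Q) := fun _ _ h => congrArg RegularWreathProduct.left h

theorem wreath_conj_base {D Q : Type} [Group D] [Group Q] (r : Q) (g : Q → D) :
    (RegularWreathProduct.inl r : D ≀ᵣ Q) * wreathBase D Q g * (RegularWreathProduct.inl r)⁻¹ =
      wreathBase D Q fun x => g (r⁻¹ * x) := by
  ext x <;> simp [wreathBase, RegularWreathProduct.inl]

theorem wreath_conj_mulSingle {D Q : Type} [Group D] [Group Q] [DecidableEq Q] (r s : Q) (d : D) :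
    (RegularWreathProduct.inl r : D ≀ᵣ Q) * wreathBase D Q (Pi.mulSingle s d) *
      (RegularWreathProduct.inl r)⁻¹ = wreathBase D Q (Pi.mulSingle (r * s) d) := by
  rw [wreath_conj_base]
  congr 1
  ext x
  simp only [Pi.mulSingle_apply, inv_mul_eq_iff_eq_mul]

theorem wreath_double_commutator {D Q : Type} [Group D] [Group Q] [DecidableEq Q] {r : Q}
    (hr : r ≠ 1) (s : Q) (p q : D) :
    ⁅⁅(RegularWreathProduct.inl r : D ≀ᵣ Q), wreathBase D Q (Pi.mulSingle s p⁻¹)⁆,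
      wreathBase D Q (Pi.mulSingle s q)⁆ = wreathBase D Q (Pi.mulSingle s ⁅p, q⁆) := by
  rw [commutatorElement_def (RegularWreathProduct.inl r), wreath_conj_mulSingle, ← map_inv,
    ← map_mul, ← map_commutatorElement]
  congr 1
  have hrs : s ≠ r * s := fun h => hr (by simpa using h.symm)
  ext x
  by_cases hx : x = s
  · subst hx
    simp [commutatorElement_def, Pi.mulSingle_eq_of_ne hrs]
  · simp [commutatorElement_def, Pi.mulSingle_eq_of_ne hx]

variable {H : Type} [Group H]

/-- The group of labels. -/
abbrev Label (m : ℕ) : Type := Fin m → Multiplicative (ZMod 2)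

/-- A family of commuting copies `θ k` of a group `Q` in `L`, centralizing `A`; `Q` contains
copies `ι s` of the centralizer of `A` in `K` indexed by labels, permuted by the `t r`. -/
structure Room (A K L : Subgroup H) (m : ℕ) where
  Q : Type
  [group : Group Q]
  θ : ℕ → Q →* H
  t : Label m →* Q
  ι : Label m → ↥(K ⊓ Subgroup.centralizer (A : Set H)) →* Q
  θ_mem : ∀ k q, θ k q ∈ L ⊓ Subgroup.centralizer (A : Set H)
  glue : ∀ y : ℕ → Q, ∃ h ∈ L ⊓ Subgroup.centralizer (A : Set H), ∀ k q,
    h * θ k q * h⁻¹ = θ k (y k * q * (y k)⁻¹)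
  conj_t : ∀ r s c, t r * ι s c * (t r)⁻¹ = ι (r * s) c
  commutator : ∀ r, r ≠ 1 → ∀ s c, ∃ y₁ y₂ : Q, ⁅⁅t r, y₁⁆, y₂⁆ = ι s c
  swap : ∀ k < m, ∃ μ ∈ L ⊓ Subgroup.centralizer (A : Set H),
    (∀ c, μ * c * μ⁻¹ = θ k (ι 1 c)) ∧ ∀ s, s ≠ 1 → ∀ c, μ * θ k (ι s c) * μ⁻¹ = θ k (ι s c)

attribute [instance] Room.group

/-- Enlarge the ambient subgroup of a `Room`. -/
def Room.mono {A K L L' : Subgroup H} {m : ℕ} (R : Room A K L m) (h : L ≤ L') :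
    Room A K L' m where
  Q := R.Q
  θ := R.θ
  t := R.t
  ι := R.ι
  θ_mem k q := ⟨h (R.θ_mem k q).1, (R.θ_mem k q).2⟩
  glue y := by
    obtain ⟨x, hx, hx'⟩ := R.glue y
    exact ⟨x, ⟨h hx.1, hx.2⟩, hx'⟩
  conj_t := R.conj_t
  commutator := R.commutator
  swap k hk := by
    obtain ⟨x, hx, hx'⟩ := R.swap k hk
    exact ⟨x, ⟨h hx.1, hx.2⟩, hx'⟩

theorem IsHall.exists_room (hH : IsHall H) {A K : Subgroup H} (hAK : A ≤ K) [Finite K]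
    (hA : A ⊓ Subgroup.centralizer (A : Set H) = ⊥) (m : ℕ) :
    ∃ L : Subgroup H, Finite L ∧ Nonempty (Room A K L m) := by
  classical
  let C : Subgroup H := K ⊓ Subgroup.centralizer (A : Set H)
  have hCK : C ≤ K := inf_le_left
  have : Finite A := Finite.of_injective _ (Subgroup.inclusion_injective hAK)
  have : Finite C := Finite.of_injective _ (Subgroup.inclusion_injective hCK)
  let Q : Type := (C ≀ᵣ C) ≀ᵣ Label m
  let b : (Label m → C) →* Q :=
    (wreathBase (C ≀ᵣ C) (Label m)).comp ((wreathDiag C C).compLeft (Label m))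
  have hb : Function.Injective b := (wreathBase_injective _ _).comp fun f g h =>
    funext fun x => wreathDiag_injective C C (congrFun h x)
  have hbs : ∀ s c, b (Pi.mulSingle s c) =
      wreathBase _ _ (Pi.mulSingle s (wreathDiag C C c)) := by
    intro s c
    simp only [b, MonoidHom.comp_apply]
    congr 1
    ext x : 1
    by_cases hx : x = s
    · subst hx; simp
    · simp [Pi.mulSingle_eq_of_ne hx]
  let F := K × (Fin m → Q)
  obtain ⟨e, he, heK⟩ := hH.exists_extend K (MonoidHom.inl K (Fin m → Q))
    (fun x y h => congrArg Prod.fst h)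
  let ω : (Fin m → Q) →* H := e.comp (MonoidHom.inr K (Fin m → Q))
  have hω : ∀ y, ω y ∈ Subgroup.centralizer (A : Set H) := by
    intro y
    rw [Subgroup.mem_centralizer_iff]
    intro a ha
    have h : e (MonoidHom.inl K (Fin m → Q) ⟨a, hAK ha⟩) = a := heK _
    rw [← h]
    simp only [ω, MonoidHom.comp_apply, ← map_mul]
    congr 1
    ext <;> simp
  let θ : ℕ → Q →* H := fun k =>
    if h : k < m then ω.comp (MonoidHom.mulSingle (fun _ => Q) ⟨k, h⟩) else 1
  have hθ : ∀ k (h : k < m) q, θ k q = ω (Pi.mulSingle ⟨k, h⟩ q) := fun k h q => by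
    simp [θ, h]
  have hθ' : ∀ k (h : ¬ k < m) q, θ k q = 1 := fun k h q => by
    simp [θ, h]
  have hswap : ∀ k : Fin m, ∃ μ ∈ Subgroup.centralizer (A : Set H),
      (∀ c : C, μ * c * μ⁻¹ = θ k (b (Pi.mulSingle 1 c))) ∧ ∀ s, s ≠ 1 → ∀ c,
        μ * θ k (b (Pi.mulSingle s c)) * μ⁻¹ = θ k (b (Pi.mulSingle s c)) := by
    intro k
    let J₁ : A × C →* K := (Subgroup.inclusion hAK).noncommCoprod (Subgroup.inclusion hCK)
      fun a c => Subtype.ext (Subgroup.mem_centralizer_iff.mp c.2.2 a a.2)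
    let J : (A × C) × (Label m → C) →* F :=
      J₁.prodMap ((MonoidHom.mulSingle (fun _ => Q) k).comp b)
    have hJ₁ : Function.Injective J₁ := by
      rw [injective_iff_map_eq_one]
      rintro ⟨a, c⟩ h
      have h' : (a : H) * c = 1 := congrArg Subtype.val h
      have ha : (a : H) ∈ A ⊓ Subgroup.centralizer (A : Set H) :=
        ⟨a.2, by rw [eq_inv_of_mul_eq_one_left h']; exact Subgroup.inv_mem _ c.2.2⟩
      rw [hA, Subgroup.mem_bot] at ha
      rw [ha, one_mul] at h'
      exact Prod.ext (Subtype.ext ha) (Subtype.ext h')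
    have hJ : Function.Injective J :=
      hJ₁.prodMap ((Pi.mulSingle_injective k).comp hb)
    let σ : (A × C) × (Label m → C) →* (A × C) × (Label m → C) :=
      { toFun := fun x => ((x.1.1, x.2 1), Function.update x.2 1 x.1.2)
        map_one' := by
          ext <;> simp
        map_mul' := fun x y => by
          ext s
          · simp
          · simp
          · by_cases hs : s = 1
            · subst hs; simp
            · simp [hs] }
    have hσ : Function.Injective σ := by
      rintro ⟨⟨a, c⟩, g⟩ ⟨⟨a', c'⟩, g'⟩ h
      simp only [σ, MonoidHom.coe_mk, OneHom.coe_mk, Prod.mk.injEq] at h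
      obtain ⟨⟨h1, h2⟩, h3⟩ := h
      have hc : c = c' := by simpa using congrFun h3 1
      have hg : g = g' := by
        ext s : 1
        by_cases hs : s = 1
        · rw [hs, h2]
        · simpa [hs] using congrFun h3 s
      rw [h1, hc, hg]
    obtain ⟨μ, hμ⟩ := hH.exists_conj (e.comp J) ((e.comp J).comp σ) (he.comp hJ)
      ((he.comp hJ).comp hσ)
    have hJ_apply : ∀ a c g, J ((a, c), g) =
        (Subgroup.inclusion hAK a * Subgroup.inclusion hCK c, Pi.mulSingle k (b g)) :=
      fun _ _ _ => rfl
    have hJA : ∀ a : A, e (J ((a, 1), 1)) = a := fun a => by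
      have h : J ((a, 1), 1) = MonoidHom.inl K (Fin m → Q) (Subgroup.inclusion hAK a) :=
        (hJ_apply _ _ _).trans (by simp only [map_one, mul_one, Pi.mulSingle_one]; rfl)
      rw [h, heK]
      rfl
    have hJC : ∀ c : C, e (J ((1, c), 1)) = c := fun c => by
      have h : J ((1, c), 1) = MonoidHom.inl K (Fin m → Q) (Subgroup.inclusion hCK c) :=
        (hJ_apply _ _ _).trans (by simp only [map_one, one_mul, Pi.mulSingle_one]; rfl)
      rw [h, heK]
      rfl
    have hJθ : ∀ g, e (J ((1, 1), g)) = θ k (b g) := fun g => by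
      rw [hθ k k.2]
      simp only [ω, MonoidHom.comp_apply, hJ_apply, map_one, mul_one]
      rfl
    refine ⟨μ, ?_, ?_, ?_⟩
    · rw [Subgroup.mem_centralizer_iff]
      intro a ha
      have h := hμ ((⟨a, ha⟩, 1), 1)
      have hs : σ ((⟨a, ha⟩, 1), 1) = ((⟨a, ha⟩, 1), 1) := by
        ext <;> simp [σ]
      simp only [MonoidHom.comp_apply, hs, hJA] at h
      exact eq_mul_inv_iff_mul_eq.mp h
    · intro c
      have h := hμ ((1, c), 1)
      have hs : σ ((1, c), 1) = ((1, 1), Pi.mulSingle 1 c) := by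
        ext <;> simp [σ, Pi.mulSingle]
      simp only [MonoidHom.comp_apply, hs, hJC, hJθ] at h
      exact h.symm
    · intro s hs1 c
      have h := hμ ((1, 1), Pi.mulSingle s c)
      have hs : σ ((1, 1), Pi.mulSingle s c) = ((1, 1), Pi.mulSingle s c) := by
        have : (Pi.mulSingle s c : Label m → C) 1 = 1 := Pi.mulSingle_eq_of_ne hs1.symm _
        simp only [σ, MonoidHom.coe_mk, OneHom.coe_mk, this]
        rw [← this, Function.update_eq_self]
      simp only [MonoidHom.comp_apply, hs, hJθ] at h
      exact h.symm
  choose μ hμA hμ₁ hμ₂ using hswap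
  have : Finite e.range := Finite.of_surjective _ e.rangeRestrict_surjective
  have := hH.finite_closure_set (Set.finite_range μ)
  let L := e.range ⊔ Subgroup.closure (Set.range μ)
  have hωL : ∀ y, ω y ∈ L := fun y => (le_sup_left : _ ≤ L) ⟨_, rfl⟩
  refine ⟨L, hH.finite_sup _ _, ⟨{
    Q := Q
    θ := θ
    t := RegularWreathProduct.inl
    ι := fun s => b.comp (MonoidHom.mulSingle (fun _ => C) s)
    θ_mem := ?_
    glue := ?_
    conj_t := ?_
    commutator := ?_
    swap := ?_ }⟩⟩
  · intro k q
    by_cases hk : k < m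
    · rw [hθ k hk]
      exact ⟨hωL _, hω _⟩
    · rw [hθ' k hk]
      exact one_mem _
  · intro y
    refine ⟨ω fun i => y i, ⟨hωL _, hω _⟩, fun k q => ?_⟩
    by_cases hk : k < m
    · rw [hθ k hk, hθ k hk, ← map_inv, ← map_mul, ← map_mul]
      congr 1
      ext i : 1
      by_cases hi : i = ⟨k, hk⟩
      · subst hi; simp
      · simp [Pi.mulSingle_eq_of_ne hi]
    · simp [hθ' k hk]
  · intro r s c
    simp only [MonoidHom.comp_apply, MonoidHom.mulSingle_apply, hbs]
    exact wreath_conj_mulSingle r s _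
  · intro r hr s c
    refine ⟨_, _, (wreath_double_commutator hr s (⟨MonoidHom.id C, 1⟩ : C ≀ᵣ C)
      ⟨1, c⟩).trans ?_⟩
    simp only [MonoidHom.comp_apply, MonoidHom.mulSingle_apply, hbs, wreath_commutator]
    rfl
  · intro k hk
    exact ⟨μ ⟨k, hk⟩, ⟨(le_sup_right : _ ≤ L) (Subgroup.subset_closure ⟨_, rfl⟩), hμA _⟩,
      hμ₁ ⟨k, hk⟩, hμ₂ ⟨k, hk⟩⟩

/-- Every centerless subgroup of `K` has a `Room` in `L`. -/
def Rich (K L : Subgroup H) (m : ℕ) : Prop :=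
  ∀ A ≤ K, A ⊓ Subgroup.centralizer (A : Set H) = ⊥ → Nonempty (Room A K L m)

theorem Rich.mono {K L L' : Subgroup H} {m : ℕ} (h : Rich K L m) (hL : L ≤ L') : Rich K L' m :=
  fun A hAK hA => (h A hAK hA).map fun R => R.mono hL

theorem IsHall.exists_rich (hH : IsHall H) (K : Subgroup H) [Finite K] (m : ℕ) :
    ∃ L : Subgroup H, Finite L ∧ Rich K L m := by
  have key : ∀ B : Subgroup K, ∃ L : Subgroup H, Finite L ∧
      (B.map K.subtype ⊓ Subgroup.centralizer (B.map K.subtype : Set H) = ⊥ →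
        Nonempty (Room (B.map K.subtype) K L m)) := by
    intro B
    by_cases hB : B.map K.subtype ⊓ Subgroup.centralizer (B.map K.subtype : Set H) = ⊥
    · obtain ⟨L, hL, hR⟩ := hH.exists_room (Subgroup.map_subtype_le B) hB m
      exact ⟨L, hL, fun _ => hR⟩
    · exact ⟨⊥, inferInstance, fun h => absurd h hB⟩
  choose L hL hR using key
  refine ⟨⨆ B, L B, hH.finite_iSup L hL, fun A hAK hA => ?_⟩
  have h : (A.subgroupOf K).map K.subtype = A := by
    rw [Subgroup.subgroupOf_map_subtype, inf_eq_left.mpr hAK]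
  have := hR (A.subgroupOf K)
  rw [h] at this
  exact (this hA).map fun R => R.mono (le_iSup L _)

end Room

section Absorb

open scoped commutatorElement

/-- The label recording the first `m` values of `a`. -/
def label (m : ℕ) (a : ℕ → Bool) : Label m := fun i =>
  if a i then Multiplicative.ofAdd 1 else 1

theorem label_inv_mul_ne_one {m : ℕ} {a b : ℕ → Bool} {j : ℕ} (hj : j < m) (ha : a j = false)
    (hb : b j = true) : (label m a)⁻¹ * label m b ≠ 1 := by
  intro h
  have := congrFun h ⟨j, hj⟩
  simp only [label, Pi.mul_apply, Pi.inv_apply, ha, hb, Pi.one_apply] at this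
  revert this
  decide

variable {H : Type} [Group H] {A K : ℕ → Subgroup H} {m : ℕ → ℕ}

/-- The `k`-th copies of the groups `Q` of a sequence of rooms, put together. -/
def roomHom (R : ∀ n, Room (A n) (K n) (A (n + 1)) (m n)) (k : ℕ) :
    (∀ n, (R n).Q) →* ∀ n, layer A n :=
  MonoidHom.piMap fun n => ((R n).θ k).codRestrict (layer A n) ((R n).θ_mem k)

theorem roomHom_apply (R : ∀ n, Room (A n) (K n) (A (n + 1)) (m n)) (k : ℕ) (y : ∀ n, (R n).Q)
    (n : ℕ) : (roomHom R k y n : H) = (R n).θ k (y n) := rfl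

theorem layerAut_mem_of_rooms (hA : Monotone A) (hex : ∀ x, ∃ n, x ∈ A n)
    (R : ∀ n, Room (A n) (K n) (A (n + 1)) (m n)) (hm : ∀ n, n ≤ m n)
    {G : Subgroup (MulAut H)} (hG : HasSmallIndex G)
    (h₀ : ∀ c ∈ Subgroup.centralizer (A 0 : Set H), MulAut.conj c ∈ G)
    (ζ : ∀ n, layer A n) (hζ : ∀ n, (ζ n : H) ∈ K n) : layerAut hA hex ζ ∈ G := by
  let Φ := layerAut hA hex
  obtain ⟨k, hk⟩ := hG.exists_conj_mem (fun k => (Φ.comp (roomHom R k)).range) (by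
    intro f hf a
    choose y hy using hf
    choose h hh hconj using fun n => (R n).glue fun k => if a k then y k n else 1
    refine ⟨Φ fun n => ⟨h n, hh n⟩, ?_⟩
    rintro k _ ⟨q, rfl⟩
    have key : Φ (fun n => ⟨h n, hh n⟩) * (Φ.comp (roomHom R k)) q *
        (Φ fun n => ⟨h n, hh n⟩)⁻¹ =
        Φ.comp (roomHom R k) (fun n => (if a k then y k n else 1) * q n *
          (if a k then y k n else 1)⁻¹) := by
      simp only [MonoidHom.comp_apply, ← map_inv, ← map_mul]
      congr 1
      ext n
      exact hconj n k (q n)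
    rw [key, ← hy k]
    by_cases ha : a k
    · simp only [ha, if_true, ← map_inv, ← map_mul]
      rfl
    · simp [ha])
  replace hk : ∀ x y : ∀ n, (R n).Q, Φ (roomHom R k x) ∈ G → Φ (roomHom R k (y * x * y⁻¹)) ∈ G :=
    fun x y hx => by
      simpa only [map_mul, map_inv, MonoidHom.comp_apply] using hk _ ⟨x, rfl⟩ hx _ ⟨y, rfl⟩
  have hcomm : ∀ x y : ∀ n, (R n).Q, Φ (roomHom R k x) ∈ G → Φ (roomHom R k ⁅x, y⁆) ∈ G := by
    intro x y hx
    have h1 : Φ (roomHom R k x⁻¹) ∈ G := by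
      rw [map_inv, map_inv]
      exact G.inv_mem hx
    have h2 := G.mul_mem hx (hk _ y h1)
    rw [← map_mul, ← map_mul] at h2
    rwa [commutatorElement_def, mul_assoc, mul_assoc, ← mul_assoc y]
  let w : (ℕ → Bool) → ∀ n, (R n).Q := fun a n => (R n).t (label (m n) a)
  have hw : ∀ a b, (w a)⁻¹ * w b = fun n => (R n).t ((label (m n) a)⁻¹ * label (m n) b) :=
    fun a b => by
      ext n
      simp [w]
  obtain ⟨a, b, j, ha, hb, hab⟩ := hG.exists_inv_mul_mem fun a => Φ (roomHom R k (w a))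
  rw [← map_inv, ← map_inv, ← map_mul, ← map_mul, hw] at hab
  have hι : ∀ (s : ∀ n, Label (m n))
      (c : ∀ n, ↥(K n ⊓ Subgroup.centralizer (A n : Set H))), (∀ n ≤ j, c n = 1) →
      Φ (roomHom R k fun n => (R n).ι (s n) (c n)) ∈ G := by
    intro s c hc
    have : ∀ n, ∃ y₁ y₂ : (R n).Q,
        ⁅⁅(R n).t ((label (m n) a)⁻¹ * label (m n) b), y₁⁆, y₂⁆ = (R n).ι (s n) (c n) := by
      intro n
      by_cases hn : n ≤ j
      · exact ⟨1, 1, by simp [hc n hn]⟩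
      · exact (R n).commutator _
          (label_inv_mul_ne_one ((not_le.mp hn).trans_le (hm n)) ha hb) _ _
    choose y₁ y₂ hy using this
    have h := hcomm _ y₂ (hcomm _ y₁ hab)
    convert h using 3
    ext n
    exact (hy n).symm
  have hμ : ∀ n, ∃ μ ∈ layer A n, k < m n →
      (∀ c, μ * c * μ⁻¹ = (R n).θ k ((R n).ι 1 c)) ∧
        ∀ s, s ≠ 1 → ∀ c, μ * (R n).θ k ((R n).ι s c) * μ⁻¹ = (R n).θ k ((R n).ι s c) := by
    intro n
    by_cases hn : k < m n
    · obtain ⟨μ, h1, h2⟩ := (R n).swap k hn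
      exact ⟨μ, h1, fun _ => h2⟩
    · exact ⟨1, one_mem _, fun h => absurd h hn⟩
  choose μ hμA hμ using hμ
  let u : ∀ n, layer A n := fun n => ⟨μ n, hμA n⟩
  obtain ⟨a', b', j', ha', hb', hab'⟩ :=
    hG.exists_inv_mul_mem fun a => (Φ u)⁻¹ * Φ (roomHom R k (w a)) * Φ u
  set r := fun n => (label (m n) a')⁻¹ * label (m n) b' with hr
  have hab'' : Φ (u⁻¹ * roomHom R k (fun n => (R n).t (r n)) * u) ∈ G := by
    rw [← hw]
    convert hab' using 1
    simp only [map_mul, map_inv]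
    group
  obtain ⟨N, hjN, hjN', hkN⟩ : ∃ N, j < N ∧ j' < N ∧ k < N :=
    ⟨j + j' + k + 1, by omega, by omega, by omega⟩
  let ζ₁ : ∀ n, layer A n := fun n => if n < N then ζ n else 1
  let ζ₂ : ∀ n, layer A n := fun n => if n < N then 1 else ζ n
  have hζ₁₂ : ζ = ζ₁ * ζ₂ := by
    ext n
    by_cases hn : n < N <;> simp [ζ₁, ζ₂, hn]
  have h1 : Φ ζ₁ ∈ G := by
    rw [show Φ ζ₁ = _ from layerAut_eq_conj hA hex (N := N) fun n hn => by
      simp [ζ₁, not_lt.mpr hn]]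
    exact h₀ _ (partialProd_mem_centralizer hA _ _)
  have h2 := hι r (fun n => if n < N then 1 else ⟨ζ n, hζ n, (ζ n).2.2⟩) fun n hn => by
    simp [hn.trans_lt hjN]
  have h3 : Φ ζ₂ ∈ G := by
    set v := u⁻¹ * roomHom R k (fun n => (R n).t (r n)) * u with hv
    have h4 : v * ζ₂ * v⁻¹ = roomHom R k fun n => (R n).ι (r n)
        (if n < N then 1 else ⟨ζ n, hζ n, (ζ n).2.2⟩) := by
      ext n
      by_cases hn : n < N
      · simp [ζ₂, hn, roomHom_apply]
      · have hNn : N ≤ n := not_lt.mp hn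
        have hkm : k < m n := hkN.trans_le (hNn.trans (hm n))
        have hrn : r n ≠ 1 := label_inv_mul_ne_one (hjN'.trans_le (hNn.trans (hm n))) ha' hb'
        obtain ⟨hμ1, hμ2⟩ := hμ n hkm
        set c : ↥(K n ⊓ Subgroup.centralizer (A n : Set H)) := ⟨ζ n, hζ n, (ζ n).2.2⟩ with hc
        have e1 := hμ1 c
        have e2 := congrArg ((R n).θ k) ((R n).conj_t (r n) 1 c)
        rw [mul_one, map_mul, map_mul, map_inv, ← e1] at e2
        have e3 := hμ2 (r n) hrn c
        have e4 : ((v * ζ₂ * v⁻¹) n : H) = (μ n)⁻¹ * ((R n).θ k ((R n).t (r n)) *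
            (μ n * c * (μ n)⁻¹) * ((R n).θ k ((R n).t (r n)))⁻¹) * μ n := by
          simp only [v, u, ζ₂, hn, hc, Pi.mul_apply, Pi.inv_apply, Subgroup.coe_mul,
            InvMemClass.coe_inv, roomHom_apply, if_false]
          group
        rw [e4, e2, roomHom_apply, if_neg hn, ← hc]
        nth_rewrite 1 [← e3]
        group
    rw [← h4, map_mul, map_mul, map_inv] at h2
    have := G.mul_mem (G.mul_mem (G.inv_mem hab'') h2) hab''
    convert this using 1
    group
  rw [hζ₁₂, map_mul]
  exact G.mul_mem h1 h3

end Absorb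

section Weave

variable {H : Type} [Group H] {M : ℕ → Subgroup H}

theorem conj_eq_of_le (hM : Monotone M) {p : ℕ → H}
    (hp : ∀ n, (p n)⁻¹ * p (n + 1) ∈ Subgroup.centralizer (M n : Set H)) {n k : ℕ} (hnk : n ≤ k)
    {x : H} (hx : x ∈ M n) : p k * x * (p k)⁻¹ = p n * x * (p n)⁻¹ := by
  induction k, hnk using Nat.le_induction with
  | base => rfl
  | succ k hk ih =>
    rw [← ih]
    have h := Subgroup.mem_centralizer_iff.mp (hp k) x (hM hk hx)
    calc p (k + 1) * x * (p (k + 1))⁻¹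
        = p k * ((p k)⁻¹ * p (k + 1) * x) * ((p k)⁻¹ * p (k + 1))⁻¹ * (p k)⁻¹ := by group
      _ = p k * x * (p k)⁻¹ := by rw [← h]; group

theorem exists_mem_of_rich_aux (hM : Monotone M) (hex : ∀ x, ∃ n, x ∈ M n)
    (hcl : ∀ n, M n ⊓ Subgroup.centralizer (M n : Set H) = ⊥)
    {m : ℕ → ℕ} (hm : ∀ n, n ≤ m n) (hrich : ∀ n, Rich (M (n + 1)) (M (n + 2)) (m n))
    {G : Subgroup (MulAut H)} (hG : HasSmallIndex G)
    (h₀ : ∀ c ∈ Subgroup.centralizer (M 0 : Set H), MulAut.conj c ∈ G)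
    (p : ℕ → H) (hpM : ∀ n, p n ∈ M n) (hp₀ : p 0 = 1)
    (hp : ∀ n, (p n)⁻¹ * p (n + 1) ∈ Subgroup.centralizer (M n : Set H)) :
    ∃ w ∈ G, ∀ n, ∀ x ∈ M n, w x = p n * x * (p n)⁻¹ := by
  have hζ : ∀ n, (p n)⁻¹ * p (n + 1) ∈ M (n + 1) := fun n =>
    mul_mem (inv_mem (hM n.le_succ (hpM n))) (hpM (n + 1))
  let A : ℕ → Subgroup H := fun i => M (2 * i)
  let B : ℕ → Subgroup H := fun i => M (2 * i + 1)
  have hA : Monotone A := fun i j h => hM (Nat.mul_le_mul_left 2 h)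
  have hB : Monotone B := fun i j h => hM (Nat.succ_le_succ (Nat.mul_le_mul_left 2 h))
  have hexA : ∀ x, ∃ n, x ∈ A n := fun x => (hex x).imp fun n hn => hM (by omega) hn
  have hexB : ∀ x, ∃ n, x ∈ B n := fun x => (hex x).imp fun n hn => hM (by omega) hn
  let ε : ∀ i, layer A i := fun i => ⟨(p (2 * i))⁻¹ * p (2 * i + 1), hM (by omega) (hζ _), hp _⟩
  let δ : ∀ i, layer B i := fun i =>
    ⟨(p (2 * i + 1))⁻¹ * p (2 * i + 2), hM (by omega) (hζ (2 * i + 1)), hp (2 * i + 1)⟩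
  have hε : layerAut hA hexA ε ∈ G :=
    layerAut_mem_of_rooms hA hexA (K := fun i => M (2 * i + 1)) (m := fun i => m (2 * i))
      (fun i => (hrich (2 * i) _ (hM (Nat.le_succ _)) (hcl _)).some)
      (fun i => (by omega : i ≤ 2 * i).trans (hm _)) hG h₀ ε (fun i => hζ _)
  have hδ : layerAut hB hexB δ ∈ G :=
    layerAut_mem_of_rooms hB hexB (K := fun i => M (2 * i + 2)) (m := fun i => m (2 * i + 1))
      (fun i => (hrich (2 * i + 1) _ (hM (Nat.le_succ _)) (hcl _)).some)
      (fun i => (by omega : i ≤ 2 * i + 1).trans (hm _)) hG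
      (fun c hc => h₀ c (Subgroup.centralizer_le (hM (Nat.zero_le _)) hc)) δ
      (fun i => hζ (2 * i + 1))
  have hδM : ∀ n, partialProd δ n ∈ M (2 * n) := by
    intro n
    induction n with
    | zero => exact one_mem _
    | succ n ih => exact mul_mem (hM (by omega) ih) (hζ (2 * n + 1))
  have hprod : ∀ n, p (2 * n) = partialProd ε n * partialProd δ n := by
    intro n
    induction n with
    | zero => simp [partialProd, hp₀]
    | succ n ih =>
      have h1 : Commute (partialProd δ n) (ε n) := layer_commute (ε n) (hδM n)
      calc p (2 * (n + 1)) = p (2 * n) * (ε n : H) * δ n := by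
            simp only [ε, δ, mul_inv_cancel_left]
            rfl
        _ = partialProd ε n * (partialProd δ n * ε n) * δ n := by rw [ih]; group
        _ = partialProd ε n * ε n * (partialProd δ n * δ n) := by rw [h1.eq]; group
        _ = partialProd ε (n + 1) * partialProd δ (n + 1) := rfl
  refine ⟨layerAut hA hexA ε * layerAut hB hexB δ, G.mul_mem hε hδ, fun n x hx => ?_⟩
  have hx' : x ∈ M (2 * n) := hM (by omega) hx
  rw [← conj_eq_of_le hM hp (by omega : n ≤ 2 * n) hx, hprod, MulAut.mul_apply,
    layerAut_apply hB hexB δ (n := n) (hM (Nat.le_succ _) hx'),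
    layerAut_apply hA hexA ε (n := n)
      (mul_mem (mul_mem (hδM n) hx') (inv_mem (hδM n)))]
  group

theorem exists_mem_of_rich (hM : Monotone M) (hex : ∀ x, ∃ n, x ∈ M n)
    (hcl : ∀ n, M n ⊓ Subgroup.centralizer (M n : Set H) = ⊥)
    {m : ℕ → ℕ} (hm : ∀ n, n ≤ m n) (hrich : ∀ n, Rich (M (n + 1)) (M (n + 2)) (m n))
    {G : Subgroup (MulAut H)} (hG : HasSmallIndex G)
    (h₀ : ∀ c ∈ Subgroup.centralizer (M 0 : Set H), MulAut.conj c ∈ G)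
    (p : ℕ → H) (hpM : ∀ n, p n ∈ M n) (hp₀ : MulAut.conj (p 0) ∈ G)
    (hp : ∀ n, (p n)⁻¹ * p (n + 1) ∈ Subgroup.centralizer (M n : Set H)) :
    ∃ w ∈ G, ∀ n, ∀ x ∈ M n, w x = p n * x * (p n)⁻¹ := by
  obtain ⟨w, hw, h⟩ := exists_mem_of_rich_aux hM hex hcl hm hrich hG h₀ (fun n => (p 0)⁻¹ * p n)
    (fun n => mul_mem (inv_mem (hM n.zero_le (hpM 0))) (hpM n)) (by simp)
    (fun n => by simpa [mul_assoc] using hp n)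
  refine ⟨MulAut.conj (p 0) * w, G.mul_mem hp₀ hw, fun n x hx => ?_⟩
  rw [MulAut.mul_apply, h n x hx, MulAut.conj_apply]
  group

end Weave

section Open

variable {H : Type} [Group H]

theorem IsHall.exists_seq (hH : IsHall H) [Countable H] {B : Subgroup H} [Finite B]
    (hB : B ⊓ Subgroup.centralizer (B : Set H) = ⊥) (s : ℕ → MulAut H) :
    ∃ (L : ℕ → Subgroup H) (g : ℕ → H), L 0 = B ∧ g 0 = 1 ∧ Monotone L ∧
      (∀ x, ∃ n, x ∈ L n) ∧ (∀ n, L n ⊓ Subgroup.centralizer (L n : Set H) = ⊥) ∧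
      (∀ n, g n ∈ L n) ∧ (∀ n, Rich (L n) (L (n + 1)) n) ∧
      ∀ n, ∀ f ∈ L n, s n (g n * f * (g n)⁻¹) = g (n + 1) * f * (g (n + 1))⁻¹ := by
  obtain ⟨e, he⟩ := exists_surjective_nat H
  obtain ⟨σ, hσ₀, hσ, hstep⟩ := exists_seq_of_step
    (fun _ (x : Subgroup H × H) => Finite x.1 ∧
      x.1 ⊓ Subgroup.centralizer (x.1 : Set H) = ⊥ ∧ x.2 ∈ x.1)
    (fun n x y => x.1 ≤ y.1 ∧ e n ∈ y.1 ∧ Rich x.1 y.1 n ∧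
      ∀ f ∈ x.1, s n (x.2 * f * x.2⁻¹) = y.2 * f * y.2⁻¹) (B, 1)
    ⟨inferInstance, hB, one_mem _⟩ (by
      rintro n ⟨K, g⟩ ⟨hK, hKc, hg⟩
      obtain ⟨g', hg'⟩ := hH.exists_conj K.subtype
        ((s n).toMonoidHom.comp ((MulAut.conj g).toMonoidHom.comp K.subtype)) K.subtype_injective
        ((s n).injective.comp ((MulAut.conj g).injective.comp K.subtype_injective))
      obtain ⟨R, hR, hKR⟩ := hH.exists_rich K n
      have := hH.finite_closure_set (Set.toFinite {e n, g'})
      have := hH.finite_sup R (Subgroup.closure {e n, g'})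
      have := hH.finite_sup K (R ⊔ Subgroup.closure {e n, g'})
      obtain ⟨L, hL, hle, hLc⟩ := hH.exists_centerless (K ⊔ (R ⊔ Subgroup.closure {e n, g'}))
      have hKL : K ≤ L := le_sup_left.trans hle
      have hRL : R ≤ L := le_sup_left.trans (le_sup_right.trans hle)
      have hsub : ({e n, g'} : Set H) ⊆ L := Subgroup.subset_closure.trans
        (SetLike.coe_subset_coe.mpr (le_sup_right.trans (le_sup_right.trans hle)))
      exact ⟨(L, g'), ⟨hL, hLc, hsub (by simp)⟩, hKL, hsub (by simp), hKR.mono hRL,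
        fun f hf => hg' ⟨f, hf⟩⟩)
  refine ⟨fun n => (σ n).1, fun n => (σ n).2, by simp [hσ₀], by simp [hσ₀],
    monotone_nat_of_le_succ fun n => (hstep n).1, fun x => ?_, fun n => (hσ n).2.1,
    fun n => (hσ n).2.2, fun n => (hstep n).2.2.1, fun n => (hstep n).2.2.2⟩
  obtain ⟨n, rfl⟩ := he x
  exact ⟨n + 1, (hstep n).2.1⟩

theorem inv_mul_mem_centralizer_of_conj_eq {L : Subgroup H} {g h : H}
    (hgh : ∀ f ∈ L, g * f * g⁻¹ = h * f * h⁻¹) :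
    g⁻¹ * h ∈ Subgroup.centralizer (L : Set H) := by
  rw [Subgroup.mem_centralizer_iff]
  intro f hf
  calc f * (g⁻¹ * h) = g⁻¹ * (g * f * g⁻¹) * h := by group
    _ = g⁻¹ * h * f := by rw [hgh f hf]; group

theorem IsHall.pointwiseStabilizer_le_of_centerless (hH : IsHall H) [Countable H]
    {G : Subgroup (MulAut H)} (hG : HasSmallIndex G) {B : Subgroup H} [Finite B]
    (hB : B ⊓ Subgroup.centralizer (B : Set H) = ⊥)
    (h₀ : ∀ c ∈ Subgroup.centralizer (B : Set H), MulAut.conj c ∈ G) :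
    pointwiseStabilizer B ≤ G := by
  intro v hv
  replace hv : ∀ b ∈ B, v b = b := hv
  obtain ⟨L, g, rfl, hg₀, hL, hex, hcl, hgL, hrich, hs⟩ :=
    hH.exists_seq hB fun n => if Even n then v else v⁻¹
  have hs₀ : ∀ n, ∀ f ∈ L (2 * n), v (g (2 * n) * f * (g (2 * n))⁻¹) =
      g (2 * n + 1) * f * (g (2 * n + 1))⁻¹ := fun n f hf => by
    simpa using hs (2 * n) f hf
  have hg₂ : ∀ n, (g n)⁻¹ * g (n + 2) ∈ Subgroup.centralizer (L n : Set H) := by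
    intro n
    apply inv_mul_mem_centralizer_of_conj_eq
    intro f hf
    rw [← hs (n + 1) f (hL n.le_succ hf), ← hs n f hf]
    by_cases hn : Even n <;> simp [hn, Nat.even_add_one, MulAut.inv_def]
  obtain ⟨α, hα, hα'⟩ := exists_mem_of_rich (M := fun n => L (2 * n)) (p := fun n => g (2 * n))
    (fun i j h => hL (Nat.mul_le_mul_left 2 h)) (fun x => (hex x).imp fun n hn => hL (by omega) hn)
    (fun n => hcl _) (m := fun n => 2 * (n + 1)) (fun n => by omega)
    (fun n => (hrich (2 * (n + 1))).mono (hL (by omega))) hG h₀ (fun n => hgL _)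
    (by simp [hg₀, one_mem]) (fun n => hg₂ (2 * n))
  have hg₁ : g 1 ∈ Subgroup.centralizer (L 0 : Set H) := by
    rw [← one_mul (g 1), ← inv_one]
    apply inv_mul_mem_centralizer_of_conj_eq
    intro f hf
    rw [← hs₀ 0 f hf]
    simp [hg₀, hv f hf]
  obtain ⟨β, hβ, hβ'⟩ := exists_mem_of_rich (M := fun n => L (2 * n + 1))
    (p := fun n => g (2 * n + 1)) (fun i j h => hL (Nat.succ_le_succ (Nat.mul_le_mul_left 2 h)))
    (fun x => (hex x).imp fun n hn => hL (by omega) hn)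
    (fun n => hcl _) (m := fun n => 2 * (n + 1) + 1) (fun n => by omega)
    (fun n => (hrich (2 * (n + 1) + 1)).mono (hL (by omega))) hG
    (fun c hc => h₀ c (Subgroup.centralizer_le (hL (Nat.zero_le _)) hc)) (fun n => hgL _)
    (h₀ _ hg₁) (fun n => hg₂ (2 * n + 1))
  have : v = β * α⁻¹ := by
    rw [eq_mul_inv_iff_mul_eq]
    ext x
    obtain ⟨n, hn⟩ := hex x
    have hn' : x ∈ L (2 * n) := hL (by omega) hn
    rw [MulAut.mul_apply, hα' n x hn', hs₀ n x hn', hβ' n x (hL (Nat.le_succ _) hn')]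
  rw [this]
  exact G.mul_mem hβ (G.inv_mem hα)

theorem IsHall.exists_pointwiseStabilizer_le (hH : IsHall H) [Countable H]
    {G : Subgroup (MulAut H)} (hG : HasSmallIndex G) :
    ∃ B : Subgroup H, Finite B ∧ pointwiseStabilizer B ≤ G := by
  obtain ⟨K, hK, hKG⟩ := hH.exists_conj_centralizer_mem hG
  obtain ⟨B, hB, hKB, hBc⟩ := hH.exists_centerless K
  exact ⟨B, hB, hH.pointwiseStabilizer_le_of_centerless hG hBc fun c hc =>
    hKG c (Subgroup.centralizer_le hKB hc)⟩

end Open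

/-- The permutation `π` acting on the second coordinate of `E × J`. -/
def sidePerm (E : Type) {J : Type} (π : E → Equiv.Perm J) : Equiv.Perm (E × J) where
  toFun x := (x.1, π x.1 x.2)
  invFun x := (x.1, (π x.1).symm x.2)
  left_inv x := by simp
  right_inv x := by simp

@[simp]
theorem sidePerm_apply {E J : Type} (π : E → Equiv.Perm J) (x : E × J) :
    sidePerm E π x = (x.1, π x.1 x.2) := rfl

@[simp]
theorem sidePerm_inv_apply {E J : Type} (π : E → Equiv.Perm J) (x : E × J) :
    (sidePerm E π)⁻¹ x = (x.1, (π x.1).symm x.2) := rfl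

section Slices

variable {E J : Type} [Group E]

/-- The permutation of `E × J` acting on the slice `E × {j}` as left multiplication by `f j`. -/
def slicePerm (E J : Type) [Group E] : (J → E) →* Equiv.Perm (E × J) where
  toFun f :=
    { toFun := fun x => (f x.2 * x.1, x.2)
      invFun := fun x => ((f x.2)⁻¹ * x.1, x.2)
      left_inv := fun x => by simp
      right_inv := fun x => by simp }
  map_one' := Equiv.ext fun x => by simp
  map_mul' f g := Equiv.ext fun x => by simp [mul_assoc]

@[simp]
theorem slicePerm_apply (f : J → E) (x : E × J) : slicePerm E J f x = (f x.2 * x.1, x.2) := rfl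

/-- Left multiplication on the first coordinate of `E × J`. -/
def leftPerm (E J : Type) [Group E] : E →* Equiv.Perm (E × J) :=
  (slicePerm E J).comp (Pi.constMonoidHom J E)

@[simp]
theorem leftPerm_apply (g : E) (x : E × J) : leftPerm E J g x = (g * x.1, x.2) := rfl

theorem leftPerm_injective [Nonempty J] : Function.Injective (leftPerm E J) := by
  intro g h hgh
  obtain ⟨j⟩ := ‹Nonempty J›
  simpa using congrArg (fun τ : Equiv.Perm (E × J) => (τ (1, j)).1) hgh

theorem sidePerm_mem_centralizer {π : E → Equiv.Perm J} {B : Subgroup E}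
    (hπ : ∀ b ∈ B, ∀ x, π (b * x) = π x) :
    sidePerm E π ∈ Subgroup.centralizer (B.map (leftPerm E J) : Set (Equiv.Perm (E × J))) := by
  rw [Subgroup.mem_centralizer_iff]
  rintro _ ⟨b, hb, rfl⟩
  ext x <;> simp [hπ b hb]

theorem const_mem_of_mulSingle_div_mem [Finite J] [DecidableEq J] {g : E}
    (hg : g ^ Nat.card J = 1) (N : Subgroup (J → E)) (t : J)
    (h : ∀ j, Pi.mulSingle t g * (Pi.mulSingle j g)⁻¹ ∈ N) : (fun _ => g) ∈ N := by
  cases nonempty_fintype J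
  let κ : (J → Multiplicative ℤ) →* (J → E) := (zpowersHom E g).compLeft J
  let c : Multiplicative ℤ := Multiplicative.ofAdd 1
  have hκ : ∀ j, κ (Pi.mulSingle j c) = Pi.mulSingle j g := by
    intro j
    ext i
    by_cases hi : i = j
    · subst hi; simp [κ, c]
    · simp [κ, Pi.mulSingle_eq_of_ne hi]
  have h1 : (fun _ => c) = (∏ j, (Pi.mulSingle t c * (Pi.mulSingle j c)⁻¹)⁻¹) *
      (Pi.mulSingle t c : J → Multiplicative ℤ) ^ Fintype.card J := by
    rw [← Finset.univ_prod_mulSingle fun _ : J => c, ← Finset.card_univ, ← Finset.prod_const,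
      ← Finset.prod_mul_distrib]
    simp
  have h2 : κ (fun _ => c) = fun _ => g := by
    ext i
    simp [κ, c]
  rw [← h2, h1, map_mul]
  apply N.mul_mem
  · change _ ∈ N.comap κ
    refine Subgroup.prod_mem _ fun j _ => Subgroup.inv_mem _ ?_
    rw [Subgroup.mem_comap, map_mul, map_inv, hκ, hκ]
    exact h j
  · rw [map_pow, hκ, ← Pi.mulSingle_pow, ← Nat.card_eq_fintype_card, hg, Pi.mulSingle_one]
    exact one_mem N

end Slices

section Intersection

variable {E : Type} [Group E]

/-- The index set for the permutation representation used to factor centralizers. -/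
abbrev CosetIndex (B : Subgroup E) : Type := ((E ⧸ B) ⊕ Bool) × E

/-- The index of the right coset of `B` containing `y`. -/
def cosetIndex (B : Subgroup E) (y : E) : CosetIndex B := (Sum.inl (QuotientGroup.mk y⁻¹), 1)

theorem cosetIndex_eq_iff {B : Subgroup E} {y z : E} :
    cosetIndex B y = cosetIndex B z ↔ y * z⁻¹ ∈ B := by
  simp [cosetIndex, QuotientGroup.eq]

theorem cosetIndex_mul {B : Subgroup E} {b : E} (hb : b ∈ B) (y : E) :
    cosetIndex B (b * y) = cosetIndex B y := by
  rw [cosetIndex_eq_iff]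
  simpa using hb

variable {A B : Subgroup E}

open Classical in
/-- The map sending `(a * y, cosetIndex B y)` to `(a * h * y, cosetIndex B (h * y))` for `a ∈ A`. -/
noncomputable def twist (A B : Subgroup E) (h : E) (x : E × CosetIndex B) : E × CosetIndex B :=
  if H : ∃ a ∈ A, cosetIndex B (a⁻¹ * x.1) = x.2 then
    (H.choose * (h * (H.choose⁻¹ * x.1)), cosetIndex B (h * (H.choose⁻¹ * x.1)))
  else x

theorem twist_apply {h : E} (hh : h ∈ Subgroup.centralizer (A ⊓ B : Subgroup E)) {a : E}
    (ha : a ∈ A) (y : E) :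
    twist A B h (a * y, cosetIndex B y) = (a * (h * y), cosetIndex B (h * y)) := by
  have H : ∃ a' ∈ A, cosetIndex B (a'⁻¹ * (a * y)) = cosetIndex B y := ⟨a, ha, by simp⟩
  rw [twist, dif_pos H]
  set a' := H.choose
  have ha' : a' ∈ A := H.choose_spec.1
  have hb : cosetIndex B (a'⁻¹ * (a * y)) = cosetIndex B y := H.choose_spec.2
  have hc : a'⁻¹ * a ∈ A ⊓ B := by
    refine Subgroup.mem_inf.mpr ⟨A.mul_mem (A.inv_mem ha') ha, ?_⟩
    simpa [mul_assoc] using cosetIndex_eq_iff.mp hb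
  have hcomm := Subgroup.mem_centralizer_iff.mp hh _ hc
  have e : h * (a'⁻¹ * (a * y)) = (a'⁻¹ * a) * (h * y) := by
    rw [← mul_assoc, ← mul_assoc, ← mul_assoc, hcomm, mul_assoc h]
  rw [e, cosetIndex_mul hc.2]
  simp [mul_assoc]

theorem twist_of_not {h : E} {x : E × CosetIndex B}
    (hx : ¬ ∃ a ∈ A, cosetIndex B (a⁻¹ * x.1) = x.2) : twist A B h x = x := dif_neg hx

theorem twist_cases (A : Subgroup E) {B : Subgroup E} (x : E × CosetIndex B) :
    (∃ a ∈ A, ∃ y, x = (a * y, cosetIndex B y)) ∨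
      ¬ ∃ a ∈ A, cosetIndex B (a⁻¹ * x.1) = x.2 := by
  by_cases hx : ∃ a ∈ A, cosetIndex B (a⁻¹ * x.1) = x.2
  · obtain ⟨a, ha, h⟩ := hx
    exact Or.inl ⟨a, ha, a⁻¹ * x.1, Prod.ext (by simp) h.symm⟩
  · exact Or.inr hx

theorem twist_twist_inv {h : E} (hh : h ∈ Subgroup.centralizer (A ⊓ B : Subgroup E))
    (x : E × CosetIndex B) : twist A B h (twist A B h⁻¹ x) = x := by
  rcases twist_cases A x with ⟨a, ha, y, rfl⟩ | hx
  · rw [twist_apply (inv_mem hh) ha, twist_apply hh ha]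
    simp
  · rw [twist_of_not hx, twist_of_not hx]

/-- `twist` as a permutation. -/
noncomputable def twistPerm {h : E} (hh : h ∈ Subgroup.centralizer (A ⊓ B : Subgroup E)) :
    Equiv.Perm (E × CosetIndex B) where
  toFun := twist A B h
  invFun := twist A B h⁻¹
  left_inv x := by simpa using twist_twist_inv (inv_mem hh) x
  right_inv x := twist_twist_inv hh x

theorem twistPerm_mem_centralizer {h : E}
    (hh : h ∈ Subgroup.centralizer (A ⊓ B : Subgroup E)) :
    twistPerm hh ∈ Subgroup.centralizer
      (A.map (leftPerm E (CosetIndex B)) : Set (Equiv.Perm (E × CosetIndex B))) := by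
  rw [Subgroup.mem_centralizer_iff]
  rintro _ ⟨b, hb, rfl⟩
  refine Equiv.ext fun x => ?_
  change leftPerm E _ b (twist A B h x) = twist A B h (leftPerm E _ b x)
  rcases twist_cases A x with ⟨a, ha, y, rfl⟩ | hx
  · rw [twist_apply hh ha, leftPerm_apply, leftPerm_apply]
    simp only
    rw [← mul_assoc b a y, twist_apply hh (A.mul_mem hb ha), mul_assoc]
  · rw [twist_of_not hx, twist_of_not]
    rintro ⟨a, ha, h⟩
    refine hx ⟨b⁻¹ * a, A.mul_mem (A.inv_mem hb) ha, ?_⟩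
    have h' : cosetIndex B (a⁻¹ * (b * x.1)) = x.2 := h
    simpa [mul_assoc] using h'

open Classical in
/-- The permutation exchanging `(y, cosetIndex B y)` and `(y, t)`. -/
noncomputable def exchangePerm (B : Subgroup E) (t : CosetIndex B) :
    Equiv.Perm (E × CosetIndex B) :=
  sidePerm E fun y => Equiv.swap (cosetIndex B y) t

theorem exchangePerm_mem_centralizer (t : CosetIndex B) :
    exchangePerm B t ∈ Subgroup.centralizer
      (B.map (leftPerm E (CosetIndex B)) : Set (Equiv.Perm (E × CosetIndex B))) :=
  sidePerm_mem_centralizer fun b hb x => by rw [cosetIndex_mul hb]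

open Classical in
theorem exchange_twist_exchange {h : E} (hh : h ∈ Subgroup.centralizer (A ⊓ B : Subgroup E))
    {t : CosetIndex B} (ht : ∀ y, cosetIndex B y ≠ t) (x : E × CosetIndex B) :
    exchangePerm B t (twist A B h (exchangePerm B t x)) =
      if x.2 = t then (h * x.1, t) else if x.2 = cosetIndex B x.1 then x else twist A B h x := by
  have htw : ∀ z : E, twist A B h (z, t) = (z, t) := fun z =>
    twist_of_not fun ⟨a, _, h⟩ => ht _ h
  have htw' : ∀ z, twist A B h (z, cosetIndex B z) = (h * z, cosetIndex B (h * z)) := fun z => by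
    simpa using twist_apply hh (one_mem A) z
  have hex : ∀ z : E, exchangePerm B t (z, t) = (z, cosetIndex B z) := fun z => by
    simp [exchangePerm]
  have hex' : ∀ z : E, exchangePerm B t (z, cosetIndex B z) = (z, t) := fun z => by
    simp [exchangePerm]
  have hex'' : ∀ x : E × CosetIndex B, x.2 ≠ t → x.2 ≠ cosetIndex B x.1 →
      exchangePerm B t x = x := fun x h1 h2 => by
    simp [exchangePerm, Equiv.swap_apply_of_ne_of_ne h2 h1]
  obtain ⟨z, j⟩ := x
  split_ifs with h1 h2
  · obtain rfl : j = t := h1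
    rw [hex, htw', hex']
  · obtain rfl : j = cosetIndex B z := h2
    rw [hex', htw, hex]
  · rw [hex'' _ h1 h2, hex'']
    · rcases twist_cases A (z, j) with ⟨a, ha, y, hy⟩ | hx
      · rw [hy, twist_apply hh ha]
        exact ht _
      · rwa [twist_of_not hx]
    · intro h3
      apply h2
      have h4 := twist_twist_inv (inv_mem hh) (z, j)
      rw [inv_inv] at h4
      have h5 : twist A B h (z, j) = (1 * (twist A B h (z, j)).1,
          cosetIndex B (twist A B h (z, j)).1) := Prod.ext (by simp) h3
      rw [h5, twist_apply (inv_mem hh) (one_mem A)] at h4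
      simp only [one_mul] at h4
      have h6 := congrArg Prod.fst h4
      have h7 := congrArg Prod.snd h4
      simp only at h6 h7
      rw [h6] at h7
      exact h7.symm

theorem leftPerm_mem_sup_centralizer [Finite E] {g : E}
    (hg : g ∈ Subgroup.centralizer (A ⊓ B : Subgroup E)) :
    leftPerm E (CosetIndex B) g ∈
      Subgroup.centralizer
        (A.map (leftPerm E (CosetIndex B)) : Set (Equiv.Perm (E × CosetIndex B))) ⊔
      Subgroup.centralizer
        (B.map (leftPerm E (CosetIndex B)) : Set (Equiv.Perm (E × CosetIndex B))) := by
  classical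
  set J := CosetIndex B with hJ
  set N := Subgroup.centralizer (A.map (leftPerm E J) : Set (Equiv.Perm (E × J))) ⊔
    Subgroup.centralizer (B.map (leftPerm E J) : Set (Equiv.Perm (E × J))) with hN
  let t : Bool → J := fun i => (Sum.inr i, 1)
  have ht : ∀ i y, cosetIndex B y ≠ t i := fun i y h => by
    simp [cosetIndex, t] at h
  have htt : t true ≠ t false := fun h => by
    have h' := congrArg Prod.fst h
    simp [t] at h'
  have hu : twistPerm hg ∈ N := (le_sup_left : _ ≤ N) (twistPerm_mem_centralizer hg)
  have hk : ∀ i, exchangePerm B (t i) ∈ N := fun i =>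
    (le_sup_right : _ ≤ N) (exchangePerm_mem_centralizer _)
  have hη : slicePerm E J (Pi.mulSingle (t true) g * (Pi.mulSingle (t false) g)⁻¹) ∈ N := by
    have h1 := fun i => N.mul_mem (N.mul_mem (hk i) hu) (hk i)
    have h2 := N.mul_mem (h1 true) (N.inv_mem (h1 false))
    convert h2 using 1
    rw [eq_mul_inv_iff_mul_eq]
    refine Equiv.ext fun x => ?_
    simp only [Equiv.Perm.mul_apply]
    change slicePerm E J _ (exchangePerm B (t false) (twist A B g (exchangePerm B (t false) x))) =
      exchangePerm B (t true) (twist A B g (exchangePerm B (t true) x))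
    rw [exchange_twist_exchange hg (ht _), exchange_twist_exchange hg (ht _)]
    obtain ⟨y, j⟩ := x
    by_cases h1 : j = t true
    · subst h1
      have h3 : ¬ ∃ a ∈ A, cosetIndex B (a⁻¹ * y) = t true := fun ⟨a, _, h⟩ => ht _ _ h
      rw [twist_of_not (x := (y, t true)) h3, if_neg htt, if_neg (ht true y).symm, if_pos rfl,
        slicePerm_apply]
      simp [Pi.mulSingle_eq_of_ne htt]
    by_cases h2 : j = t false
    · subst h2
      have h3 : ¬ ∃ a ∈ A, cosetIndex B (a⁻¹ * y) = t false := fun ⟨a, _, h⟩ => ht _ _ h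
      rw [twist_of_not (x := (y, t false)) h3, if_pos rfl, if_neg htt.symm,
        if_neg (ht false y).symm, slicePerm_apply]
      simp [Pi.mulSingle_eq_of_ne htt.symm]
    have h3 : ∀ z : E × J, z.2 ≠ t true → z.2 ≠ t false →
        slicePerm E J (Pi.mulSingle (t true) g * (Pi.mulSingle (t false) g)⁻¹) z = z := by
      intro z h h'
      rw [slicePerm_apply]
      simp [Pi.mulSingle_eq_of_ne h, Pi.mulSingle_eq_of_ne h']
    simp only [h1, h2, if_false]
    split_ifs with h4
    · exact h3 _ h1 h2
    · apply h3
      all_goals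
        rcases twist_cases A (y, j) with ⟨a, ha, z, hz⟩ | hx
        · rw [hz, twist_apply hg ha]
          exact ht _ _
        · rwa [twist_of_not hx]
  have hcard : g ^ Nat.card J = 1 := by
    rw [hJ, Nat.card_prod, mul_comm, pow_mul, pow_card_eq_one', one_pow]
  refine const_mem_of_mulSingle_div_mem hcard (N.comap (slicePerm E J)) (t true) fun j => ?_
  rw [Subgroup.mem_comap]
  by_cases hj : j = t true
  · subst hj
    simp [one_mem]
  let π : Equiv.Perm (E × J) := sidePerm E fun _ => Equiv.swap j (t false)
  have hπ : π ∈ N := (le_sup_left : _ ≤ N) (sidePerm_mem_centralizer fun _ _ _ => rfl)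
  convert N.mul_mem (N.mul_mem hπ hη) (N.inv_mem hπ) using 1
  rw [eq_mul_inv_iff_mul_eq]
  refine Equiv.ext fun x => ?_
  obtain ⟨y, i⟩ := x
  have e1 : (Pi.mulSingle (t true) g : J → E) (Equiv.swap j (t false) i) =
      (Pi.mulSingle (t true) g : J → E) i := by
    have : Equiv.swap j (t false) i = t true ↔ i = t true := by
      rw [Equiv.swap_apply_eq_iff, Equiv.swap_apply_of_ne_of_ne (Ne.symm hj) htt]
    simp only [Pi.mulSingle_apply, this]
  have e2 : (Pi.mulSingle j g : J → E) (Equiv.swap j (t false) i) =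
      (Pi.mulSingle (t false) g : J → E) i := by
    have : Equiv.swap j (t false) i = j ↔ i = t false := by
      rw [Equiv.swap_apply_eq_iff, Equiv.swap_apply_left]
    simp only [Pi.mulSingle_apply, this]
  simp only [Equiv.Perm.mul_apply, slicePerm_apply, π, sidePerm_apply, Pi.mul_apply,
    Pi.inv_apply, e1, e2]

theorem IsHall.mem_sup_centralizer {H : Type} [Group H] (hH : IsHall H) (A B : Subgroup H)
    [Finite A] [Finite B] {g : H} (hg : g ∈ Subgroup.centralizer (A ⊓ B : Subgroup H)) :
    g ∈ Subgroup.centralizer (A : Set H) ⊔ Subgroup.centralizer (B : Set H) := by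
  have := hH.finite_sup A B
  have := hH.finite_closure_set (Set.finite_singleton g)
  have := hH.finite_sup (A ⊔ B) (Subgroup.closure {g})
  set E := A ⊔ B ⊔ Subgroup.closure {g} with hE
  have hAE : A ≤ E := le_sup_left.trans le_sup_left
  have hBE : B ≤ E := le_sup_right.trans le_sup_left
  have hgE : g ∈ E := (le_sup_right : _ ≤ E) (Subgroup.mem_closure_singleton_self g)
  set J := CosetIndex (B.subgroupOf E)
  obtain ⟨e, he, heE⟩ := hH.exists_extend E (leftPerm E J) leftPerm_injective
  have key := leftPerm_mem_sup_centralizer (A := A.subgroupOf E) (B := B.subgroupOf E)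
    (g := ⟨g, hgE⟩) (by
      rw [Subgroup.mem_centralizer_iff]
      intro x hx
      exact Subtype.ext (Subgroup.mem_centralizer_iff.mp hg x hx))
  have hmap : ∀ D ≤ E, (Subgroup.centralizer (((D.subgroupOf E).map (leftPerm E J) : Subgroup _) :
      Set (Equiv.Perm (E × J)))).map e ≤ Subgroup.centralizer (D : Set H) := by
    rintro D hD _ ⟨σ, hσ, rfl⟩
    rw [Subgroup.mem_centralizer_iff]
    intro d hd
    have h := congrArg e (Subgroup.mem_centralizer_iff.mp hσ _ ⟨⟨d, hD hd⟩, hd, rfl⟩)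
    rwa [map_mul, map_mul, heE] at h
  have h := Subgroup.mem_map_of_mem e key
  rw [heE, Subgroup.map_sup] at h
  exact sup_le_sup (hmap A hAE) (hmap B hBE) h

end Intersection

section SetwiseBound

variable {H : Type} [Group H]

theorem conj_mem_pointwiseStabilizer {A : Subgroup H} {c : H}
    (hc : c ∈ Subgroup.centralizer (A : Set H)) : MulAut.conj c ∈ pointwiseStabilizer A := by
  intro a ha
  rw [MulAut.conj_apply, ← Subgroup.mem_centralizer_iff.mp hc a ha, mul_inv_cancel_right]

theorem IsHall.pointwiseStabilizer_inf_le (hH : IsHall H) {G : Subgroup (MulAut H)}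
    {A B : Subgroup H} [Finite A] [Finite B] (hA : pointwiseStabilizer A ≤ G)
    (hB : pointwiseStabilizer B ≤ G) : pointwiseStabilizer (A ⊓ B) ≤ G := by
  intro f hf
  obtain ⟨k, hk⟩ := hH.exists_conj A.subtype (f.toMonoidHom.comp A.subtype) A.subtype_injective
    (f.injective.comp A.subtype_injective)
  have hk' : ∀ a ∈ A, f a = k * a * k⁻¹ := fun a ha => hk ⟨a, ha⟩
  have hkc : k ∈ Subgroup.centralizer ((A ⊓ B : Subgroup H) : Set H) := by
    rw [Subgroup.mem_centralizer_iff]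
    intro a ha
    have h := (hf a ha).symm.trans (hk' a ha.1)
    rwa [eq_mul_inv_iff_mul_eq] at h
  have hkG : MulAut.conj k ∈ G := by
    have hle : Subgroup.centralizer (A : Set H) ⊔ Subgroup.centralizer (B : Set H) ≤
        G.comap MulAut.conj :=
      sup_le (fun c hc => hA (conj_mem_pointwiseStabilizer hc))
        (fun c hc => hB (conj_mem_pointwiseStabilizer hc))
    exact hle (hH.mem_sup_centralizer A B hkc)
  have hfA : (MulAut.conj k)⁻¹ * f ∈ pointwiseStabilizer A := by
    intro a ha
    rw [MulAut.mul_apply, hk' a ha, ← MulAut.conj_apply, MulAut.inv_apply_self]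
  simpa using G.mul_mem hkG (hA hfA)

theorem pointwiseStabilizer_map_le {G : Subgroup (MulAut H)} {A : Subgroup H}
    (hA : pointwiseStabilizer A ≤ G) {f : MulAut H} (hf : f ∈ G) :
    pointwiseStabilizer (A.map f.toMonoidHom) ≤ G := by
  intro σ hσ
  have h : f⁻¹ * σ * f ∈ pointwiseStabilizer A := by
    intro a ha
    have h' : σ (f a) = f a := hσ _ ⟨a, ha, rfl⟩
    rw [MulAut.mul_apply, MulAut.mul_apply, h', MulAut.inv_apply_self]
  have := G.mul_mem (G.mul_mem hf (hA h)) (G.inv_mem hf)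
  simpa [mul_assoc] using this

theorem IsHall.exists_le_setwiseStabilizer (hH : IsHall H) {G : Subgroup (MulAut H)}
    (hG : ∃ B : Subgroup H, Finite B ∧ pointwiseStabilizer B ≤ G) :
    ∃ A : Subgroup H, Finite A ∧ pointwiseStabilizer A ≤ G ∧ G ≤ setwiseStabilizer A := by
  obtain ⟨A, ⟨hA, hAG⟩, hmin⟩ := exists_minimalFor_of_wellFoundedLT
    (fun B : Subgroup H => Finite B ∧ pointwiseStabilizer B ≤ G) (fun B => Nat.card B) hG
  refine ⟨A, hA, hAG, fun f hf => ?_⟩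
  have hfin : Finite (A.map f.toMonoidHom) := (Set.toFinite (A : Set H)).image f |>.to_subtype
  have hinf : Finite (A ⊓ A.map f.toMonoidHom : Subgroup H) :=
    ((Set.toFinite (A : Set H)).subset inf_le_left).to_subtype
  have hcard := hmin ⟨hinf, hH.pointwiseStabilizer_inf_le hAG (pointwiseStabilizer_map_le hAG hf)⟩
    (Subgroup.card_le_of_le inf_le_left)
  have hle : A ≤ A.map f.toMonoidHom :=
    inf_eq_left.mp (Subgroup.eq_of_le_of_card_ge inf_le_left hcard)
  have heq := Subgroup.eq_of_le_of_card_ge hle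
    (Subgroup.card_map_of_injective f.injective).le
  exact (congrArg (fun B : Subgroup H => (B : Set H)) heq).symm

theorem IsHall.exists_mem_centralizer_conj_notMem (hH : IsHall H) (A B : Subgroup H) [Finite A]
    [Finite B] {b : H} (hb : b ∈ B) (hbA : b ∉ A) :
    ∃ x ∈ Subgroup.centralizer (A : Set H), x * b * x⁻¹ ∉ B := by
  classical
  have := hH.finite_sup A B
  set K := A ⊔ B
  have hAK : A ≤ K := le_sup_left
  have hBK : B ≤ K := le_sup_right
  obtain ⟨e, he, heK⟩ := hH.exists_extend K (leftPerm K Bool) leftPerm_injective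
  let π : K → Equiv.Perm Bool := fun y => if (y : H) ∈ A then Equiv.swap true false else 1
  have hπ : sidePerm K π ∈ Subgroup.centralizer
      ((A.subgroupOf K).map (leftPerm K Bool) : Set (Equiv.Perm (K × Bool))) :=
    sidePerm_mem_centralizer fun a ha y => by
      have : (a : H) * y ∈ A ↔ (y : H) ∈ A := A.mul_mem_cancel_left ha
      simp [π, this]
  refine ⟨e (sidePerm K π), ?_, fun hx => ?_⟩
  · rw [Subgroup.mem_centralizer_iff]
    intro a ha
    have h := congrArg e (Subgroup.mem_centralizer_iff.mp hπ _ ⟨⟨a, hAK ha⟩, ha, rfl⟩)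
    rwa [map_mul, map_mul, heK] at h
  · have h : e (sidePerm K π * leftPerm K Bool ⟨b, hBK hb⟩ * (sidePerm K π)⁻¹) =
        e (leftPerm K Bool ⟨_, hBK hx⟩) := by
      rw [map_mul, map_mul, map_inv, heK, heK]
    have h' := congrArg (fun τ : Equiv.Perm (K × Bool) => (τ (1, true)).2) (he h)
    simp only [Equiv.Perm.mul_apply, sidePerm_inv_apply, leftPerm_apply, sidePerm_apply] at h'
    simp [π, hbA, one_mem] at h'

theorem IsHall.le_of_pointwiseStabilizer_le (hH : IsHall H) {A B : Subgroup H} [Finite A]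
    [Finite B] (h : pointwiseStabilizer A ≤ setwiseStabilizer B) : B ≤ A := by
  intro b hb
  by_contra hbA
  obtain ⟨x, hx, hxB⟩ := hH.exists_mem_centralizer_conj_notMem A B hb hbA
  have himage : MulAut.conj x '' (B : Set H) = B := h (conj_mem_pointwiseStabilizer hx)
  exact hxB (himage.subset ⟨b, hb, rfl⟩)

end SetwiseBound

/-- **Strong small index property for Hall's universal group.**
If `H` is Hall's universal group (countable, locally finite, embedding every finite group,
homogeneous for finite subgroups), then every subgroup of `Aut(H)` of index `< 2^ℵ₀` lies
between the pointwise and the setwise stabilizer of a unique finite subgroup `A ≤ H`. -/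
theorem strong_small_index_property
    {H : Type} [Group H] [Countable H]
    (hLF : ∀ s : Finset H, ((Subgroup.closure (s : Set H) : Subgroup H) : Set H).Finite)
    (hEmb : ∀ (G : Type) [Group G] [Finite G], ∃ e : G →* H, Function.Injective e)
    (hHom : ∀ K L : Subgroup H, (K : Set H).Finite → (L : Set H).Finite →
      ∀ φ : ↥K ≃* ↥L, ∃ h : H, ∀ k : K, (φ k : H) = h * (k : H) * h⁻¹)
    (G : Subgroup (MulAut H))
    (hG : Cardinal.mk (MulAut H ⧸ G) < Cardinal.continuum) :
    ∃! A : Subgroup H, (A : Set H).Finite ∧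
      pointwiseStabilizer A ≤ G ∧ G ≤ setwiseStabilizer A := by
  have hH : IsHall H := ⟨hLF, hEmb, hHom⟩
  obtain ⟨A, hA, hAG, hGA⟩ := hH.exists_le_setwiseStabilizer
    (hH.exists_pointwiseStabilizer_le (hasSmallIndex_of_mk_lt G hG))
  refine ⟨A, ⟨Set.toFinite _, hAG, hGA⟩, ?_⟩
  rintro B ⟨hB, hBG, hGB⟩
  have : Finite B := hB.to_subtype
  exact le_antisymm (hH.le_of_pointwiseStabilizer_le (hAG.trans hGB))
    (hH.le_of_pointwiseStabilizer_le (hBG.trans hGA))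
end

section
/- Let H be Hall's universal group. Then H has the small index property: every subgroup G of Aut(H) whose index (the cardinality of the coset space Aut(H)/G) is strictly less than 2^ℵ₀ contains the pointwise stabilizer of some finite subgroup A of H. -/
/-- The group `H` is locally finite, embeds every finite group, and any two embeddings of a finite
group into `H` are conjugate. -/
structure IsHallUniversal (H : Type) [Group H] : Prop where
  closure_finite : ∀ s : Set H, s.Finite → (Subgroup.closure s : Set H).Finite
  exists_embedding : ∀ (G : Type) [Group G] [Finite G], ∃ e : G →* H, Function.Injective e
  exists_conj : ∀ (K : Type) [Group K] [Finite K] (φ ψ : K →* H), Function.Injective φ →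
    Function.Injective ψ → ∃ u : H, ∀ k, ψ k = MulAut.conj u (φ k)

section

variable {H : Type} [Group H]

theorem IsHallUniversal.of_properties
    (hLF : ∀ s : Finset H, ((Subgroup.closure (s : Set H) : Subgroup H) : Set H).Finite)
    (hEmb : ∀ (G : Type) [Group G] [Finite G], ∃ e : G →* H, Function.Injective e)
    (hHom : ∀ K L : Subgroup H, (K : Set H).Finite → (L : Set H).Finite →
      ∀ φ : ↥K ≃* ↥L, ∃ h : H, ∀ k : K, (φ k : H) = h * (k : H) * h⁻¹) :
    IsHallUniversal H where
  closure_finite s hs := by simpa using hLF hs.toFinset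
  exists_embedding := hEmb
  exists_conj K _ _ φ ψ hφ hψ := by
    obtain ⟨u, hu⟩ := hHom φ.range ψ.range (Set.finite_range φ) (Set.finite_range ψ)
      ((MonoidHom.ofInjective hφ).symm.trans (MonoidHom.ofInjective hψ))
    refine ⟨u, fun k => ?_⟩
    have := hu (MonoidHom.ofInjective hφ k)
    simpa [MonoidHom.ofInjective_apply] using this

theorem map_conj_apply {M N F : Type*} [Group M] [Group N] [FunLike F M N] [MonoidHomClass F M N]
    (f : F) (a m : M) : f (MulAut.conj a m) = MulAut.conj (f a) (f m) := by
  simp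

theorem conj_mk_one {M N : Type*} [Group M] [Group N] (a m : M) (b : N) :
    MulAut.conj (a, b) (m, 1) = (MulAut.conj a m, 1) := by
  ext <;> simp

namespace IsHallUniversal

theorem exists_conj_eqOn (hH : IsHallUniversal H) (f : MulAut H) {A : Set H} (hA : A.Finite) :
    ∃ t : H, ∀ a ∈ A, f a = MulAut.conj t a := by
  have := (hH.closure_finite A hA).to_subtype
  obtain ⟨t, ht⟩ := hH.exists_conj (Subgroup.closure A) (Subgroup.subtype _)
    (f.toMonoidHom.comp (Subgroup.subtype _)) Subtype.val_injective
    (f.injective.comp Subtype.val_injective)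
  exact ⟨t, fun a ha => ht ⟨a, Subgroup.subset_closure ha⟩⟩

/-- The quadruples `(b * p, b * q, p, q)` with `b ∈ B` such that `p` and `q` normalize `B` and
induce the same automorphism of `B`. -/
def jointNormalizer {M : Type} [Group M] (B : Subgroup M) : Subgroup (M × M × M × M) where
  carrier := {x | (∀ b, b ∈ B ↔ MulAut.conj x.2.2.1 b ∈ B) ∧
    (∀ b ∈ B, MulAut.conj x.2.2.1 b = MulAut.conj x.2.2.2 b) ∧
    ∃ b ∈ B, x.1 = b * x.2.2.1 ∧ x.2.1 = b * x.2.2.2}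
  one_mem' := by simp [B.one_mem]
  mul_mem' := by
    rintro ⟨_, _, p, q⟩ ⟨_, _, p', q'⟩ ⟨h₁, h₂, b, hb, hx, hy⟩ ⟨h₁', h₂', b', hb', hx', hy'⟩
    dsimp only at h₁ h₂ h₁' h₂' hx hy hx' hy'
    subst hx hy hx' hy'
    refine ⟨fun c => ?_, fun c hc => ?_, b * MulAut.conj p b', B.mul_mem hb ((h₁ b').1 hb'), ?_, ?_⟩
    · rw [h₁' c, h₁]
      simp [mul_assoc]
    · have := h₂ _ ((h₁' c).1 hc)
      rw [h₂' c hc] at this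
      simpa [mul_assoc, h₂' c hc] using this
    · simp [mul_assoc]
    · have := h₂ b' hb'
      simp only [Prod.mk_mul_mk, this]
      simp [mul_assoc]
  inv_mem' := by
    rintro ⟨_, _, p, q⟩ ⟨h₁, h₂, b, hb, hx, hy⟩
    dsimp only at h₁ h₂ hx hy
    subst hx hy
    have hp : ∀ c, c ∈ B ↔ MulAut.conj p⁻¹ c ∈ B := fun c => by
      rw [h₁ (MulAut.conj p⁻¹ c)]
      simp [mul_assoc]
    have hpq : ∀ c ∈ B, MulAut.conj p⁻¹ c = MulAut.conj q⁻¹ c := fun c hc => by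
      have := h₂ _ ((hp c).1 hc)
      apply (MulAut.conj q).injective
      rw [← this]
      simp [mul_assoc]
    refine ⟨hp, hpq, (MulAut.conj p⁻¹ b)⁻¹, B.inv_mem ((hp b).1 hb), ?_, ?_⟩
    · simp [mul_assoc]
    · rw [hpq b hb]
      simp [mul_assoc]

theorem exists_amalgam (hH : IsHallUniversal H) {M ι : Type} [Group M] [Finite M] (B : Subgroup M)
    {s t : ι → M} (hs : ∀ i, ∀ b ∈ B, MulAut.conj (s i) b ∈ B)
    (hst : ∀ i, ∀ b ∈ B, MulAut.conj (s i) b = MulAut.conj (t i) b)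
    {j : M →* H} (hj : Function.Injective j) :
    ∃ (r : ι → H) (e : M →* H), Function.Injective e ∧ (∀ b ∈ B, e b = j b) ∧
      (∀ i m, MulAut.conj (r i) (j m) = j (MulAut.conj (s i) m)) ∧
      ∀ i m, MulAut.conj (r i) (e m) = e (MulAut.conj (t i) m) := by
  obtain ⟨d, hd⟩ := hH.exists_embedding (M × M × M)
  let φ : jointNormalizer B →* H := d.comp
    (((MonoidHom.fst M (M × M × M)).prod
      ((MonoidHom.snd M (M × M)).comp (MonoidHom.snd M (M × M × M)))).comp (Subgroup.subtype _))
  let ψ : jointNormalizer B →* H := d.comp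
    ((MonoidHom.snd M (M × M × M)).comp (Subgroup.subtype _))
  have hφ : Function.Injective φ := by
    refine hd.comp ?_
    rintro ⟨⟨x, y, p, q⟩, _, _, b, hb, hx, hy⟩ ⟨⟨x', y', p', q'⟩, _, _, b', hb', hx', hy'⟩ h
    simp only [MonoidHom.comp_apply, MonoidHom.prod_apply, Subgroup.subtype_apply,
      MonoidHom.coe_fst, MonoidHom.coe_snd, Prod.mk.injEq] at h
    dsimp only at hx hy hx' hy'
    obtain ⟨rfl, rfl, rfl⟩ := h
    obtain rfl : b = b' := mul_right_cancel (hx.symm.trans hx')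
    exact Subtype.ext (Prod.ext rfl (Prod.ext (hy.trans hy'.symm) rfl))
  have hψ : Function.Injective ψ := by
    refine hd.comp ?_
    rintro ⟨⟨x, y, p, q⟩, _, _, b, hb, hx, hy⟩ ⟨⟨x', y', p', q'⟩, _, _, b', hb', hx', hy'⟩ h
    simp only [MonoidHom.comp_apply, Subgroup.subtype_apply,
      MonoidHom.coe_snd, Prod.mk.injEq] at h
    dsimp only at hx hy hx' hy'
    obtain ⟨rfl, rfl, rfl⟩ := h
    obtain rfl : b = b' := mul_right_cancel (hy.symm.trans hy')
    exact Subtype.ext (Prod.ext (hx.trans hx'.symm) rfl)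
  obtain ⟨u, hu⟩ := hH.exists_conj _ ψ φ hψ hφ
  let i₁ : M →* M × M × M := MonoidHom.inl M (M × M)
  have hi₁ : Function.Injective i₁ := fun a b h => (Prod.ext_iff.1 h).1
  obtain ⟨v, hv⟩ := hH.exists_conj M (d.comp i₁) j (hd.comp hi₁) hj
  have hB : ∀ b ∈ B, d (b, 1) = MulAut.conj u (d (b, 1)) := fun b hb =>
    hu ⟨(b, b, 1, 1), by simp, by simp, b, hb, by simp, by simp⟩
  have hsB : ∀ i b, b ∈ B ↔ MulAut.conj (s i) b ∈ B := fun i =>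
    Subgroup.mem_normalizer_fintype (hs i)
  have hr : ∀ i, d (s i, s i, t i) = MulAut.conj u (d (t i, s i, t i)) := fun i =>
    hu ⟨(s i, t i, s i, t i), hsB i, hst i, 1, B.one_mem, by simp, by simp⟩
  refine ⟨fun i => MulAut.conj v (d (s i, s i, t i)),
    (MulAut.conj (v * u)).toMonoidHom.comp (d.comp i₁),
    (MulAut.conj (v * u)).injective.comp (hd.comp hi₁), fun b hb => ?_, fun i m => ?_, fun i m => ?_⟩
  · rw [hv]
    have := hB b hb
    show MulAut.conj (v * u) (d (b, 1)) = MulAut.conj v (d (b, 1))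
    rw [map_mul, MulAut.mul_apply, ← this]
  · rw [hv, hv]
    show MulAut.conj (MulAut.conj v (d (s i, s i, t i))) (MulAut.conj v (d (m, 1))) =
      MulAut.conj v (d (MulAut.conj (s i) m, 1))
    rw [← map_conj_apply, ← map_conj_apply, conj_mk_one]
  · show MulAut.conj (MulAut.conj v (d (s i, s i, t i))) (MulAut.conj (v * u) (d (m, 1))) =
      MulAut.conj (v * u) (d (MulAut.conj (t i) m, 1))
    rw [hr, map_mul, MulAut.mul_apply, MulAut.mul_apply, ← map_conj_apply, ← map_conj_apply,
      ← map_conj_apply, conj_mk_one]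

end IsHallUniversal

theorem exists_limit {h : ℕ → MulAut H} {E : ℕ → Set H} (hE : Monotone E)
    (hstep : ∀ n, Set.EqOn (h (n + 1)) (h n) (E n))
    (hex : ∀ a, ∃ n, a ∈ E n ∧ (h n)⁻¹ a ∈ E n) :
    ∃ f : MulAut H, ∀ n, Set.EqOn f (h n) (E n) := by
  have hle : ∀ {m n}, m ≤ n → Set.EqOn (h n) (h m) (E m) := by
    intro m n hmn
    induction n, hmn using Nat.le_induction with
    | base => exact fun _ _ => rfl
    | succ n hmn ih => exact fun a ha => (hstep n (hE hmn ha)).trans (ih ha)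
  choose N hN hN' using hex
  have hlim : ∀ {a n}, a ∈ E n → h (N a) a = h n a := by
    intro a n ha
    rcases le_total (N a) n with hl | hl
    · exact (hle hl (hN a)).symm
    · exact hle hl ha
  have hev : ∀ a, ∀ᶠ n in Filter.atTop, a ∈ E n := fun a =>
    (Filter.eventually_ge_atTop (N a)).mono fun n hn => hE hn (hN a)
  let F : H →* H := MonoidHom.mk' (fun a => h (N a) a) fun a b => by
    obtain ⟨n, ha, hb, hab⟩ := ((hev a).and ((hev b).and (hev (a * b)))).exists
    rw [hlim ha, hlim hb, hlim hab, map_mul]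
  have hF : ∀ a n, a ∈ E n → F a = h n a := fun a n ha => hlim ha
  refine ⟨MulEquiv.ofBijective F ⟨fun a b hab => ?_, fun a => ⟨(h (N a))⁻¹ a, ?_⟩⟩,
    fun n a ha => hF a n ha⟩
  · obtain ⟨n, ha, hb⟩ := ((hev a).and (hev b)).exists
    rw [hF a n ha, hF b n hb] at hab
    exact (h n).injective hab
  · rw [hF _ _ (hN' a), MulAut.apply_inv_self]

theorem IsHallUniversal.exists_amalgam_conj (hH : IsHallUniversal H) {ι : Type} [Finite ι]
    {B : Subgroup H} (hB : (B : Set H).Finite) {s t : ι → H}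
    (hs : ∀ i, ∀ b ∈ B, MulAut.conj (s i) b ∈ B)
    (hst : ∀ i, ∀ b ∈ B, MulAut.conj (s i) b = MulAut.conj (t i) b)
    {C : Set H} (hC : C.Finite) :
    ∃ (r : ι → H) (g : H), (∀ b ∈ B, MulAut.conj g b = b) ∧ ∀ i, ∀ c ∈ C,
      MulAut.conj (r i) c = MulAut.conj (s i) c ∧
      MulAut.conj (r i) (MulAut.conj g c) = MulAut.conj g (MulAut.conj (t i) c) := by
  let M := Subgroup.closure ((B ∪ C) ∪ (Set.range s ∪ Set.range t))
  have : Finite M := (hH.closure_finite _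
    ((hB.union hC).union ((Set.finite_range s).union (Set.finite_range t)))).to_subtype
  have hBM : ∀ b ∈ B, b ∈ M := fun b hb => Subgroup.subset_closure (Or.inl (Or.inl hb))
  have hCM : ∀ c ∈ C, c ∈ M := fun c hc => Subgroup.subset_closure (Or.inl (Or.inr hc))
  have hsM : ∀ i, s i ∈ M := fun i => Subgroup.subset_closure (Or.inr (Or.inl ⟨i, rfl⟩))
  have htM : ∀ i, t i ∈ M := fun i => Subgroup.subset_closure (Or.inr (Or.inr ⟨i, rfl⟩))
  obtain ⟨r, e, he, heB, hr, hre⟩ := hH.exists_amalgam (B.subgroupOf M)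
    (s := fun i => ⟨s i, hsM i⟩) (t := fun i => ⟨t i, htM i⟩)
    (fun i b hb => hs i b hb) (fun i b hb => Subtype.ext (hst i b hb))
    (j := M.subtype) Subtype.val_injective
  obtain ⟨g, hg⟩ := hH.exists_conj M M.subtype e Subtype.val_injective he
  refine ⟨r, g, fun b hb => ?_, fun i c hc => ⟨hr i ⟨c, hCM c hc⟩, ?_⟩⟩
  · exact (hg ⟨b, hBM b hb⟩).symm.trans (heB ⟨b, hBM b hb⟩ hb)
  · have := hre i ⟨c, hCM c hc⟩
    rw [hg, hg] at this
    exact this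

/-- One of the conditions defining a generic tuple: `C` is contained in a finite invariant
subgroup, and if the tuple acts on the invariant subgroup `B` as conjugation by `t`, then some
conjugate of it over `B` acts on all of `C` as conjugation by `t`. -/
def IsGenericAt {n : ℕ} (x : Fin n → MulAut H) (B : Subgroup H) (t : Fin n → H) (C : Set H) :
    Prop :=
  (∃ B' : Subgroup H, (B' : Set H).Finite ∧ C ⊆ B' ∧ ∀ i, ∀ b ∈ B', x i b ∈ B') ∧
  ((∀ i, ∀ b ∈ B, x i b ∈ B ∧ x i b = MulAut.conj (t i) b) →
    ∃ g, (∀ b ∈ B, MulAut.conj g b = b) ∧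
      ∀ i, ∀ c ∈ C, x i (MulAut.conj g c) = MulAut.conj g (MulAut.conj (t i) c))

/-- A tuple of automorphisms is generic if it satisfies all the conditions `IsGenericAt` for finite
subgroups and finite sets. -/
def IsGeneric {n : ℕ} (x : Fin n → MulAut H) : Prop :=
  ∀ (B : Subgroup H) (t : Fin n → H) (C : Set H), (B : Set H).Finite → C.Finite →
    IsGenericAt x B t C

theorem isGeneric_of_isEmpty (hH : IsHallUniversal H) (x : Fin 0 → MulAut H) : IsGeneric x :=
  fun _ _ C _ hC => ⟨⟨Subgroup.closure C, hH.closure_finite C hC, Subgroup.subset_closure,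
    fun i => i.elim0⟩, fun _ => ⟨1, by simp, fun i => i.elim0⟩⟩

namespace IsGeneric

variable {n : ℕ} {x : Fin n → MulAut H}

theorem exists_invariant (hx : IsGeneric x) {A : Set H} (hA : A.Finite) :
    ∃ B : Subgroup H, (B : Set H).Finite ∧ A ⊆ B ∧ ∀ i, ∀ b ∈ B, x i b ∈ B :=
  (hx ⊥ 1 A (by simp) hA).1

/-- If a generic tuple acts on a finite invariant subgroup `B` as conjugation by `t`, then a
conjugate of it over `B` acts on any given finite set as conjugation by `t`. -/
theorem exists_conj (hx : IsGeneric x) {B : Subgroup H} (hB : (B : Set H).Finite)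
    (hxB : ∀ i, ∀ b ∈ B, x i b ∈ B) {t : Fin n → H} (ht : ∀ i, ∀ b ∈ B, x i b = MulAut.conj (t i) b)
    {C : Set H} (hC : C.Finite) :
    ∃ g, (∀ b ∈ B, MulAut.conj g b = b) ∧
      ∀ i, ∀ c ∈ C, x i (MulAut.conj g c) = MulAut.conj g (MulAut.conj (t i) c) :=
  (hx B t C hB hC).2 fun i b hb => ⟨hxB i b hb, ht i b hb⟩

theorem exists_invariant_eqOn (hH : IsHallUniversal H) (hx : IsGeneric x) (u : MulAut H)
    {E : Set H} (hE : E.Finite) :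
    ∃ (y : MulAut H) (B : Subgroup H), (B : Set H).Finite ∧ E ⊆ B ∧ Set.EqOn y u E ∧
      (∀ i, ∀ b ∈ B, x i b ∈ B) ∧ ∀ b ∈ B, y b ∈ B := by
  obtain ⟨A, hA, hEA, hxA⟩ := hx.exists_invariant (hE.union (hE.image u))
  choose t ht using fun i => hH.exists_conj_eqOn (x i) hA
  obtain ⟨t₀, ht₀⟩ := hH.exists_conj_eqOn u hE
  have hB := hH.closure_finite _ ((hA.union (Set.finite_range t)).union (Set.finite_singleton t₀))
  set B := Subgroup.closure ((A : Set H) ∪ Set.range t ∪ {t₀})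
  have hAB : ∀ a ∈ A, a ∈ B := fun a ha => Subgroup.subset_closure (Or.inl (Or.inl ha))
  have htB : ∀ i, t i ∈ B := fun i => Subgroup.subset_closure (Or.inl (Or.inr ⟨i, rfl⟩))
  have ht₀B : t₀ ∈ B := Subgroup.subset_closure (Or.inr rfl)
  obtain ⟨g, hg, hgB⟩ := hx.exists_conj hA hxA ht hB
  refine ⟨MulAut.conj (MulAut.conj g t₀), B.map (MulAut.conj g).toMonoidHom,
    hB.image (MulAut.conj g), fun e he => ?_, fun e he => ?_, ?_, ?_⟩
  · have := hEA (Or.inl he)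
    exact ⟨e, hAB e this, hg e this⟩
  · rw [← hg e (hEA (Or.inl he)), ← map_conj_apply, ← ht₀ e he,
      hg _ (hEA (Or.inr ⟨e, he, rfl⟩)), hg e (hEA (Or.inl he))]
  · rintro i _ ⟨b, hb, rfl⟩
    exact ⟨MulAut.conj (t i) b, B.mul_mem (B.mul_mem (htB i) hb) (B.inv_mem (htB i)),
      (hgB i b hb).symm⟩
  · rintro _ ⟨b, hb, rfl⟩
    exact ⟨MulAut.conj t₀ b, B.mul_mem (B.mul_mem ht₀B hb) (B.inv_mem ht₀B),
      map_conj_apply (MulAut.conj g) t₀ b⟩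

theorem exists_conj_eqOn (hH : IsHallUniversal H) (hx : IsGeneric x) {u : MulAut H}
    {A B : Subgroup H} (hA : (A : Set H).Finite) (hBA : B ≤ A) (hxA : ∀ i, ∀ a ∈ A, x i a ∈ A)
    (huA : ∀ a ∈ A, u a ∈ A) {t : Fin (n + 1) → H}
    (hB : ∀ i, ∀ b ∈ B, (Fin.cons u x : Fin (n + 1) → MulAut H) i b ∈ B ∧
      (Fin.cons u x : Fin (n + 1) → MulAut H) i b = MulAut.conj (t i) b)
    {C : Set H} (hC : C.Finite) :
    ∃ (y : MulAut H) (g : H), Set.EqOn y u A ∧ (∀ b ∈ B, MulAut.conj g b = b) ∧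
      ∀ i, ∀ c ∈ C, (Fin.cons y x : Fin (n + 1) → MulAut H) i (MulAut.conj g c) =
        MulAut.conj g (MulAut.conj (t i) c) := by
  choose s hs using fun i => hH.exists_conj_eqOn ((Fin.cons u x : Fin (n + 1) → MulAut H) i) hA
  obtain ⟨r, k, hk, hr⟩ := hH.exists_amalgam_conj (hA.subset hBA) (s := s) (t := t)
    (fun i b hb => by rw [← hs i b (hBA hb)]; exact (hB i b hb).1)
    (fun i b hb => by rw [← hs i b (hBA hb)]; exact (hB i b hb).2) (hA.union hC)
  obtain ⟨g, hg, hgC⟩ := hx.exists_conj hA hxA (t := Fin.tail r)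
    (fun i a ha => (hs i.succ a ha).trans (hr i.succ a (Or.inl ha)).1.symm)
    (hC.image (MulAut.conj k))
  refine ⟨MulAut.conj (MulAut.conj g (r 0)), g * k, fun a ha => ?_, fun b hb => ?_, ?_⟩
  · have h0 : u a = MulAut.conj (r 0) a := (hs 0 a ha).trans (hr 0 a (Or.inl ha)).1.symm
    conv_lhs => rw [← hg a ha]
    rw [← map_conj_apply, ← h0, hg _ (huA a ha)]
  · rw [map_mul, MulAut.mul_apply, hk b hb, hg b (hBA hb)]
  · intro i c hc
    rw [map_mul, MulAut.mul_apply, MulAut.mul_apply, ← (hr i c (Or.inr hc)).2]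
    induction i using Fin.cases with
    | zero => rw [Fin.cons_zero, ← map_conj_apply]
    | succ i =>
      rw [Fin.cons_succ, hgC i _ ⟨c, hc, rfl⟩]
      rfl

end IsGeneric

/-- The interior of `U` in the topology of pointwise convergence on `Aut(H)` is dense. -/
def HasDenseInterior (U : Set (MulAut H)) : Prop :=
  ∀ (u : MulAut H) (E : Set H), E.Finite → ∃ v : MulAut H, Set.EqOn v u E ∧
    ∃ E' : Set H, E'.Finite ∧ ∀ w : MulAut H, Set.EqOn w v E' → w ∈ U

theorem HasDenseInterior.inter {U V : Set (MulAut H)} (hU : HasDenseInterior U)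
    (hV : HasDenseInterior V) : HasDenseInterior (U ∩ V) := by
  intro u E hE
  obtain ⟨v, hv, E', hE', hvU⟩ := hU u E hE
  obtain ⟨w, hw, E'', hE'', hwV⟩ := hV v (E ∪ E') (hE.union hE')
  exact ⟨w, fun a ha => (hw (Or.inl ha)).trans (hv ha), E' ∪ E'', hE'.union hE'', fun z hz =>
    ⟨hvU z fun a ha => (hz (Or.inl ha)).trans (hw (Or.inr ha)), hwV z fun a ha => hz (Or.inr ha)⟩⟩

theorem HasDenseInterior.preimage_mul {U : Set (MulAut H)} (hU : HasDenseInterior U)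
    (f : MulAut H) : HasDenseInterior {y | f * y ∈ U} := by
  intro u E hE
  obtain ⟨v, hv, E', hE', hvU⟩ := hU (f * u) E hE
  refine ⟨f⁻¹ * v, fun a ha => ?_, E', hE', fun w hw => hvU _ fun a ha => ?_⟩
  · rw [MulAut.mul_apply, hv ha, ← MulAut.mul_apply, inv_mul_cancel_left]
  · rw [MulAut.mul_apply, hw ha, ← MulAut.mul_apply, mul_inv_cancel_left]

theorem IsGeneric.hasDenseInterior (hH : IsHallUniversal H) {n : ℕ} {x : Fin n → MulAut H}
    (hx : IsGeneric x) {B : Subgroup H} (hB : (B : Set H).Finite) (t : Fin (n + 1) → H) {C : Set H}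
    (hC : C.Finite) :
    HasDenseInterior {y | IsGenericAt (Fin.cons y x : Fin (n + 1) → MulAut H) B t C} := by
  intro u E hE
  obtain ⟨y, A, hA, hEA, hyu, hxA, hyA⟩ :=
    hx.exists_invariant_eqOn hH u ((hE.union hB).union hC)
  have hCA : ∀ w : MulAut H, Set.EqOn w y A → ∃ B' : Subgroup H, (B' : Set H).Finite ∧ C ⊆ B' ∧
      ∀ i, ∀ b ∈ B', (Fin.cons w x : Fin (n + 1) → MulAut H) i b ∈ B' := fun w hw =>
    ⟨A, hA, fun c hc => hEA (Or.inr hc), Fin.forall_fin_succ.2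
      ⟨fun b hb => by rw [Fin.cons_zero, hw hb]; exact hyA b hb, hxA⟩⟩
  have hBA : B ≤ A := fun b hb => hEA (Or.inl (Or.inr hb))
  have hcons : ∀ w : MulAut H, Set.EqOn w y A → ∀ i, ∀ b ∈ B,
      (Fin.cons w x : Fin (n + 1) → MulAut H) i b = (Fin.cons y x : Fin (n + 1) → MulAut H) i b :=
    fun w hw => Fin.forall_fin_succ.2 ⟨fun b hb => hw (hBA hb), fun i b hb => rfl⟩
  by_cases hyB : ∀ i, ∀ b ∈ B, (Fin.cons y x : Fin (n + 1) → MulAut H) i b ∈ B ∧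
      (Fin.cons y x : Fin (n + 1) → MulAut H) i b = MulAut.conj (t i) b
  · obtain ⟨z, g, hzy, hg, hgC⟩ := hx.exists_conj_eqOn hH hA hBA hxA hyA hyB hC
    refine ⟨z, fun a ha => (hzy (hEA (Or.inl (Or.inl ha)))).trans (hyu (Or.inl (Or.inl ha))),
      A ∪ MulAut.conj g '' C, hA.union (hC.image _), fun w hw =>
        ⟨hCA w fun a ha => (hw (Or.inl ha)).trans (hzy ha), fun _ => ⟨g, hg, ?_⟩⟩⟩
    refine Fin.forall_fin_succ.2 ⟨fun c hc => ?_, fun i c hc => hgC i.succ c hc⟩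
    rw [← hgC 0 c hc]
    exact hw (Or.inr ⟨c, hc, rfl⟩)
  · refine ⟨y, fun a ha => hyu (Or.inl (Or.inl ha)), A, hA, fun w hw =>
      ⟨hCA w hw, fun h => absurd (fun i b hb => ?_) hyB⟩⟩
    rw [← hcons w hw i b hb]
    exact h i b hb

/-- Conjugation by `g` is an isomorphism from the action of `x` on the finite invariant subgroup `C`
to the action of `y` on its image. -/
structure IsPartialConj {n : ℕ} (x y : Fin n → MulAut H) (C : Subgroup H) (g : H) : Prop where
  finite : (C : Set H).Finite
  invariant : ∀ i, ∀ c ∈ C, x i c ∈ C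
  equivariant : ∀ i, ∀ c ∈ C, MulAut.conj g (x i c) = y i (MulAut.conj g c)

namespace IsPartialConj

variable {n : ℕ} {x y : Fin n → MulAut H} {C : Subgroup H} {g : H}

theorem symm (h : IsPartialConj x y C g) :
    IsPartialConj y x (C.map (MulAut.conj g).toMonoidHom) g⁻¹ where
  finite := h.finite.image (MulAut.conj g)
  invariant := by
    rintro i _ ⟨c, hc, rfl⟩
    exact ⟨x i c, h.invariant i c hc, h.equivariant i c hc⟩
  equivariant := by
    rintro i _ ⟨c, hc, rfl⟩
    show MulAut.conj g⁻¹ (y i (MulAut.conj g c)) = x i (MulAut.conj g⁻¹ (MulAut.conj g c))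
    rw [← h.equivariant i c hc, map_inv, MulAut.inv_apply_self, MulAut.inv_apply_self]

theorem exists_forth (hH : IsHallUniversal H) (hx : IsGeneric x) (hy : IsGeneric y)
    (h : IsPartialConj x y C g) (a : H) :
    ∃ (C' : Subgroup H) (g' : H), IsPartialConj x y C' g' ∧ C ≤ C' ∧ a ∈ C' ∧
      Set.EqOn (MulAut.conj g') (MulAut.conj g) C := by
  obtain ⟨C', hC', hCC', hxC'⟩ := hx.exists_invariant (h.finite.union (Set.finite_singleton a))
  choose t ht using fun i => hH.exists_conj_eqOn (x i) hC'
  have hsub : C ≤ C' := fun c hc => hCC' (Or.inl hc)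
  obtain ⟨k, hk, hkC⟩ := hy.exists_conj h.symm.finite h.symm.invariant
    (t := fun i => MulAut.conj g (t i)) (by
      rintro i _ ⟨c, hc, rfl⟩
      refine (h.equivariant i c hc).symm.trans ?_
      rw [ht i c (hsub hc), map_conj_apply]
      rfl) (hC'.image (MulAut.conj g))
  refine ⟨C', k * g, ⟨hC', hxC', fun i c hc => ?_⟩, hsub, hCC' (Or.inr rfl), fun c hc => ?_⟩
  · rw [map_mul, MulAut.mul_apply, MulAut.mul_apply, hkC i _ ⟨c, hc, rfl⟩, ← map_conj_apply,
      ← ht i c hc]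
  · rw [map_mul, MulAut.mul_apply]
    exact hk _ ⟨c, hc, rfl⟩

theorem exists_back_and_forth (hH : IsHallUniversal H) (hx : IsGeneric x) (hy : IsGeneric y)
    (h : IsPartialConj x y C g) (a : H) :
    ∃ (C' : Subgroup H) (g' : H), IsPartialConj x y C' g' ∧ C ≤ C' ∧
      (a ∈ C' ∧ (MulAut.conj g')⁻¹ a ∈ C') ∧ Set.EqOn (MulAut.conj g') (MulAut.conj g) C := by
  obtain ⟨C₁, g₁, h₁, hC₁, ha₁, hg₁⟩ := h.exists_forth hH hx hy a
  obtain ⟨D, k, hD, hCD, haD, hk⟩ := h₁.symm.exists_forth hH hy hx a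
  have hkg : ∀ c ∈ C₁, MulAut.conj k (MulAut.conj g₁ c) = c := fun c hc => by
    refine (hk ⟨c, hc, rfl⟩).trans ?_
    rw [map_inv]
    exact MulAut.inv_apply_self _ _ _
  have hsub : C₁ ≤ D.map (MulAut.conj k).toMonoidHom := fun c hc =>
    ⟨MulAut.conj g₁ c, hCD ⟨c, hc, rfl⟩, hkg c hc⟩
  refine ⟨_, k⁻¹, hD.symm, hC₁.trans hsub, ⟨hsub ha₁, a, haD, ?_⟩, fun c hc => ?_⟩
  · rw [map_inv, inv_inv]
    rfl
  · rw [← hg₁ hc]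
    conv_lhs => rw [← hkg c (hC₁ hc)]
    rw [map_inv, MulAut.inv_apply_self]

end IsPartialConj

/-- Generic tuples with the same restriction to a finite invariant subgroup are conjugate over that
subgroup. -/
theorem IsGeneric.exists_conj_eq (hH : IsHallUniversal H) [Countable H] {n : ℕ}
    {x y : Fin n → MulAut H} (hx : IsGeneric x) (hy : IsGeneric y) {B : Subgroup H}
    (hB : (B : Set H).Finite) (hxB : ∀ i, ∀ b ∈ B, x i b ∈ B)
    (hxy : ∀ i, Set.EqOn (x i) (y i) B) :
    ∃ f : MulAut H, (∀ b ∈ B, f b = b) ∧ ∀ i, f * x i = y i * f := by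
  obtain ⟨e, he⟩ := exists_surjective_nat H
  have h₀ : IsPartialConj x y B 1 := ⟨hB, hxB, fun i b hb => by simpa using hxy i hb⟩
  let State := {p : Subgroup H × H // IsPartialConj x y p.1 p.2}
  have hstep : ∀ (p : State) (a : H), ∃ q : State, p.1.1 ≤ q.1.1 ∧
      (a ∈ q.1.1 ∧ (MulAut.conj q.1.2)⁻¹ a ∈ q.1.1) ∧
      Set.EqOn (MulAut.conj q.1.2) (MulAut.conj p.1.2) p.1.1 := by
    rintro ⟨⟨C, g⟩, h⟩ a
    obtain ⟨C', g', h', hC', ha, hg'⟩ := h.exists_back_and_forth hH hx hy a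
    exact ⟨⟨(C', g'), h'⟩, hC', ha, hg'⟩
  choose next hle hmem heq using hstep
  let p : ℕ → State := fun m => Nat.rec ⟨(B, 1), h₀⟩ (fun k q => next q (e k)) m
  have hmono : Monotone fun m => ((p m).1.1 : Set H) := monotone_nat_of_le_succ fun m => hle (p m) _
  have hcov : ∀ a, ∃ m, a ∈ (p m).1.1 ∧ (MulAut.conj (p m).1.2)⁻¹ a ∈ (p m).1.1 := fun a => by
    obtain ⟨m, rfl⟩ := he a
    exact ⟨m + 1, hmem (p m) (e m)⟩
  obtain ⟨f, hf⟩ := exists_limit (h := fun m => MulAut.conj (p m).1.2) hmono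
    (fun m => heq (p m) _) hcov
  refine ⟨f, fun b hb => ?_, fun i => MulEquiv.ext fun a => ?_⟩
  · rw [hf 0 hb]
    show MulAut.conj 1 b = b
    simp
  · obtain ⟨m, ha, -⟩ := hcov a
    rw [MulAut.mul_apply, MulAut.mul_apply, hf m ha, hf m ((p m).2.invariant i a ha)]
    exact (p m).2.equivariant i a ha

theorem HasDenseInterior.exists_perturbation {U : Set (MulAut H)} (hU : HasDenseInterior U)
    {I : Type} [Finite I] (a : I → MulAut H) {E : Set H} (hE : E.Finite) :
    ∃ (a' : I → MulAut H) (E' : Set H), E'.Finite ∧ E ⊆ E' ∧ (∀ i, Set.EqOn (a' i) (a i) E) ∧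
      ∀ i j, i ≠ j → ∀ v w : MulAut H, Set.EqOn v (a' i) E' → Set.EqOn w (a' j) E' →
        v⁻¹ * w ∈ U := by
  classical
  suffices ∀ P : Set (I × I), P.Finite → ∃ (a' : I → MulAut H) (E' : Set H), E'.Finite ∧ E ⊆ E' ∧
      (∀ i, Set.EqOn (a' i) (a i) E) ∧ ∀ i j, (i, j) ∈ P → i ≠ j → ∀ v w : MulAut H,
        Set.EqOn v (a' i) E' → Set.EqOn w (a' j) E' → v⁻¹ * w ∈ U by
    obtain ⟨a', E', h, h', h'', hP⟩ := this Set.univ Set.finite_univ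
    exact ⟨a', E', h, h', h'', fun i j => hP i j trivial⟩
  intro P hP
  induction P, hP using Set.Finite.induction_on with
  | empty => exact ⟨a, E, hE, subset_rfl, fun i => Set.eqOn_refl _ _, by simp⟩
  | @insert p P _ _ ih =>
    obtain ⟨a', E', hE', hEE', ha', hP⟩ := ih
    obtain ⟨i, j⟩ := p
    by_cases hij : i = j
    · exact ⟨a', E', hE', hEE', ha', fun k l hkl hne =>
        hP k l (hkl.resolve_left (by rintro ⟨⟩; exact hne hij)) hne⟩
    obtain ⟨u, hu, E'', hE'', huU⟩ := hU ((a' i)⁻¹ * a' j) E' hE'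
    have hupd : ∀ k, Set.EqOn (Function.update a' j (a' i * u) k) (a' k) E' := fun k c hc => by
      by_cases hk : k = j
      · subst hk
        rw [Function.update_self, MulAut.mul_apply, hu hc, MulAut.mul_apply,
          MulAut.apply_inv_self]
      · rw [Function.update_of_ne hk]
    refine ⟨Function.update a' j (a' i * u), E' ∪ (E'' ∪ u '' E''),
      hE'.union (hE''.union (hE''.image _)), hEE'.trans Set.subset_union_left,
      fun k c hc => (hupd k (hEE' hc)).trans (ha' k hc), fun k l hkl hne v w hv hw => ?_⟩
    rcases hkl with hkl | hkl
    · obtain ⟨rfl, rfl⟩ := Prod.mk.inj hkl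
      refine huU _ fun c hc => ?_
      have h₁ := hw (Or.inr (Or.inl hc))
      have h₂ := hv (Or.inr (Or.inr ⟨c, hc, rfl⟩))
      rw [Function.update_self] at h₁
      rw [Function.update_of_ne hij] at h₂
      rw [MulAut.mul_apply, h₁, MulAut.mul_apply, ← h₂, MulAut.inv_apply_self]
    · exact hP k l hkl hne v w (fun c hc => (hv (Or.inl hc)).trans (hupd k hc))
        fun c hc => (hw (Or.inl hc)).trans (hupd l hc)

/-- A Mycielski-type theorem: countably many sets with dense interior contain all quotients of
distinct members of some family of automorphisms indexed by the Cantor space. -/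
theorem exists_cantor_family [Countable H] {U : ℕ → Set (MulAut H)}
    (hU : ∀ m, HasDenseInterior (U m)) {E : Set H} (hE : E.Finite) :
    ∃ Y : (ℕ → Bool) → MulAut H, (∀ α, ∀ a ∈ E, Y α a = a) ∧
      ∀ α β, α ≠ β → ∀ m, (Y α)⁻¹ * Y β ∈ U m := by
  obtain ⟨e, he⟩ := exists_surjective_nat H
  let State : ℕ → Type := fun n => ((Fin n → Bool) → MulAut H) × {F : Set H // F.Finite}
  have hstep : ∀ n (p : State n), ∃ q : State (n + 1), p.2.1 ⊆ q.2.1 ∧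
      (∀ σ, Set.EqOn (q.1 σ) (p.1 (Fin.init σ)) p.2.1) ∧
      (∀ σ, e n ∈ q.2.1 ∧ (q.1 σ)⁻¹ (e n) ∈ q.2.1) ∧
      ∀ σ τ, σ ≠ τ → ∀ v w : MulAut H, Set.EqOn v (q.1 σ) q.2.1 → Set.EqOn w (q.1 τ) q.2.1 →
        v⁻¹ * w ∈ U n.unpair.1 := by
    rintro n ⟨a, F, hF⟩
    obtain ⟨a', F', hF', hFF', ha', hb⟩ :=
      (hU n.unpair.1).exists_perturbation (fun σ : Fin (n + 1) → Bool => a (Fin.init σ)) hF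
    refine ⟨⟨a', F' ∪ ({e n} ∪ Set.range fun σ => (a' σ)⁻¹ (e n)),
      hF'.union ((Set.finite_singleton _).union (Set.finite_range _))⟩,
      hFF'.trans Set.subset_union_left, ha',
      fun σ => ⟨Or.inr (Or.inl rfl), Or.inr (Or.inr ⟨σ, rfl⟩)⟩,
      fun σ τ hne v w hv hw => hb σ τ hne v w (fun c hc => hv (Or.inl hc))
        fun c hc => hw (Or.inl hc)⟩
  choose next hsub heq hmem hUn using hstep
  let p : ∀ n, State n := fun n => Nat.rec ⟨fun _ => 1, E, hE⟩ (fun k q => next k q) n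
  have hmono : Monotone fun n => (p n).2.1 := monotone_nat_of_le_succ fun n => hsub n (p n)
  choose Y hY using fun α : ℕ → Bool => exists_limit (h := fun n => (p n).1 fun i => α i)
    hmono (fun n => heq n (p n) _) (fun a => by
      obtain ⟨n, rfl⟩ := he a
      exact ⟨n + 1, hmem n (p n) _⟩)
  refine ⟨Y, fun α a ha => hY α 0 ha, fun α β hαβ m => ?_⟩
  obtain ⟨k, hk⟩ := Function.ne_iff.1 hαβ
  have hne : (fun i : Fin (Nat.pair m k + 1) => α i) ≠ fun i : Fin (Nat.pair m k + 1) => β i :=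
    fun h => hk (congrFun h ⟨k, Nat.lt_succ_of_le (Nat.right_le_pair m k)⟩)
  have key := hUn _ (p _) _ _ hne _ _ (hY α (Nat.pair m k + 1))
    (hY β (Nat.pair m k + 1))
  rwa [Nat.unpair_pair] at key

/-- A subgroup of small index contains an element of every countable intersection of sets with
dense interior, even fixing a given finite set. -/
theorem exists_mem_of_mk_quotient_lt [Countable H] {G : Subgroup (MulAut H)}
    (hG : Cardinal.mk (MulAut H ⧸ G) < Cardinal.continuum) {ι : Type} [Countable ι]
    [Nonempty ι] {U : ι → Set (MulAut H)} (hU : ∀ i, HasDenseInterior (U i)) {E : Set H}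
    (hE : E.Finite) : ∃ y ∈ G, (∀ a ∈ E, y a = a) ∧ ∀ i, y ∈ U i := by
  obtain ⟨e, he⟩ := exists_surjective_nat ι
  obtain ⟨Y, hYE, hYU⟩ := exists_cantor_family (fun m => hU (e m)) hE
  obtain ⟨α, β, hαβ, hne⟩ : ∃ α β, (Y α : MulAut H ⧸ G) = Y β ∧ α ≠ β := by
    by_contra! h
    have := Cardinal.mk_le_of_injective (f := fun α => (Y α : MulAut H ⧸ G)) fun α β => h α β
    simp at this
    exact this.not_gt hG
  refine ⟨_, QuotientGroup.eq.1 hαβ, fun a ha => ?_, fun i => ?_⟩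
  · rw [MulAut.mul_apply, hYE β a ha]
    conv_lhs => rw [← hYE α a ha]
    exact MulAut.inv_apply_self _ _ _
  · obtain ⟨m, rfl⟩ := he i
    exact hYU α β hne m

/-- `S` is the set of entries of a generic tuple. -/
def IsGenericRange (S : Set (MulAut H)) : Prop :=
  ∃ (n : ℕ) (x : Fin n → MulAut H), IsGeneric x ∧ Set.range x = S

theorem isGeneric_of_forall_closure {n : ℕ} {x : Fin n → MulAut H}
    (h : ∀ (F : Finset H) (t : Fin n → H) (C : Finset H),
      IsGenericAt x (Subgroup.closure F) t C) : IsGeneric x := fun B t C hB hC => by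
  simpa using h hB.toFinset t hC.toFinset

theorem IsGenericRange.exists_split (hH : IsHallUniversal H) [Countable H]
    {G : Subgroup (MulAut H)} (hG : Cardinal.mk (MulAut H ⧸ G) < Cardinal.continuum)
    (hstab : ∀ A : Subgroup H, (A : Set H).Finite → ¬ pointwiseStabilizer A ≤ G)
    {S : Set (MulAut H)} (hS : IsGenericRange S) {E : Set H} (hE : E.Finite) :
    ∃ y z f : MulAut H, y ∈ G ∧ z ∉ G ∧ (∀ a ∈ E, f a = a) ∧ (∀ w ∈ S, f * w = w * f) ∧
      f * z = y * f ∧ IsGenericRange (insert y S) ∧ IsGenericRange (insert z S) := by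
  obtain ⟨n, x, hx, rfl⟩ := hS
  obtain ⟨B, hB, hEB, hxB⟩ := hx.exists_invariant hE
  obtain ⟨k, hk, hkG⟩ := SetLike.not_le_iff_exists.1 (hstab B hB)
  let V : Finset H × (Fin (n + 1) → H) × Finset H → Set (MulAut H) := fun d =>
    {y | IsGenericAt (Fin.cons y x : Fin (n + 1) → MulAut H) (Subgroup.closure d.1) d.2.1 d.2.2}
  have hV : ∀ d, HasDenseInterior (V d) := fun d =>
    hx.hasDenseInterior hH (hH.closure_finite _ d.1.finite_toSet) d.2.1 d.2.2.finite_toSet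
  obtain ⟨y, hyG, hyB, hyV⟩ := exists_mem_of_mk_quotient_lt hG
    (fun d => (hV d).inter ((hV d).preimage_mul k)) hB
  have hy : IsGeneric (Fin.cons y x : Fin (n + 1) → MulAut H) :=
    isGeneric_of_forall_closure fun F t C => (hyV (F, t, C)).1
  have hz : IsGeneric (Fin.cons (k * y) x : Fin (n + 1) → MulAut H) :=
    isGeneric_of_forall_closure fun F t C => (hyV (F, t, C)).2
  have hzB : ∀ b ∈ B, (k * y) b = b := fun b hb => by
    rw [MulAut.mul_apply, hyB b hb, hk b hb]
  obtain ⟨f, hf, hfx⟩ := hz.exists_conj_eq hH hy hB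
    (Fin.forall_fin_succ.2 ⟨fun b hb => by rwa [Fin.cons_zero, hzB b hb], hxB⟩)
    (Fin.forall_fin_succ.2 ⟨fun b hb => (hzB b hb).trans (hyB b hb).symm, fun i => Set.eqOn_refl _ _⟩)
  refine ⟨y, k * y, f, hyG, fun h => hkG ((Subgroup.mul_mem_cancel_right G hyG).1 h),
    fun a ha => hf a (hEB ha), ?_, hfx 0, ⟨_, _, hy, Fin.range_cons _ _⟩,
    ⟨_, _, hz, Fin.range_cons _ _⟩⟩
  rintro _ ⟨i, rfl⟩
  exact hfx i.succ

end

/-- **Small index property for Hall's universal group.**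
If `H` is Hall's universal group (countable, locally finite, embedding every finite group,
homogeneous for finite subgroups), then every subgroup of `Aut(H)` of index `< 2^ℵ₀`
contains the pointwise stabilizer of some finite subgroup `A ≤ H`. -/
theorem small_index_property
    {H : Type} [Group H] [Countable H]
    (hLF : ∀ s : Finset H, ((Subgroup.closure (s : Set H) : Subgroup H) : Set H).Finite)
    (hEmb : ∀ (G : Type) [Group G] [Finite G], ∃ e : G →* H, Function.Injective e)
    (hHom : ∀ K L : Subgroup H, (K : Set H).Finite → (L : Set H).Finite →
      ∀ φ : ↥K ≃* ↥L, ∃ h : H, ∀ k : K, (φ k : H) = h * (k : H) * h⁻¹)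
    (G : Subgroup (MulAut H))
    (hG : Cardinal.mk (MulAut H ⧸ G) < Cardinal.continuum) :
    ∃ A : Subgroup H, (A : Set H).Finite ∧ pointwiseStabilizer A ≤ G := by
  have hH := IsHallUniversal.of_properties hLF hEmb hHom
  by_contra! hstab
  obtain ⟨e, he⟩ := exists_surjective_nat H
  let State := {p : Set (MulAut H) × MulAut H × Set H // IsGenericRange p.1 ∧ p.2.2.Finite}
  have hsplit : ∀ (p : State) (a : H), ∃ (q : Bool → State) (y z : MulAut H), y ∈ G ∧ z ∉ G ∧
      y ∈ (q false).1.1 ∧ z ∈ (q true).1.1 ∧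
      (q false).1.2.1 * y * (q false).1.2.1⁻¹ = (q true).1.2.1 * z * (q true).1.2.1⁻¹ ∧
      ∀ b, p.1.1 ⊆ (q b).1.1 ∧
        (∀ w ∈ p.1.1, (q b).1.2.1 * w * (q b).1.2.1⁻¹ = p.1.2.1 * w * p.1.2.1⁻¹) ∧
        p.1.2.2 ⊆ (q b).1.2.2 ∧ Set.EqOn (q b).1.2.1 p.1.2.1 p.1.2.2 ∧
        a ∈ (q b).1.2.2 ∧ (q b).1.2.1⁻¹ a ∈ (q b).1.2.2 := by
    rintro ⟨⟨S, h, E⟩, hS, hE⟩ a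
    have hE' : (E ∪ {a, h⁻¹ a}).Finite := hE.union (by simp)
    obtain ⟨y, z, f, hy, hz, hfE, hfS, hf, hSy, hSz⟩ := hS.exists_split hH hG hstab hE'
    have hfa : f⁻¹ (h⁻¹ a) = h⁻¹ a := by
      conv_lhs => rw [← hfE (h⁻¹ a) (Or.inr (Or.inr rfl))]
      exact MulAut.inv_apply_self _ _ _
    refine ⟨fun b => Bool.rec ⟨(insert y S, h, E ∪ {a, h⁻¹ a}), hSy, hE'⟩
      ⟨(insert z S, h * f, E ∪ {a, h⁻¹ a}), hSz, hE'⟩ b, y, z, hy, hz, Set.mem_insert _ _,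
      Set.mem_insert _ _, ?_, ?_⟩
    · show h * y * h⁻¹ = h * f * z * (h * f)⁻¹
      rw [mul_assoc h f z, hf]
      group
    · rintro (_ | _)
      · exact ⟨Set.subset_insert _ _, fun w hw => rfl, Set.subset_union_left, Set.eqOn_refl _ _,
          Or.inr (Or.inl rfl), Or.inr (Or.inr rfl)⟩
      · refine ⟨Set.subset_insert _ _, fun w hw => ?_, Set.subset_union_left, fun c hc => ?_,
          Or.inr (Or.inl rfl), Or.inr (Or.inr ?_)⟩
        · show h * f * w * (h * f)⁻¹ = h * w * h⁻¹
          rw [mul_assoc h f w, hfS w hw]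
          group
        · exact congrArg h (hfE c (Or.inl hc))
        · show (h * f)⁻¹ a = h⁻¹ a
          rw [mul_inv_rev, MulAut.mul_apply, hfa]
  choose next y z hy hz hyS hzS hyz hS hconj hsub heq hmem hmem' using hsplit
  let p : (ℕ → Bool) → ℕ → State := fun α n =>
    Nat.rec ⟨(∅, 1, ∅), ⟨0, Fin.elim0, isGeneric_of_isEmpty hH _, by simp⟩, Set.finite_empty⟩
      (fun k q => next q (e k) (α k)) n
  have hpcongr : ∀ α β n, (∀ k < n, α k = β k) → p α n = p β n := by
    intro α β n h
    induction n with
    | zero => rfl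
    | succ n ih =>
      show next (p α n) (e n) (α n) = next (p β n) (e n) (β n)
      rw [ih fun k hk => h k (hk.trans n.lt_succ_self), h n n.lt_succ_self]
  have hmono : ∀ α, Monotone fun n => (p α n).1.2.2 := fun α =>
    monotone_nat_of_le_succ fun n => hsub (p α n) _ _
  have hcov : ∀ α a, ∃ n, a ∈ (p α n).1.2.2 ∧ (p α n).1.2.1⁻¹ a ∈ (p α n).1.2.2 := fun α a => by
    obtain ⟨n, rfl⟩ := he a
    exact ⟨n + 1, hmem (p α n) _ _, hmem' (p α n) _ _⟩
  choose F hF using fun α => exists_limit (hmono α) (fun n => heq (p α n) _ _) (hcov α)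
  have hstable : ∀ α m n, m ≤ n → ∀ w ∈ (p α m).1.1, w ∈ (p α n).1.1 ∧
      (p α n).1.2.1 * w * (p α n).1.2.1⁻¹ = (p α m).1.2.1 * w * (p α m).1.2.1⁻¹ := by
    intro α m n hmn w hw
    induction n, hmn using Nat.le_induction with
    | base => exact ⟨hw, rfl⟩
    | succ n _ ih => exact ⟨hS (p α n) _ _ ih.1, (hconj (p α n) _ _ w ih.1).trans ih.2⟩
  have hFconj : ∀ α m, ∀ w ∈ (p α m).1.1,
      F α * w = (p α m).1.2.1 * w * (p α m).1.2.1⁻¹ * F α := by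
    intro α m w hw
    ext a
    obtain ⟨n₁, h₁, -⟩ := hcov α a
    obtain ⟨n₂, h₂, -⟩ := hcov α (w a)
    obtain ⟨n, hn₁, hn₂, hn⟩ : ∃ n, n₁ ≤ n ∧ n₂ ≤ n ∧ m ≤ n :=
      ⟨max n₁ (max n₂ m), by omega, by omega, by omega⟩
    rw [← (hstable α m n hn w hw).2, MulAut.mul_apply, MulAut.mul_apply,
      hF α n (hmono α hn₁ h₁), hF α n (hmono α hn₂ h₂), ← MulAut.mul_apply, ← MulAut.mul_apply,
      inv_mul_cancel_right]
  have hsep : ∀ α β n, (∀ k < n, α k = β k) → α n = false → β n = true →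
      (F α : MulAut H ⧸ G) ≠ F β := by
    intro α β n hlt hα hβ hFG
    have hpα : p α (n + 1) = next (p α n) (e n) false := by rw [← hα]
    have hpβ : p β (n + 1) = next (p α n) (e n) true := by rw [← hβ, hpcongr α β n hlt]
    have h₁ := hFconj α (n + 1) (y (p α n) (e n)) (by rw [hpα]; exact hyS _ _)
    have h₂ := hFconj β (n + 1) (z (p α n) (e n)) (by rw [hpβ]; exact hzS _ _)
    rw [hpα, hyz, ← hpβ] at h₁
    have hmemG : (F β)⁻¹ * F α ∈ G := QuotientGroup.eq.1 hFG.symm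
    refine hz (p α n) (e n) ?_
    have : z (p α n) (e n) = (F β)⁻¹ * F α * y (p α n) (e n) * ((F β)⁻¹ * F α)⁻¹ := by
      rw [mul_assoc (F β)⁻¹, h₁, eq_mul_inv_iff_mul_eq]
      rw [← mul_inv_eq_iff_eq_mul] at h₂
      rw [← h₂]
      group
    rw [this]
    exact G.mul_mem (G.mul_mem hmemG (hy _ _)) (G.inv_mem hmemG)
  have hinj : Function.Injective fun α => (F α : MulAut H ⧸ G) := by
    classical
    intro α β hαβ
    by_contra hne
    have hex := Function.ne_iff.1 hne
    have hlt : ∀ k < Nat.find hex, α k = β k := fun k hk => not_not.1 (Nat.find_min hex hk)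
    have hspec := Nat.find_spec hex
    rcases hα : α (Nat.find hex) with _ | _
    · exact hsep α β _ hlt hα (by simpa [hα] using hspec.symm) hαβ
    · exact hsep β α _ (fun k hk => (hlt k hk).symm) (by simpa [hα] using hspec.symm) hα hαβ.symm
  have := Cardinal.mk_le_of_injective hinj
  simp at this
  exact this.not_gt hG
end

section
/- Let H be Hall's universal group. Then Inn(H) is the locally finite radical of Aut(H): Inn(H) is a normal subgroup of Aut(H), Inn(H) is locally finite as a group, and every locally finite normal subgroup N of Aut(H) is contained in Inn(H). -/
/-- A group is locally finite if every finitely generated subgroup is finite. -/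
def IsLocallyFiniteGroup (G : Type*) [Group G] : Prop :=
  ∀ s : Finset G, ((Subgroup.closure (s : Set G) : Subgroup G) : Set G).Finite

open scoped commutatorElement

theorem IsLocallyFiniteGroup.of_surjective {G G' : Type*} [Group G] [Group G']
    (hG : IsLocallyFiniteGroup G) (f : G →* G') (hf : Function.Surjective f) :
    IsLocallyFiniteGroup G' := by
  classical
  intro s
  obtain ⟨t, rfl⟩ : ∃ t : Finset G, t.image f = s :=
    ⟨s.image (Function.surjInv hf), by
      rw [Finset.image_image]
      convert Finset.image_id (s := s)
      ext x
      simp [Function.surjInv_eq hf]⟩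
  rw [Finset.coe_image, ← MonoidHom.map_closure, Subgroup.coe_map]
  exact (hG t).image f

theorem IsLocallyFiniteGroup.closure_finite {G : Type*} [Group G]
    (hG : IsLocallyFiniteGroup G) {S : Set G} (hS : S.Finite) :
    ((Subgroup.closure S : Subgroup G) : Set G).Finite := by
  have := hG hS.toFinset
  rwa [hS.coe_toFinset] at this

theorem IsLocallyFiniteGroup.exists_pow_eq_one {G : Type*} [Group G]
    (hG : IsLocallyFiniteGroup G) (g : G) : ∃ n : ℕ, g ^ (n + 1) = 1 := by
  have hfin := hG.closure_finite (Set.finite_singleton g)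
  have : Finite (Subgroup.closure ({g} : Set G)) := hfin
  obtain ⟨n, hn, h⟩ := isOfFinOrder_iff_pow_eq_one.mp
    (isOfFinOrder_of_finite (⟨g, Subgroup.subset_closure rfl⟩ : Subgroup.closure ({g} : Set G)))
  refine ⟨n - 1, ?_⟩
  rw [Nat.sub_add_cancel hn]
  simpa using congrArg Subtype.val h

theorem pow_natCard_eq_one_of_mem {G : Type*} [Group G] {Q : Subgroup G} {g : G} (hg : g ∈ Q) :
    g ^ Nat.card Q = 1 := by
  exact congrArg Subtype.val (pow_card_eq_one' (x := (⟨g, hg⟩ : Q)))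

theorem MulAut.conj_range_normal (G : Type*) [Group G] :
    ((MulAut.conj : G →* MulAut G).range).Normal := by
  refine ⟨?_⟩
  rintro _ ⟨g, rfl⟩ φ
  refine ⟨φ g, ?_⟩
  ext x
  simp

/-- A finite group acting on itself by left translation embeds into a finite group of
permutations in which two elements outside a subgroup `K` generate, after conjugating one of them
by a permutation commuting with `K`, an element of large order. -/
theorem exists_perm_commute_pow_ne_one {G : Type} [Group G] [Finite G] (K : Subgroup G) {s t : G}
    (hs : s ∉ K) (ht : t ∉ K) {n : ℕ} (hn : n ≠ 0) :
    ∃ (P : Type) (_ : Group P) (_ : Finite P) (ι : G →* P) (w : P), Function.Injective ι ∧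
      (∀ k ∈ K, w * ι k = ι k * w) ∧ (ι t * (w * ι s * w⁻¹)) ^ n ≠ 1 := by
  classical
  have : NeZero (n + 1) := ⟨by omega⟩
  let Ω := (G × ZMod (n + 1)) × Bool
  let f : Ω → Ω := fun p => match p with
    | ((g, i), false) => if g ∈ K then ((g * t, i), true) else
        if g * s⁻¹ ∈ K then ((g * s⁻¹, i + 1), true) else ((g, i), false)
    | ((g, i), true) => if g * t⁻¹ ∈ K then ((g * t⁻¹, i), false) else
        if g ∈ K then ((g * s, i - 1), false) else ((g, i), true)
  have hinv : ∀ {a : G}, a ∉ K → a⁻¹ ∉ K := fun h h' => h (by simpa using K.inv_mem h')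
  have hmul : ∀ {k a : G}, k ∈ K → (k * a ∈ K ↔ a ∈ K) := fun h => K.mul_mem_cancel_left h
  have hf : Function.Involutive f := by
    rintro ⟨⟨g, i⟩, b⟩
    cases b
    · by_cases h1 : g ∈ K
      · simp [f, h1]
      · by_cases h2 : g * s⁻¹ ∈ K
        · simp [f, h1, h2, hmul h2, hinv ht]
        · simp [f, h1, h2]
    · by_cases h1 : g * t⁻¹ ∈ K
      · simp [f, h1]
      · by_cases h2 : g ∈ K
        · simp [f, h1, h2, hmul h2, hs]
        · simp [f, h1, h2]
  let ι : G →* Equiv.Perm Ω :=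
    { toFun := fun g => ((Equiv.mulLeft g).prodCongr (Equiv.refl _)).prodCongr (Equiv.refl _)
      map_one' := by ext p <;> simp
      map_mul' := fun a b => by ext p <;> simp [mul_assoc] }
  have hι : ∀ g a i b, ι g ((a, i), b) = ((g * a, i), b) := fun _ _ _ _ => rfl
  let w : Equiv.Perm Ω := hf.toPerm
  have hw : ∀ p, w p = f p := fun _ => rfl
  have hw' : ∀ p, w⁻¹ p = f p := fun _ => rfl
  refine ⟨Equiv.Perm Ω, inferInstance, inferInstance, ι, w, ?_, ?_, ?_⟩
  · intro a b hab
    have := congrArg (fun e : Equiv.Perm Ω => e ((1, 0), false)) hab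
    simpa [hι, Ω] using this
  · intro k hk
    ext1 ⟨⟨g, i⟩, b⟩
    simp only [Equiv.Perm.mul_apply, hι, hw]
    cases b
    · simp only [f, mul_assoc, hmul hk]
      split_ifs <;> simp [hι]
    · simp only [f, mul_assoc, hmul hk]
      split_ifs <;> simp [hι]
  · have step : ∀ i, (ι t * (w * ι s * w⁻¹)) ((t, i), true) = ((t, i + 1), true) := by
      intro i
      simp [Equiv.Perm.mul_apply, hw, hw', f, hι, hs]
    have steps : ∀ m : ℕ,
        ((ι t * (w * ι s * w⁻¹)) ^ m) ((t, 0), true) = ((t, (m : ZMod (n + 1))), true) := by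
      intro m
      induction m with
      | zero => simp
      | succ m ih => rw [pow_succ', Equiv.Perm.mul_apply, ih, step]; simp
    intro h
    have := steps n
    rw [h] at this
    have h0 : (n : ZMod (n + 1)) = 0 := by simpa [Ω] using this.symm
    rw [ZMod.natCast_eq_zero_iff] at h0
    exact absurd (Nat.le_of_dvd (Nat.pos_of_ne_zero hn) h0) (by omega)

/-- The defining properties of the Hall universal group other than countability. -/
structure IsHallUniversal_s4 (H : Type) [Group H] : Prop where
  locallyFinite : IsLocallyFiniteGroup H
  exists_embedding : ∀ (G : Type) [Group G] [Finite G], ∃ e : G →* H, Function.Injective e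
  homogeneous : ∀ K L : Subgroup H, (K : Set H).Finite → (L : Set H).Finite →
    ∀ φ : ↥K ≃* ↥L, ∃ h : H, ∀ k : K, (φ k : H) = h * (k : H) * h⁻¹

namespace IsHallUniversal_s4

variable {H : Type} [Group H]

theorem exists_conj_eq (hH : IsHallUniversal_s4 H) {K : Subgroup H} (hK : (K : Set H).Finite)
    (f : K →* H) (hf : Function.Injective f) : ∃ h : H, ∀ k : K, f k = h * k * h⁻¹ := by
  have : Finite K := hK
  obtain ⟨h, hh⟩ := hH.homogeneous K f.range hK (Set.finite_range f) (MonoidHom.ofInjective hf)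
  exact ⟨h, fun k => by rw [← hh k]; rfl⟩

theorem exists_extension (hH : IsHallUniversal_s4 H) {G : Subgroup H} (hG : (G : Set H).Finite)
    {P : Type} [Group P] [Finite P] (ι : G →* P) (hι : Function.Injective ι) :
    ∃ j : P →* H, Function.Injective j ∧ ∀ g : G, j (ι g) = g := by
  obtain ⟨e, he⟩ := hH.exists_embedding P
  obtain ⟨h, hh⟩ := hH.exists_conj_eq hG (e.comp ι) (he.comp hι)
  refine ⟨(MulAut.conj h⁻¹).toMonoidHom.comp e, (MulAut.conj h⁻¹).injective.comp he, fun g => ?_⟩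
  have := hh g
  simp only [MonoidHom.comp_apply] at this
  simp [this, mul_assoc]

/-- Two elements outside a finite subgroup `K` become independent over `K` after conjugating one
of them by an element of the centralizer of `K`. -/
theorem exists_commute_pow_ne_one (hH : IsHallUniversal_s4 H) {K : Subgroup H}
    (hK : (K : Set H).Finite) {s t : H} (hs : s ∉ K) (ht : t ∉ K) {n : ℕ} (hn : n ≠ 0) :
    ∃ w : H, (∀ k ∈ K, w * k = k * w) ∧ (t * (w * s * w⁻¹)) ^ n ≠ 1 := by
  set G := Subgroup.closure ((K : Set H) ∪ {s, t}) with hGdef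
  have hG : (G : Set H).Finite := hH.locallyFinite.closure_finite (hK.union (by simp))
  have hKG : ∀ k ∈ K, k ∈ G := fun k hk => Subgroup.subset_closure (Or.inl hk)
  have hsG : s ∈ G := Subgroup.subset_closure (by simp)
  have htG : t ∈ G := Subgroup.subset_closure (by simp)
  have : Finite G := hG
  obtain ⟨P, _, _, ι, w, hι, hw, hpow⟩ := exists_perm_commute_pow_ne_one (K.subgroupOf G)
    (s := ⟨s, hsG⟩) (t := ⟨t, htG⟩) (by simpa [Subgroup.mem_subgroupOf] using hs)
    (by simpa [Subgroup.mem_subgroupOf] using ht) hn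
  obtain ⟨j, hj, hjι⟩ := hH.exists_extension hG ι hι
  refine ⟨j w, fun k hk => ?_, fun h => hpow (hj ?_)⟩
  · have := congrArg j (hw ⟨k, hKG k hk⟩ (by simpa [Subgroup.mem_subgroupOf] using hk))
    simpa [hjι] using this
  · simpa [hjι] using h

theorem exists_not_commute (hH : IsHallUniversal_s4 H) {g : H} (hg : g ≠ 1) :
    ∃ x : H, g * x ≠ x * g := by
  obtain ⟨x, -, hx⟩ := hH.exists_commute_pow_ne_one (K := ⊥) (by simp) (s := g⁻¹) (t := g)
    (by simpa using hg) (by simpa using hg) one_ne_zero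
  refine ⟨x, fun h => hx ?_⟩
  rw [pow_one, ← mul_assoc, ← mul_assoc, h]
  group

/-- A finite subgroup `F` of `H` and a conjugate of `K` generate their direct product. -/
theorem exists_direct_conj (hH : IsHallUniversal_s4 H) {F K : Subgroup H} (hF : (F : Set H).Finite)
    (hK : (K : Set H).Finite) :
    ∃ (j : F × K →* H) (y : H), Function.Injective j ∧ (∀ f, j (f, 1) = f) ∧
      ∀ k, j (1, k) = y * k * y⁻¹ := by
  have : Finite F := hF
  have : Finite K := hK
  obtain ⟨j, hj, hjF⟩ := hH.exists_extension hF (MonoidHom.inl F K)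
    (fun a b h => by simpa using h)
  obtain ⟨y, hy⟩ := hH.exists_conj_eq hK (j.comp (MonoidHom.inr F K))
    (hj.comp fun a b h => by simpa using h)
  exact ⟨j, y, hj, hjF, hy⟩

theorem exists_mem_forall_eq_conj (hH : IsHallUniversal_s4 H) {K F : Subgroup H}
    (hK : (K : Set H).Finite) (hF : (F : Set H).Finite) (hKF : K ≤ F) (α : MulAut H)
    (hα : ∀ z, (∀ k ∈ K, z * k = k * z) → z⁻¹ * α z ∈ K) :
    ∃ t ∈ K, ∀ x ∈ F, α x = t * x * t⁻¹ := by
  set F' := Subgroup.closure ((F : Set H) ∪ α '' F) with hF'def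
  have hF' : (F' : Set H).Finite := hH.locallyFinite.closure_finite (hF.union (hF.image _))
  have hFF' : ∀ x ∈ F, x ∈ F' := fun x hx => Subgroup.subset_closure (Or.inl hx)
  have hαF' : ∀ x ∈ F, α x ∈ F' := fun x hx => Subgroup.subset_closure (Or.inr ⟨x, hx, rfl⟩)
  obtain ⟨j, y, hj, hjF, hjK⟩ := hH.exists_direct_conj hF' hK
  have : Finite F' := hF'
  have : Finite K := hK
  set t := α y * y⁻¹ with ht
  have key : ∀ z, (∀ k : K, z * j (1, k) = j (1, k) * z) →
      ∃ k : K, α z = t * (z * j (1, k)) * t⁻¹ := by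
    intro z hz
    have := hα (y⁻¹ * z * y) (fun k hk => by
      have := hz ⟨k, hk⟩
      rw [hjK] at this
      calc y⁻¹ * z * y * k = y⁻¹ * (z * (y * k * y⁻¹)) * y := by group
        _ = y⁻¹ * (y * k * y⁻¹ * z) * y := by rw [← this]
        _ = k * (y⁻¹ * z * y) := by group)
    refine ⟨⟨_, this⟩, ?_⟩
    rw [hjK]
    simp only [map_mul, map_inv, ht]
    group
  set L := ((K.subgroupOf F').prod ⊤).map j with hL
  have hLfin : (L : Set H).Finite := by
    rw [hL, Subgroup.coe_map]
    exact (Set.toFinite _).image _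
  have hKL : ∀ k ∈ K, k ∈ L := fun k hk =>
    ⟨(⟨k, hFF' k (hKF hk)⟩, 1), by simpa [Subgroup.mem_prod, Subgroup.mem_subgroupOf] using hk,
      hjF _⟩
  have hjL : ∀ k : K, j (1, k) ∈ L := fun k => ⟨(1, k), by simp [Subgroup.mem_prod], rfl⟩
  have htL : t ∈ L := by
    by_contra htL
    set Q := Subgroup.closure ((L : Set H) ∪ {t}) with hQ
    have hQfin : (Q : Set H).Finite := hH.locallyFinite.closure_finite (hLfin.union (by simp))
    have hLQ : ∀ x ∈ L, x ∈ Q := fun x hx => Subgroup.subset_closure (Or.inl hx)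
    have htQ : t ∈ Q := Subgroup.subset_closure (Or.inr rfl)
    have : Finite Q := hQfin
    obtain ⟨w, hw, hpow⟩ := hH.exists_commute_pow_ne_one hLfin (s := t) (t := t) htL htL
      (n := Nat.card Q) Nat.card_pos.ne'
    refine hpow (pow_natCard_eq_one_of_mem (Q.mul_mem htQ ?_))
    have hw' : ∀ x ∈ L, w⁻¹ * x = x * w⁻¹ := fun x hx =>
      ((show Commute w x from hw x hx).inv_left)
    obtain ⟨k, hk⟩ := key w⁻¹ (fun k => hw' _ (hjL k))
    have hk' := hα w⁻¹ (fun k hk => hw' _ (hKL k hk))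
    have : w * t * w⁻¹ = w⁻¹⁻¹ * α w⁻¹ * t * (j (1, k))⁻¹ := by
      rw [hk]
      group
    rw [this]
    exact Q.mul_mem (Q.mul_mem (hLQ _ (hKL _ hk')) htQ) (Q.inv_mem (hLQ _ (hjL k)))
  obtain ⟨⟨t₁, t₂⟩, htm, htj⟩ := htL
  refine ⟨t₁, by simpa [Subgroup.mem_prod, Subgroup.mem_subgroupOf] using htm, fun x hx => ?_⟩
  obtain ⟨k, hk⟩ := key x (fun k => by
    rw [show x = j (⟨x, hFF' x hx⟩, 1) from (hjF ⟨x, hFF' x hx⟩).symm, ← map_mul, ← map_mul]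
    simp)
  have h : j (⟨α x, hαF' x hx⟩, 1) =
      j ((t₁, t₂) * ((⟨x, hFF' x hx⟩, 1) * (1, k)) * (t₁, t₂)⁻¹) := by
    rw [map_mul, map_mul, map_mul, map_inv, hjF, hjF, htj]
    exact hk
  simpa using congrArg (fun p : F' × K => (p.1 : H)) (hj h)

/-- An automorphism that moves the centralizer of a finite subgroup `K` only within cosets of `K`
is inner. -/
theorem mem_range_conj (hH : IsHallUniversal_s4 H) {K : Subgroup H} (hK : (K : Set H).Finite)
    (α : MulAut H) (hα : ∀ z, (∀ k ∈ K, z * k = k * z) → z⁻¹ * α z ∈ K) :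
    α ∈ (MulAut.conj : H →* MulAut H).range := by
  by_contra hout
  have hx : ∀ t : H, ∃ x, α x ≠ t * x * t⁻¹ := by
    intro t
    by_contra! h
    exact hout ⟨t, by ext x; simp [h x]⟩
  choose x hx using hx
  obtain ⟨t, ht, h⟩ := hH.exists_mem_forall_eq_conj hK
    (hH.locallyFinite.closure_finite (hK.union (hK.image x)))
    (fun k hk => Subgroup.subset_closure (Or.inl hk)) α hα
  exact hx t (h _ (Subgroup.subset_closure (Or.inr ⟨t, ht, rfl⟩)))

theorem exists_commutator_pow_ne_one (hH : IsHallUniversal_s4 H) {α : MulAut H}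
    (hα : α ∉ (MulAut.conj : H →* MulAut H).range) {K : Subgroup H} (hK : (K : Set H).Finite)
    (a b : H) {n : ℕ} (hn : n ≠ 0) :
    ∃ z w : H, (∀ k ∈ K, z * k = k * z) ∧ (∀ k ∈ K, w * k = k * w) ∧
      ⁅(a * z)⁻¹ * α (a * z), b * w⁆ ^ n ≠ 1 := by
  set L := Subgroup.closure ((K : Set H) ∪ {b}) with hL
  have hLfin : (L : Set H).Finite := hH.locallyFinite.closure_finite (hK.union (by simp))
  have hKL : ∀ k ∈ K, k ∈ L := fun k hk => Subgroup.subset_closure (Or.inl hk)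
  have hbL : b ∈ L := Subgroup.subset_closure (Or.inr rfl)
  obtain ⟨z, hz, hzL⟩ : ∃ z, (∀ k ∈ L, z * k = k * z) ∧ (a * z)⁻¹ * α (a * z) ∉ L := by
    by_contra! h
    have h1 := h 1 (by simp)
    rw [mul_one] at h1
    refine hα ?_
    have := hH.mem_range_conj hLfin (MulAut.conj (a⁻¹ * α a) * α) (fun z hz => by
      have := L.mul_mem (h z hz) (L.inv_mem h1)
      convert this using 1
      simp only [MulAut.mul_apply, MulAut.conj_apply, map_mul]
      group)
    exact (Subgroup.mul_mem_cancel_left _ (MonoidHom.mem_range.mpr ⟨a⁻¹ * α a, rfl⟩)).mp this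
  set s := (a * z)⁻¹ * α (a * z) with hs
  obtain ⟨w, hw, hpow⟩ := hH.exists_commute_pow_ne_one hLfin (s := s⁻¹) (t := b⁻¹ * s * b)
    (by simpa using hzL) (fun h => hzL (by
      have := L.mul_mem (L.mul_mem hbL h) (L.inv_mem hbL)
      convert this using 1
      group)) hn
  refine ⟨z, w, fun k hk => hz k (hKL k hk), fun k hk => hw k (hKL k hk), fun h => hpow ?_⟩
  have e : ⁅s, b * w⁆ = b * (b⁻¹ * s * b * (w * s⁻¹ * w⁻¹)) * b⁻¹ := by
    rw [commutatorElement_def]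
    group
  rw [e, conj_pow] at h
  simpa using h

end IsHallUniversal_s4

/-- The value at each point of the automorphism `Φ β` depends, near `b`, only on the values of
`β` on a finite set: continuity at `b` for pointwise convergence. -/
def FinitelyDeterminedAt {H : Type*} [Group H] (b : MulAut H × MulAut H)
    (Φ : MulAut H × MulAut H → MulAut H) : Prop :=
  ∀ x, ∃ S : Set H, S.Finite ∧ ∀ β : MulAut H × MulAut H,
    (∀ u ∈ S, β.1 u = b.1 u ∧ β.2 u = b.2 u) → Φ β x = Φ b x

namespace FinitelyDeterminedAt

variable {H : Type*} [Group H] {b : MulAut H × MulAut H} {Φ Ψ : MulAut H × MulAut H → MulAut H}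

theorem const (b : MulAut H × MulAut H) (α : MulAut H) : FinitelyDeterminedAt b fun _ => α :=
  fun _ => ⟨∅, Set.finite_empty, fun _ _ => rfl⟩

theorem fst (b : MulAut H × MulAut H) : FinitelyDeterminedAt b fun β => β.1 :=
  fun x => ⟨{x}, Set.finite_singleton x, fun _ h => (h x rfl).1⟩

theorem snd (b : MulAut H × MulAut H) : FinitelyDeterminedAt b fun β => β.2 :=
  fun x => ⟨{x}, Set.finite_singleton x, fun _ h => (h x rfl).2⟩

theorem mul (hΦ : FinitelyDeterminedAt b Φ) (hΨ : FinitelyDeterminedAt b Ψ) :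
    FinitelyDeterminedAt b fun β => Φ β * Ψ β := by
  intro x
  obtain ⟨S, hS, h⟩ := hΨ x
  obtain ⟨T, hT, h'⟩ := hΦ (Ψ b x)
  refine ⟨S ∪ T, hS.union hT, fun β hβ => ?_⟩
  rw [MulAut.mul_apply, MulAut.mul_apply, h β fun u hu => hβ u (Or.inl hu),
    h' β fun u hu => hβ u (Or.inr hu)]

theorem inv (hΦ : FinitelyDeterminedAt b Φ) : FinitelyDeterminedAt b fun β => (Φ β)⁻¹ := by
  intro x
  obtain ⟨S, hS, h⟩ := hΦ ((Φ b)⁻¹ x)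
  refine ⟨S, hS, fun β hβ => ?_⟩
  have := h β hβ
  rw [MulAut.apply_inv_self] at this
  conv_lhs => rw [← this]
  rw [MulAut.inv_apply_self]

theorem pow (hΦ : FinitelyDeterminedAt b Φ) (n : ℕ) :
    FinitelyDeterminedAt b fun β => Φ β ^ n := by
  induction n with
  | zero => simpa using const b 1
  | succ n ih => simpa only [pow_succ] using ih.mul hΦ

end FinitelyDeterminedAt

/-- A sequence of inner automorphisms that stabilizes on an exhausting chain of subgroups
converges to an automorphism. -/
theorem exists_mulAut_of_stabilizing {H : Type*} [Group H] (h : ℕ → H) (K : ℕ → Subgroup H)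
    (hK : Monotone K)
    (hstab : ∀ n, ∀ k ∈ K n, h (n + 1) * k * (h (n + 1))⁻¹ = h n * k * (h n)⁻¹)
    (hdom : ∀ x, ∃ n, x ∈ K n) (hran : ∀ x, ∃ n, (h n)⁻¹ * x * h n ∈ K n) :
    ∃ β : MulAut H, ∀ n, ∀ k ∈ K n, β k = MulAut.conj (h n) k := by
  have hst : ∀ n m, n ≤ m → ∀ k ∈ K n, h m * k * (h m)⁻¹ = h n * k * (h n)⁻¹ := by
    intro n m hnm
    induction m, hnm using Nat.le_induction with
    | base => exact fun _ _ => rfl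
    | succ m hm ih => exact fun k hk => (hstab m k (hK hm hk)).trans (ih k hk)
  choose N hN using hdom
  have hval : ∀ n, ∀ k ∈ K n, h (N k) * k * (h (N k))⁻¹ = h n * k * (h n)⁻¹ := by
    intro n k hk
    rcases le_total n (N k) with hle | hle
    · exact hst _ _ hle k hk
    · exact (hst _ _ hle k (hN k)).symm
  let f : H →* H := MonoidHom.mk' (fun x => h (N x) * x * (h (N x))⁻¹) (fun x y => by
    have hx : x ∈ K (max (N x) (N y)) := hK (le_max_left _ _) (hN x)
    have hy : y ∈ K (max (N x) (N y)) := hK (le_max_right _ _) (hN y)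
    rw [hval _ x hx, hval _ y hy, hval _ (x * y) (mul_mem hx hy)]
    group)
  have hf : ∀ n, ∀ k ∈ K n, f k = h n * k * (h n)⁻¹ := hval
  refine ⟨MulEquiv.ofBijective f ⟨?_, ?_⟩, fun n k hk => ?_⟩
  · rw [injective_iff_map_eq_one]
    intro x hx
    rw [hf _ x (hN x)] at hx
    simpa using hx
  · intro x
    obtain ⟨n, hn⟩ := hran x
    refine ⟨_, (hf n _ hn).trans ?_⟩
    group
  · exact hf n k hk

/-- If `α` is not inner, some word `⁅β₁⁻¹ α β₁ α⁻¹, β₂⁆` has infinite order. -/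
theorem IsHallUniversal_s4.exists_commutator_infinite_order {H : Type} [Group H] [Countable H]
    (hH : IsHallUniversal_s4 H) {α : MulAut H} (hα : α ∉ (MulAut.conj : H →* MulAut H).range) :
    ∃ β : MulAut H × MulAut H, ∀ n : ℕ, ⁅β.1⁻¹ * α * β.1 * α⁻¹, β.2⁆ ^ (n + 1) ≠ 1 := by
  obtain ⟨e, he⟩ := exists_surjective_nat H
  let State := {p : (H × H) × Subgroup H // (p.2 : Set H).Finite}
  have step : ∀ (n : ℕ) (p : State), ∃ q : State, p.1.2 ≤ q.1.2 ∧
      (∀ k ∈ p.1.2, q.1.1.1 * k * (q.1.1.1)⁻¹ = p.1.1.1 * k * (p.1.1.1)⁻¹) ∧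
      (∀ k ∈ p.1.2, q.1.1.2 * k * (q.1.1.2)⁻¹ = p.1.1.2 * k * (p.1.1.2)⁻¹) ∧
      e n ∈ q.1.2 ∧ (q.1.1.1)⁻¹ * e n * q.1.1.1 ∈ q.1.2 ∧
      (q.1.1.2)⁻¹ * e n * q.1.1.2 ∈ q.1.2 ∧
      ∀ β : MulAut H × MulAut H,
        (∀ u ∈ q.1.2, β.1 u = MulAut.conj q.1.1.1 u ∧ β.2 u = MulAut.conj q.1.1.2 u) →
        ⁅β.1⁻¹ * α * β.1 * α⁻¹, β.2⁆ ^ (n + 1) ≠ 1 := by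
    rintro n ⟨⟨⟨a, b⟩, K⟩, hK⟩
    obtain ⟨z, w, hz, hw, hpow⟩ :=
      hH.exists_commutator_pow_ne_one hα hK a b (Nat.succ_ne_zero n)
    obtain ⟨x, hx⟩ := hH.exists_not_commute hpow
    let c : MulAut H × MulAut H := (MulAut.conj (a * z), MulAut.conj (b * w))
    have hσ : FinitelyDeterminedAt c fun β => β.1⁻¹ * α * β.1 * α⁻¹ :=
      (((FinitelyDeterminedAt.fst c).inv.mul (.const c α)).mul (.fst c)).mul (.const c α⁻¹)
    obtain ⟨S, hS, hdet⟩ := (((hσ.mul (.snd c)).mul hσ.inv).mul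
      (FinitelyDeterminedAt.snd c).inv).pow (n + 1) x
    refine ⟨⟨⟨(a * z, b * w), Subgroup.closure ((K : Set H) ∪ S ∪
      {e n, (a * z)⁻¹ * e n * (a * z), (b * w)⁻¹ * e n * (b * w)})⟩,
      hH.locallyFinite.closure_finite ((hK.union hS).union (by simp))⟩,
      fun k hk => Subgroup.subset_closure (Or.inl (Or.inl hk)), fun k hk => ?_, fun k hk => ?_,
      Subgroup.subset_closure (by simp), Subgroup.subset_closure (by simp),
      Subgroup.subset_closure (by simp), fun β hβ h1 => ?_⟩
    · calc a * z * k * (a * z)⁻¹ = a * (z * k) * z⁻¹ * a⁻¹ := by group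
        _ = a * k * a⁻¹ := by rw [hz k hk]; group
    · calc b * w * k * (b * w)⁻¹ = b * (w * k) * w⁻¹ * b⁻¹ := by group
        _ = b * k * b⁻¹ := by rw [hw k hk]; group
    · have h2 := hdet β fun u hu => hβ u (Subgroup.subset_closure (Or.inl (Or.inr hu)))
      rw [commutatorElement_def] at h1
      have hs : c.1⁻¹ * α * c.1 * α⁻¹ = MulAut.conj ((a * z)⁻¹ * α (a * z)) := by
        ext y
        simp [c, mul_assoc]
      simp only [h1, hs] at h2
      rw [show c.2 = MulAut.conj (b * w) from rfl, ← map_inv, ← map_inv, ← map_mul, ← map_mul,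
        ← map_mul, ← map_pow, ← commutatorElement_def, MulAut.conj_apply, MulAut.one_apply] at h2
      exact hx (eq_mul_inv_iff_mul_eq.mp h2).symm
  choose next hle h₁ h₂ hmem hmem₁ hmem₂ hbad using step
  let p : ℕ → State := fun n => Nat.rec ⟨((1, 1), ⊥), by simp⟩ next n
  have hmono : Monotone fun n => (p n).1.2 := monotone_nat_of_le_succ fun n => hle n (p n)
  obtain ⟨β₁, hβ₁⟩ := exists_mulAut_of_stabilizing (fun n => (p n).1.1.1) (fun n => (p n).1.2)
    hmono (fun n => h₁ n (p n))
    (fun x => (he x).elim fun n hn => ⟨n + 1, hn ▸ hmem n (p n)⟩)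
    (fun x => (he x).elim fun n hn => ⟨n + 1, hn ▸ hmem₁ n (p n)⟩)
  obtain ⟨β₂, hβ₂⟩ := exists_mulAut_of_stabilizing (fun n => (p n).1.1.2) (fun n => (p n).1.2)
    hmono (fun n => h₂ n (p n))
    (fun x => (he x).elim fun n hn => ⟨n + 1, hn ▸ hmem n (p n)⟩)
    (fun x => (he x).elim fun n hn => ⟨n + 1, hn ▸ hmem₂ n (p n)⟩)
  exact ⟨(β₁, β₂), fun n => hbad n (p n) (β₁, β₂) fun u hu => ⟨hβ₁ (n + 1) u hu, hβ₂ (n + 1) u hu⟩⟩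

/-- **`Inn(H)` is the locally finite radical of `Aut(H)`.**
If `H` is Hall's universal group (countable, locally finite, embedding every finite group,
homogeneous for finite subgroups), then `Inn(H)` (the range of the conjugation homomorphism
`H →* Aut(H)`) is a normal subgroup of `Aut(H)`, it is locally finite as a group, and every
locally finite normal subgroup of `Aut(H)` is contained in it. -/
theorem inn_is_locally_finite_radical
    {H : Type} [Group H] [Countable H]
    (hLF : ∀ s : Finset H, ((Subgroup.closure (s : Set H) : Subgroup H) : Set H).Finite)
    (hEmb : ∀ (G : Type) [Group G] [Finite G], ∃ e : G →* H, Function.Injective e)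
    (hHom : ∀ K L : Subgroup H, (K : Set H).Finite → (L : Set H).Finite →
      ∀ φ : ↥K ≃* ↥L, ∃ h : H, ∀ k : K, (φ k : H) = h * (k : H) * h⁻¹) :
    ((MulAut.conj : H →* MulAut H).range).Normal ∧
    IsLocallyFiniteGroup ↥((MulAut.conj : H →* MulAut H).range) ∧
    ∀ N : Subgroup (MulAut H), N.Normal → IsLocallyFiniteGroup ↥N →
      N ≤ (MulAut.conj : H →* MulAut H).range := by
  have hH : IsHallUniversal_s4 H := ⟨hLF, hEmb, hHom⟩
  refine ⟨MulAut.conj_range_normal H, hH.locallyFinite.of_surjective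
    MulAut.conj.rangeRestrict MulAut.conj.rangeRestrict_surjective, fun N hN hNLF α hαN => ?_⟩
  by_contra hα
  obtain ⟨β, hβ⟩ := hH.exists_commutator_infinite_order hα
  have hσ : β.1⁻¹ * α * β.1 * α⁻¹ ∈ N := by
    refine N.mul_mem ?_ (N.inv_mem hαN)
    simpa using hN.conj_mem α hαN β.1⁻¹
  have hW : ⁅β.1⁻¹ * α * β.1 * α⁻¹, β.2⁆ ∈ N := by
    rw [commutatorElement_def, mul_assoc, mul_assoc, ← mul_assoc β.2]
    exact N.mul_mem hσ (hN.conj_mem _ (N.inv_mem hσ) β.2)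
  obtain ⟨n, hn⟩ := hNLF.exists_pow_eq_one ⟨_, hW⟩
  exact hβ n (by simpa using congrArg Subtype.val hn)
end

section
/- Let H be Hall's universal group and let f ∈ Aut(H) be an automorphism of finite order which is not inner. Then there exists g ∈ Aut(H) such that the automorphism g⁻¹ f⁻¹ g f has infinite order. Consequently, every normal subgroup of Aut(H) properly containing Inn(H) contains an element of infinite order, hence is not locally finite. -/
/-- Hall's universal group, without the countability condition. -/
structure IsHallGroup (H : Type) [Group H] : Prop where
  locallyFinite : IsLocallyFiniteGroup H
  embeds : ∀ (G : Type) [Group G] [Finite G], ∃ e : G →* H, Function.Injective e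
  homogeneous : ∀ K L : Subgroup H, (K : Set H).Finite → (L : Set H).Finite →
    ∀ φ : ↥K ≃* ↥L, ∃ h : H, ∀ k : K, (φ k : H) = h * (k : H) * h⁻¹

theorem IsLocallyFiniteGroup.finite_closure {G : Type*} [Group G] (hG : IsLocallyFiniteGroup G)
    {s : Set G} (hs : s.Finite) : (Subgroup.closure s : Set G).Finite := by
  have := hG hs.toFinset
  rwa [hs.coe_toFinset] at this

theorem IsLocallyFiniteGroup.finite_sup {G : Type*} [Group G] (hG : IsLocallyFiniteGroup G)
    {K L : Subgroup G} (hK : (K : Set G).Finite) (hL : (L : Set G).Finite) :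
    ((K ⊔ L : Subgroup G) : Set G).Finite := by
  rw [← Subgroup.closure_eq K, ← Subgroup.closure_eq L, ← Subgroup.closure_union]
  exact hG.finite_closure (hK.union hL)

theorem IsLocallyFiniteGroup.isOfFinOrder {G : Type*} [Group G] (hG : IsLocallyFiniteGroup G)
    (x : G) : IsOfFinOrder x := by
  have h := hG.finite_closure (Set.finite_singleton x)
  rw [← Subgroup.zpowers_eq_closure] at h
  exact finite_zpowers.1 h

/-- The automorphism `f` of finite order maps a finite subset into a finite invariant subgroup. -/
theorem IsLocallyFiniteGroup.exists_invariant {G : Type*} [Group G] (hG : IsLocallyFiniteGroup G)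
    {f : MulAut G} (hf : IsOfFinOrder f) {s : Set G} (hs : s.Finite) :
    ∃ D : Subgroup G, (D : Set G).Finite ∧ s ⊆ D ∧ ∀ d ∈ D, f d ∈ D := by
  let t : Set G := ⋃ φ ∈ (Subgroup.zpowers f : Set (MulAut G)), φ '' s
  have ht : t.Finite := Set.Finite.biUnion (finite_zpowers.2 hf) fun φ _ => hs.image φ
  refine ⟨Subgroup.closure t, hG.finite_closure ht, ?_, ?_⟩
  · intro x hx
    refine Subgroup.subset_closure (Set.mem_iUnion₂.2 ⟨1, Subgroup.one_mem _, x, hx, rfl⟩)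
  · intro d hd
    have : Subgroup.closure t ≤ (Subgroup.closure t).comap f.toMonoidHom := by
      rw [Subgroup.closure_le]
      intro x hx
      obtain ⟨φ, hφ, y, hy, rfl⟩ := Set.mem_iUnion₂.1 hx
      refine Subgroup.subset_closure (Set.mem_iUnion₂.2 ⟨f * φ, ?_, y, hy, rfl⟩)
      exact Subgroup.mul_mem _ (Subgroup.mem_zpowers f) hφ
    exact this hd

/-- A generic construction of automorphisms by successive approximation of inner ones. -/
theorem IsLocallyFiniteGroup.exists_mulAut {H : Type*} [Group H] [Countable H]
    (hH : IsLocallyFiniteGroup H) (P : ℕ → MulAut H → Prop)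
    (hP : ∀ (n : ℕ) (D : Subgroup H) (h : H), (D : Set H).Finite →
      ∃ (D' : Subgroup H) (h' : H), (D' : Set H).Finite ∧ D ≤ D' ∧
        (∀ d ∈ D, h' * d * h'⁻¹ = h * d * h⁻¹) ∧
        ∀ g : MulAut H, (∀ d ∈ D', g d = h' * d * h'⁻¹) → P n g) :
    ∃ g : MulAut H, ∀ n, P n g := by
  obtain ⟨a, ha⟩ := exists_surjective_nat H
  have step : ∀ (n : ℕ) (p : {p : Subgroup H × H // (p.1 : Set H).Finite}),
      ∃ q : {p : Subgroup H × H // (p.1 : Set H).Finite}, p.1.1 ≤ q.1.1 ∧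
        (∀ d ∈ p.1.1, q.1.2 * d * q.1.2⁻¹ = p.1.2 * d * p.1.2⁻¹) ∧
        a n ∈ q.1.1 ∧ q.1.2⁻¹ * a n * q.1.2 ∈ q.1.1 ∧
        ∀ g : MulAut H, (∀ d ∈ q.1.1, g d = q.1.2 * d * q.1.2⁻¹) → P n g := by
    rintro n ⟨⟨D, h⟩, hD⟩
    obtain ⟨D', h', hfin, hle, hagree, hg⟩ := hP n D h hD
    refine ⟨⟨⟨D' ⊔ Subgroup.closure {a n, h'⁻¹ * a n * h'}, h'⟩, hH.finite_sup hfin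
      (hH.finite_closure (Set.toFinite _))⟩, hle.trans le_sup_left, hagree,
      le_sup_right (a := D') (Subgroup.subset_closure (by simp)),
      le_sup_right (a := D') (Subgroup.subset_closure (by simp)), fun g hg' => ?_⟩
    exact hg g fun d hd => hg' d (le_sup_left (a := D') hd)
  choose next hle hagree hmem hmem' hnext using step
  let p : ℕ → {p : Subgroup H × H // (p.1 : Set H).Finite} :=
    fun n => Nat.rec ⟨⟨⊥, 1⟩, by simp⟩ (fun n q => next n q) n
  have hp : ∀ n, p (n + 1) = next n (p n) := fun _ => rfl
  have hmono : Monotone fun n => (p n).1.1 := monotone_nat_of_le_succ fun n => hle n (p n)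
  have hcoh : ∀ m n, m ≤ n → ∀ d ∈ (p m).1.1,
      (p n).1.2 * d * (p n).1.2⁻¹ = (p m).1.2 * d * (p m).1.2⁻¹ := by
    intro m n hmn
    induction n, hmn using Nat.le_induction with
    | base => intros; rfl
    | succ n hmn ih =>
      intro d hd
      rw [← ih d hd]
      exact hagree n (p n) d (hmono hmn hd)
  have hex : ∀ x : H, ∃ n, x ∈ (p n).1.1 := by
    intro x
    obtain ⟨n, rfl⟩ := ha x
    exact ⟨n + 1, hmem n (p n)⟩
  choose idx hidx using hex
  let g₀ : H → H := fun x => (p (idx x)).1.2 * x * (p (idx x)).1.2⁻¹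
  have hg₀ : ∀ n, ∀ d ∈ (p n).1.1, g₀ d = (p n).1.2 * d * (p n).1.2⁻¹ := by
    intro n d hd
    rcases le_total n (idx d) with h | h
    · exact hcoh _ _ h d hd
    · exact (hcoh _ _ h d (hidx d)).symm
  have hpair : ∀ x y : H, ∃ n, x ∈ (p n).1.1 ∧ y ∈ (p n).1.1 := fun x y =>
    ⟨max (idx x) (idx y), hmono (le_max_left _ _) (hidx x), hmono (le_max_right _ _) (hidx y)⟩
  let g₁ : H →* H := MonoidHom.mk' g₀ fun x y => by
    obtain ⟨n, hx, hy⟩ := hpair x y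
    rw [hg₀ n x hx, hg₀ n y hy, hg₀ n _ (mul_mem hx hy)]
    group
  have hbij : Function.Bijective g₁ := by
    constructor
    · intro x y hxy
      obtain ⟨n, hx, hy⟩ := hpair x y
      change g₀ x = g₀ y at hxy
      rw [hg₀ n x hx, hg₀ n y hy] at hxy
      exact (MulAut.conj (p n).1.2).injective hxy
    · intro x
      obtain ⟨n, rfl⟩ := ha x
      refine ⟨(p (n + 1)).1.2⁻¹ * a n * (p (n + 1)).1.2, ?_⟩
      refine (hg₀ (n + 1) _ (hmem' n (p n))).trans ?_
      rw [hp]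
      group
  exact ⟨MulEquiv.ofBijective g₁ hbij, fun n => hnext n (p n) _ (hg₀ (n + 1))⟩

namespace IsHallGroup

variable {H : Type} [Group H]

/-- An embedding of a finite subgroup `B` into a finite group `G` is undone by an embedding of
`G` into `H`. -/
theorem exists_extension (hH : IsHallGroup H) {B : Subgroup H} (hB : (B : Set H).Finite)
    {G : Type} [Group G] [Finite G] (e : B →* G) (he : Function.Injective e) :
    ∃ ι : G →* H, Function.Injective ι ∧ ∀ b (hb : b ∈ B), ι (e ⟨b, hb⟩) = b := by
  obtain ⟨ι, hι⟩ := hH.embeds G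
  have hinj : Function.Injective (ι.comp e) := hι.comp he
  have : Finite B := hB
  have hfin : ((ι.comp e).range : Set H).Finite := by
    rw [MonoidHom.coe_range]
    exact Set.finite_range _
  obtain ⟨h, hh⟩ := hH.homogeneous _ B hfin hB (MonoidHom.ofInjective hinj).symm
  refine ⟨(MulAut.conj h).toMonoidHom.comp ι, (MulAut.conj h).injective.comp hι, fun b hb => ?_⟩
  have := hh (MonoidHom.ofInjective hinj ⟨b, hb⟩)
  rw [MulEquiv.symm_apply_apply] at this
  exact this.symm

theorem exists_conj_mul_notMem (hH : IsHallGroup H) {D E : Subgroup H} (hD : (D : Set H).Finite)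
    (hE : (E : Set H).Finite) {w y : H} (hw : w ∉ D) (hy : y ∉ D) :
    ∃ k ∈ Subgroup.centralizer (D : Set H),
      (k⁻¹ * w * k) * y * (k⁻¹ * w * k)⁻¹ ∉ E := by
  classical
  let B : Subgroup H := D ⊔ E ⊔ Subgroup.closure {w, y}
  have hB : (B : Set H).Finite := hH.locallyFinite.finite_sup
    (hH.locallyFinite.finite_sup hD hE) (hH.locallyFinite.finite_closure (Set.toFinite _))
  have hDB : D ≤ B := le_sup_left.trans le_sup_left
  have hEB : E ≤ B := le_sup_right.trans le_sup_left
  have hcB : Subgroup.closure {w, y} ≤ B := le_sup_right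
  have hwB : w ∈ B := hcB (Subgroup.subset_closure (by simp))
  have hyB : y ∈ B := hcB (Subgroup.subset_closure (by simp))
  have : Finite B := hB
  let e : B →* Equiv.Perm (B × ZMod 3) :=
    { toFun := fun b => Equiv.prodCongr (Equiv.mulLeft b) (Equiv.refl _)
      map_one' := by ext x <;> simp
      map_mul' := fun a b => by ext x <;> simp [mul_assoc] }
  have he_apply : ∀ b x i, e b (x, i) = (b * x, i) := fun _ _ _ => rfl
  have he : Function.Injective e := fun a b hab => by
    have := congrArg (fun σ => (σ (1, 0)).1) hab
    simpa [he_apply] using this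
  let κ : Equiv.Perm (B × ZMod 3) := Equiv.prodShear (Equiv.refl B)
    fun b => if (b : H) ∈ D then Equiv.addRight 1 else Equiv.refl _
  have hκ : ∀ b i, κ (b, i) = (b, if (b : H) ∈ D then i + 1 else i) := by
    intro b i
    by_cases h : (b : H) ∈ D <;> simp [κ, h]
  have hκ' : ∀ b i, κ⁻¹ (b, i) = (b, if (b : H) ∈ D then i - 1 else i) := by
    intro b i
    rw [Equiv.Perm.inv_eq_iff_eq, hκ]
    by_cases h : (b : H) ∈ D <;> simp [h]
  obtain ⟨ι, hι, hιe⟩ := hH.exists_extension hB e he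
  refine ⟨ι κ, Subgroup.mem_centralizer_iff.2 fun d hd => ?_, fun hmem => ?_⟩
  · rw [← hιe d (hDB hd), ← map_mul, ← map_mul]
    congr 1
    ext ⟨b, i⟩ : 1
    have : d * (b : H) ∈ D ↔ (b : H) ∈ D := Subgroup.mul_mem_cancel_left _ hd
    simp [he_apply, hκ, this]
  · set v := (ι κ)⁻¹ * w * ι κ * y * ((ι κ)⁻¹ * w * ι κ)⁻¹ with hv
    have hv' : (ι κ)⁻¹ * w * ι κ * y = v * ((ι κ)⁻¹ * w * ι κ) := by rw [hv]; group
    rw [← hιe w hwB, ← hιe y hyB, ← hιe v (hEB hmem)] at hv'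
    simp only [← map_inv, ← map_mul] at hv'
    have h2 := congrArg (fun σ => (σ (1, 0)).2) (hι hv')
    simp only [Equiv.Perm.mul_apply, he_apply, hκ, hκ', hw, hy, mul_one, OneMemClass.coe_one,
      one_mem, if_true, if_false] at h2
    split_ifs at h2 <;> revert h2 <;> decide

theorem mem_of_mem_centralizer_centralizer (hH : IsHallGroup H) {D : Subgroup H}
    (hD : (D : Set H).Finite) {x : H}
    (hx : ∀ k ∈ Subgroup.centralizer (D : Set H), k * x = x * k) : x ∈ D := by
  by_contra hxD
  obtain ⟨k, hk, hkx⟩ := hH.exists_conj_mul_notMem hD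
    (hH.locallyFinite.finite_closure (Set.finite_singleton x)) hxD hxD
  apply hkx
  have : k⁻¹ * x * k = x := by rw [mul_assoc, ← hx k hk, inv_mul_cancel_left]
  rw [this, mul_inv_cancel_right]
  exact Subgroup.subset_closure rfl

theorem exists_conj_notMem (hH : IsHallGroup H) {D E : Subgroup H} (hD : (D : Set H).Finite)
    (hE : (E : Set H).Finite) {y : H} (hy : y ∉ D) :
    ∃ k ∈ Subgroup.centralizer (D : Set H), k * y * k⁻¹ ∉ E := by
  by_contra! h
  obtain ⟨k, hk, hky⟩ := hH.exists_conj_mul_notMem hD hE hy hy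
  have h1 := h 1 (one_mem _)
  have h2 := h k⁻¹ (inv_mem hk)
  simp only [one_mul, inv_one, mul_one, inv_inv] at h1 h2
  exact hky (mul_mem (mul_mem h2 h1) (inv_mem h2))

theorem exists_not_commute (hH : IsHallGroup H) {x : H} (hx : x ≠ 1) : ∃ y, y * x ≠ x * y := by
  by_contra! h
  exact hx (Subgroup.mem_bot.1 (hH.mem_of_mem_centralizer_centralizer (by simp) fun k _ => h k))

/-- Every finite subgroup commutes with its conjugate by some involution. -/
theorem exists_involution_conj_commute (hH : IsHallGroup H) {X : Subgroup H}
    (hX : (X : Set H).Finite) :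
    ∃ u : H, u * u = 1 ∧ ∀ x ∈ X, ∀ y ∈ X, x * (u * y * u) = (u * y * u) * x := by
  have : Finite X := hX
  let e : X →* Equiv.Perm (X ⊕ X) := (Equiv.Perm.sumCongrHom X X).comp
    ((MonoidHom.inl _ _).comp (MulAction.toPermHom X X))
  have he_inl : ∀ x p, e x (Sum.inl p) = Sum.inl (x * p) := fun _ _ => rfl
  have he_inr : ∀ x p, e x (Sum.inr p) = Sum.inr p := fun _ _ => rfl
  have he : Function.Injective e := fun a b hab => by
    have := congrArg (fun σ => σ (Sum.inl 1)) hab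
    simpa [he_inl] using this
  let s : Equiv.Perm (X ⊕ X) := Equiv.sumComm X X
  have hs_inl : ∀ p, s (Sum.inl p) = Sum.inr p := fun _ => rfl
  have hs_inr : ∀ p, s (Sum.inr p) = Sum.inl p := fun _ => rfl
  obtain ⟨ι, -, hιe⟩ := hH.exists_extension hX e he
  refine ⟨ι s, ?_, fun x hx y hy => ?_⟩
  · rw [← map_mul, ← map_one ι]
    congr 1
    ext (p | p) : 1 <;> simp [hs_inl, hs_inr]
  · rw [← hιe x hx, ← hιe y hy]
    simp only [← map_mul]
    congr 1
    ext (p | p) : 1 <;> simp [he_inl, he_inr, hs_inl, hs_inr]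

/-- An automorphism acting trivially on the centralizer of a finite subgroup is inner. -/
theorem mem_range_conj_of_forall_centralizer (hH : IsHallGroup H) {f : MulAut H}
    {D : Subgroup H} (hD : (D : Set H).Finite)
    (hf : ∀ k ∈ Subgroup.centralizer (D : Set H), f k = k) :
    f ∈ (MulAut.conj : H →* MulAut H).range := by
  have key : ∀ X : Subgroup H, (X : Set H).Finite → D ≤ X →
      ∃ a ∈ D, ∀ x ∈ X, f x = a * x * a⁻¹ := by
    intro X hX hDX
    obtain ⟨u, hu, hcomm⟩ := hH.exists_involution_conj_commute hX
    have hu' : u⁻¹ = u := inv_eq_of_mul_eq_one_left hu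
    have huu : ∀ x, u * (u * x) = x := fun x => by rw [← mul_assoc, hu, one_mul]
    have : Finite D := hD
    let ψ : D × D →* H := MonoidHom.noncommCoprod D.subtype
      ((MulAut.conj u).toMonoidHom.comp D.subtype) fun a b => by
        have := hcomm a (hDX a.2) b (hDX b.2)
        simpa [Commute, SemiconjBy, hu'] using this
    have hψ : ∀ a b : D, ψ (a, b) = a * (u * b * u) := fun a b => by
      simp [ψ, MonoidHom.noncommCoprod_apply, hu']
    have hψfin : (ψ.range : Set H).Finite := by
      rw [MonoidHom.coe_range]
      exact Set.finite_range _
    have hfu : f u * f u = 1 := by rw [← map_mul, hu, map_one]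
    have hmem : u * f u ∈ ψ.range := by
      refine hH.mem_of_mem_centralizer_centralizer hψfin fun c hc => ?_
      rw [Subgroup.mem_centralizer_iff] at hc
      have hc₁ : f c = c := hf c <| Subgroup.mem_centralizer_iff.2 fun d hd =>
        hc d ⟨(⟨d, hd⟩, 1), by simp [hψ, hu]⟩
      have hc₂ : f (u * c * u) = u * c * u := hf _ <| Subgroup.mem_centralizer_iff.2 fun d hd => by
        have h := hc (u * d * u) ⟨(1, ⟨d, hd⟩), by simp [hψ]⟩
        calc d * (u * c * u) = u * ((u * d * u) * c) * u := by simp only [mul_assoc, huu]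
          _ = u * (c * (u * d * u)) * u := by rw [h]
          _ = u * c * u * d := by simp only [mul_assoc, hu, mul_one]
      rw [map_mul, map_mul, hc₁] at hc₂
      calc c * (u * f u) = u * (u * c * u) * f u := by simp only [mul_assoc, huu]
        _ = u * (f u * c * f u) * f u := by rw [hc₂]
        _ = u * f u * c := by simp only [mul_assoc, hfu, mul_one]
    obtain ⟨⟨a, b⟩, hab⟩ := hmem
    rw [hψ] at hab
    have hv : f u = u * a * u * b * u := by
      rw [← huu (f u), ← hab]
      simp only [mul_assoc]
    have hv' : f u = u * (b : H)⁻¹ * u * (a : H)⁻¹ * u := by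
      rw [eq_inv_of_mul_eq_one_left hfu, hv]
      simp only [mul_inv_rev, hu', mul_assoc]
    refine ⟨b, b.2, fun x hx => ?_⟩
    have hxc : f (u * x * u) = u * x * u := hf _ <| Subgroup.mem_centralizer_iff.2 fun d hd =>
      hcomm d (hDX hd) x hx
    have hac := hcomm a (hDX a.2) (b * x * (b : H)⁻¹)
      (mul_mem (mul_mem (hDX b.2) hx) (inv_mem (hDX b.2)))
    calc f x = f (u * (u * x * u) * u) := by simp only [mul_assoc, huu, hu, mul_one]
      _ = f u * (u * x * u) * f u := by rw [map_mul, map_mul, hxc]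
      _ = (u * a * u * b * u) * (u * x * u) * (u * (b : H)⁻¹ * u * (a : H)⁻¹ * u) := by
        rw [← hv, ← hv']
      _ = u * (a * (u * (b * x * (b : H)⁻¹) * u)) * (a : H)⁻¹ * u := by
        simp only [mul_assoc, huu]
      _ = b * x * (b : H)⁻¹ := by
        rw [hac]
        simp only [mul_assoc, huu, mul_inv_cancel_left, hu, mul_one]
  by_contra hnot
  have hne : ∀ a : H, ∃ x, f x ≠ a * x * a⁻¹ := by
    intro a
    by_contra! h
    exact hnot ⟨a, MulEquiv.ext fun x => (h x).symm⟩
  choose x hx using hne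
  obtain ⟨a, ha, hax⟩ := key (D ⊔ Subgroup.closure (x '' D))
    (hH.locallyFinite.finite_sup hD (hH.locallyFinite.finite_closure (hD.image x))) le_sup_left
  exact hx a (hax _ (le_sup_right (a := D) (Subgroup.subset_closure ⟨a, ha, rfl⟩)))

theorem exists_apply_conj_notMem (hH : IsHallGroup H) {f : MulAut H} (hf : IsOfFinOrder f)
    (hf' : f ∉ (MulAut.conj : H →* MulAut H).range) {D : Subgroup H} (hD : (D : Set H).Finite)
    {y : H} (hy : y ∉ D) :
    ∃ k ∈ Subgroup.centralizer (D : Set H),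
      f (k * y * k⁻¹) ∉ D ⊔ Subgroup.zpowers (k * y * k⁻¹) := by
  by_contra! hcon
  obtain ⟨D₁, hD₁, hDD₁, hinv⟩ := hH.locallyFinite.exists_invariant hf hD
  have hcent : ∀ x : H, ∃ z, x ≠ 1 → z * x ≠ x * z := fun x => by
    by_cases hx : x = 1
    · exact ⟨1, fun h => absurd hx h⟩
    · obtain ⟨z, hz⟩ := hH.exists_not_commute hx
      exact ⟨z, fun _ => hz⟩
  choose z hz using hcent
  obtain ⟨D₂, hD₂, hsub, hinv₂⟩ := hH.locallyFinite.exists_invariant hf (hD₁.union (hD₁.image z))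
  have hD₁₂ : D₁ ≤ D₂ := fun d hd => hsub (Or.inl hd)
  obtain ⟨k₀, hk₀, hne⟩ : ∃ k ∈ Subgroup.centralizer (D₂ : Set H), f k ≠ k := by
    by_contra! h
    exact hf' (hH.mem_range_conj_of_forall_centralizer hD₂ h)
  have hk₀' : k₀ ∈ Subgroup.centralizer (D₁ : Set H) :=
    Subgroup.centralizer_le (show (D₁ : Set H) ⊆ D₂ from hD₁₂) hk₀
  have hfsurj : ∀ d ∈ D₂, ∃ d' ∈ D₂, f d' = d := by
    intro d hd
    have hmaps : Set.MapsTo f (D₂ : Set H) D₂ := hinv₂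
    have := (hD₂.injOn_iff_bijOn_of_mapsTo hmaps).1 f.injective.injOn
    exact this.surjOn hd
  have hw : k₀⁻¹ * f k₀ ∉ D₁ := by
    intro hmem
    have hw1 : k₀⁻¹ * f k₀ ≠ 1 := fun h => hne (inv_mul_eq_one.1 h).symm
    refine hz _ hw1 ?_
    have hzmem : z (k₀⁻¹ * f k₀) ∈ D₂ := hsub (Or.inr ⟨_, hmem, rfl⟩)
    have hfk₀ : f k₀ ∈ Subgroup.centralizer (D₂ : Set H) := by
      refine Subgroup.mem_centralizer_iff.2 fun d hd => ?_
      obtain ⟨d', hd', rfl⟩ := hfsurj d hd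
      rw [← map_mul, ← map_mul, Subgroup.mem_centralizer_iff.1 hk₀ d' hd']
    exact Subgroup.mem_centralizer_iff.1 (mul_mem (inv_mem hk₀) hfk₀) _ hzmem
  obtain ⟨k₁, hk₁, hy₁⟩ := hH.exists_conj_notMem hD hD₁ hy
  set y₁ := k₁ * y * k₁⁻¹ with hy₁_def
  let E : Subgroup H := D₁ ⊔ Subgroup.zpowers y₁
  have hE : (E : Set H).Finite := hH.locallyFinite.finite_sup hD₁
    (finite_zpowers.2 (hH.locallyFinite.isOfFinOrder y₁))
  have hstab : ∀ k ∈ Subgroup.centralizer (D₁ : Set H), ∀ e ∈ E,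
      k⁻¹ * f (k * e * k⁻¹) * k ∈ E := by
    intro k hk
    have hkd : ∀ d ∈ D₁, k * d * k⁻¹ = d := fun d hd => by
      rw [← Subgroup.mem_centralizer_iff.1 hk d hd, mul_inv_cancel_right]
    have hkd' : ∀ d ∈ D₁, k⁻¹ * d * k = d := fun d hd => by
      rw [mul_assoc, Subgroup.mem_centralizer_iff.1 hk d hd, inv_mul_cancel_left]
    have hle : E ≤ E.comap
        ((MulAut.conj k⁻¹).toMonoidHom.comp (f.toMonoidHom.comp (MulAut.conj k).toMonoidHom)) := by
      refine sup_le (fun d hd => ?_) ?_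
      · have : k⁻¹ * f (k * d * k⁻¹) * k = f d := by rw [hkd d hd, hkd' _ (hinv d hd)]
        change k⁻¹ * f (k * d * k⁻¹) * k⁻¹⁻¹ ∈ E
        rw [inv_inv, this]
        exact le_sup_left (b := Subgroup.zpowers y₁) (hinv d hd)
      · rw [Subgroup.zpowers_le]
        have h := hcon (k * k₁) (mul_mem
          (Subgroup.centralizer_le (show (D : Set H) ⊆ D₁ from hDD₁) hk) hk₁)
        have hconj : k * k₁ * y * (k * k₁)⁻¹ = k * y₁ * k⁻¹ := by rw [hy₁_def]; group
        rw [hconj] at h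
        have hle' : D ⊔ Subgroup.zpowers (k * y₁ * k⁻¹) ≤
            E.comap (MulAut.conj k⁻¹).toMonoidHom := by
          refine sup_le (fun d hd => ?_) ?_
          · simpa [hkd' d (hDD₁ hd)] using le_sup_left (b := Subgroup.zpowers y₁) (hDD₁ hd)
          · rw [Subgroup.zpowers_le]
            simpa [mul_assoc] using le_sup_right (a := D₁) (Subgroup.mem_zpowers y₁)
        simpa using hle' h
    intro e he
    simpa using hle he
  have hfE : Set.SurjOn f (E : Set H) E := by
    have hmaps : Set.MapsTo f (E : Set H) E := fun e he => by
      simpa using hstab 1 (one_mem _) e he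
    exact ((hE.injOn_iff_bijOn_of_mapsTo hmaps).1 f.injective.injOn).surjOn
  have hnorm : ∀ k ∈ Subgroup.centralizer (D₁ : Set H),
      k⁻¹ * f k ∈ Subgroup.normalizer (E : Set H) := by
    intro k hk
    have : Finite (E : Set H) := hE
    refine Subgroup.mem_normalizer_fintype fun e he => ?_
    obtain ⟨e', he', rfl⟩ := hfE he
    have := hstab k hk e' he'
    simpa [mul_assoc] using this
  obtain ⟨k, hk, hkE⟩ := hH.exists_conj_mul_notMem hD₁ hE hw hy₁
  apply hkE
  have hprod : k⁻¹ * (k₀⁻¹ * f k₀) * k ∈ Subgroup.normalizer (E : Set H) := by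
    have := mul_mem (hnorm _ (mul_mem hk₀' hk)) (inv_mem (hnorm k hk))
    convert this using 1
    rw [map_mul]
    group
  exact (Subgroup.mem_normalizer_iff.1 hprod _).1
    (le_sup_right (a := D₁) (Subgroup.mem_zpowers y₁))

/-- Any inner automorphism can be modified off a finite subgroup so that the first `m` iterates
of its commutator with `f` at some point `x` are prescribed by finitely many values and leave
`x`. -/
theorem exists_commutator_orbit (hH : IsHallGroup H) {f : MulAut H} (hf : IsOfFinOrder f)
    (hf' : f ∉ (MulAut.conj : H →* MulAut H).range) {D : Subgroup H} (hD : (D : Set H).Finite)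
    (h : H) (m : ℕ) :
    ∃ (D' : Subgroup H) (h' x z : H), (D' : Set H).Finite ∧ D ≤ D' ∧
      (∀ d ∈ D, h' * d * h'⁻¹ = h * d * h⁻¹) ∧ x ∈ D' ∧ f z ∉ D' ∧ (m ≠ 0 → z ≠ x) ∧
      ∀ g : MulAut H, (∀ d ∈ D', g d = h' * d * h'⁻¹) → ((g⁻¹ * f⁻¹ * g * f) ^ m) x = z := by
  have finite_zpowers_sup : ∀ {K : Subgroup H} (x : H), (K : Set H).Finite →
      ((K ⊔ Subgroup.zpowers x : Subgroup H) : Set H).Finite := fun x hK =>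
    hH.locallyFinite.finite_sup hK (finite_zpowers.2 (hH.locallyFinite.isOfFinOrder x))
  induction m with
  | zero =>
    obtain ⟨y, hy⟩ : ∃ y, y ∉ D := by
      by_contra! hall
      have htop : ((⊤ : Subgroup H) : Set H).Finite := hD.subset fun y _ => hall y
      obtain ⟨h, hh⟩ := hH.homogeneous ⊤ ⊤ htop htop
        (Subgroup.topEquiv.trans (f.trans Subgroup.topEquiv.symm))
      exact hf' ⟨h, MulEquiv.ext fun y => (hh ⟨y, Subgroup.mem_top y⟩).symm⟩
    obtain ⟨k, hk, hky⟩ := hH.exists_apply_conj_notMem hf hf' hD hy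
    exact ⟨D ⊔ Subgroup.zpowers (k * y * k⁻¹), h, k * y * k⁻¹, k * y * k⁻¹,
      finite_zpowers_sup _ hD, le_sup_left, fun _ _ => rfl,
      le_sup_right (a := D) (Subgroup.mem_zpowers _), hky, by simp, by simp⟩
  | succ m ih =>
    obtain ⟨D₁, h₁, x, z, hD₁, hDD₁, hagree, hx, hz, -, horbit⟩ := ih
    have hfin' : ((D₁.map (MulAut.conj h₁).toMonoidHom : Subgroup H) : Set H).Finite :=
      hD₁.image _
    have hy : h₁ * f z * h₁⁻¹ ∉ D₁.map (MulAut.conj h₁).toMonoidHom := by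
      rintro ⟨d, hd, hdz⟩
      have : d = f z := (MulAut.conj h₁).injective hdz
      exact hz (this ▸ hd)
    obtain ⟨k, hk, hq⟩ := hH.exists_apply_conj_notMem hf.inv (fun h => hf' (inv_mem_iff.1 h))
      hfin' hy
    have hk' : ∀ d ∈ D₁, k * h₁ * d * (k * h₁)⁻¹ = h₁ * d * h₁⁻¹ := fun d hd => by
      have := Subgroup.mem_centralizer_iff.1 hk (h₁ * d * h₁⁻¹) ⟨d, hd, rfl⟩
      calc k * h₁ * d * (k * h₁)⁻¹ = k * (h₁ * d * h₁⁻¹) * k⁻¹ := by group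
        _ = h₁ * d * h₁⁻¹ := by rw [← this, mul_inv_cancel_right]
    have hconj : k * (h₁ * f z * h₁⁻¹) * k⁻¹ = (k * h₁) * f z * (k * h₁)⁻¹ := by group
    rw [hconj] at hq
    set h₂ := k * h₁
    set q := f⁻¹ (h₂ * f z * h₂⁻¹) with hq_def
    let D₂ : Subgroup H := D₁ ⊔ Subgroup.zpowers (f z)
    have hzD₂ : f z ∈ D₂ := le_sup_right (a := D₁) (Subgroup.mem_zpowers _)
    have hr : h₂⁻¹ * q * h₂ ∉ D₂ := by
      intro hmem
      have hle : D₂ ≤ (D₁.map (MulAut.conj h₁).toMonoidHom ⊔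
          Subgroup.zpowers (h₂ * f z * h₂⁻¹)).comap (MulAut.conj h₂).toMonoidHom := by
        refine sup_le (fun d hd => ?_) ?_
        · refine le_sup_left (a := D₁.map (MulAut.conj h₁).toMonoidHom) ⟨d, hd, ?_⟩
          exact (hk' d hd).symm
        · rw [Subgroup.zpowers_le]
          exact le_sup_right (a := D₁.map (MulAut.conj h₁).toMonoidHom) (Subgroup.mem_zpowers _)
      apply hq
      have := hle hmem
      simpa [mul_assoc] using this
    obtain ⟨k', hk'mem, hlast⟩ := hH.exists_apply_conj_notMem hf hf'
      (finite_zpowers_sup (f z) hD₁) hr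
    set z' := k' * (h₂⁻¹ * q * h₂) * k'⁻¹ with hz'_def
    have hk'' : ∀ d ∈ D₂, h₂ * k'⁻¹ * d * (h₂ * k'⁻¹)⁻¹ = h₂ * d * h₂⁻¹ := fun d hd => by
      have := Subgroup.mem_centralizer_iff.1 hk'mem d hd
      calc h₂ * k'⁻¹ * d * (h₂ * k'⁻¹)⁻¹ = h₂ * k'⁻¹ * (d * k') * h₂⁻¹ := by group
        _ = h₂ * d * h₂⁻¹ := by rw [this]; group
    have hz' : z' ∉ D₂ := by
      intro hmem
      have := Subgroup.mem_centralizer_iff.1 hk'mem z' hmem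
      apply hr
      have hz'eq : h₂⁻¹ * q * h₂ = k'⁻¹ * (z' * k') := by rw [hz'_def]; group
      rwa [hz'eq, this, inv_mul_cancel_left]
    have hD₁D₂ : D₁ ≤ D₂ := le_sup_left
    refine ⟨D₂ ⊔ Subgroup.zpowers z', h₂ * k'⁻¹, x, z',
      finite_zpowers_sup _ (finite_zpowers_sup _ hD₁), (hDD₁.trans hD₁D₂).trans le_sup_left,
      fun d hd => ?_, le_sup_left (a := D₂) (hD₁D₂ hx), hlast, fun _ hzx => ?_, fun g hg => ?_⟩
    · rw [hk'' d (hD₁D₂ (hDD₁ hd)), hk' d (hDD₁ hd), hagree d hd]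
    · exact hz' (hzx ▸ hD₁D₂ hx)
    · have hg₂ : ∀ d ∈ D₂, g d = h₂ * d * h₂⁻¹ := fun d hd => by
        rw [hg d (le_sup_left (a := D₂) hd), hk'' d hd]
      have hgz' : g z' = q := by
        rw [hg z' (le_sup_right (a := D₂) (Subgroup.mem_zpowers _)), hz'_def]
        group
      rw [pow_succ', MulAut.mul_apply, horbit g fun d hd => by rw [hg₂ d (hD₁D₂ hd), hk' d hd]]
      simp only [MulAut.mul_apply]
      rw [hg₂ _ hzD₂, ← hq_def, ← hgz', MulAut.inv_apply_self]

theorem exists_commutator_not_isOfFinOrder [Countable H] (hH : IsHallGroup H) {f : MulAut H}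
    (hf : IsOfFinOrder f) (hf' : f ∉ (MulAut.conj : H →* MulAut H).range) :
    ∃ g : MulAut H, ¬ IsOfFinOrder (g⁻¹ * f⁻¹ * g * f) := by
  obtain ⟨g, hg⟩ := hH.locallyFinite.exists_mulAut
    (fun n g => (g⁻¹ * f⁻¹ * g * f) ^ (n + 1) ≠ 1) fun n D h hD => by
      obtain ⟨D', h', x, z, hD', hle, hagree, -, -, hzx, horbit⟩ :=
        hH.exists_commutator_orbit hf hf' hD h (n + 1)
      refine ⟨D', h', hD', hle, hagree, fun g hg h1 => hzx n.succ_ne_zero ?_⟩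
      rw [← horbit g hg, h1, MulAut.one_apply]
  refine ⟨g, fun hfin => ?_⟩
  obtain ⟨n, hn, h1⟩ := isOfFinOrder_iff_pow_eq_one.1 hfin
  obtain ⟨m, rfl⟩ := Nat.exists_eq_succ_of_ne_zero hn.ne'
  exact hg m h1

end IsHallGroup

/-- If `H` is Hall's universal group and `f ∈ Aut(H)` is a non-inner automorphism of finite
order, then there is `g ∈ Aut(H)` such that `g⁻¹ * f⁻¹ * g * f` has infinite order.
Consequently, every normal subgroup of `Aut(H)` properly containing `Inn(H)` contains an
element of infinite order, hence is not locally finite. -/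
theorem commutator_of_infinite_order
    {H : Type} [Group H] [Countable H]
    (hLF : ∀ s : Finset H, ((Subgroup.closure (s : Set H) : Subgroup H) : Set H).Finite)
    (hEmb : ∀ (G : Type) [Group G] [Finite G], ∃ e : G →* H, Function.Injective e)
    (hHom : ∀ K L : Subgroup H, (K : Set H).Finite → (L : Set H).Finite →
      ∀ φ : ↥K ≃* ↥L, ∃ h : H, ∀ k : K, (φ k : H) = h * (k : H) * h⁻¹)
    (f : MulAut H)
    (hford : IsOfFinOrder f)
    (hfnotinner : f ∉ (MulAut.conj : H →* MulAut H).range) :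
    (∃ g : MulAut H, ¬ IsOfFinOrder (g⁻¹ * f⁻¹ * g * f)) ∧
    (∀ N : Subgroup (MulAut H), N.Normal → (MulAut.conj : H →* MulAut H).range < N →
      (∃ x ∈ N, ¬ IsOfFinOrder x) ∧ ¬ IsLocallyFiniteGroup ↥N) := by
  have hH : IsHallGroup H := ⟨hLF, hEmb, hHom⟩
  refine ⟨hH.exists_commutator_not_isOfFinOrder hford hfnotinner, fun N hN hlt => ?_⟩
  have hex : ∃ x ∈ N, ¬ IsOfFinOrder x := by
    obtain ⟨-, φ, hφN, hφ⟩ := SetLike.lt_iff_le_and_exists.1 hlt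
    by_cases hfin : IsOfFinOrder φ
    · obtain ⟨g, hg⟩ := hH.exists_commutator_not_isOfFinOrder hfin hφ
      refine ⟨_, N.mul_mem ?_ hφN, hg⟩
      simpa using hN.conj_mem _ (N.inv_mem hφN) g⁻¹
    · exact ⟨φ, hφN, hfin⟩
  refine ⟨hex, fun hlf => ?_⟩
  obtain ⟨x, hxN, hx⟩ := hex
  exact hx (N.subtype.isOfFinOrder (hlf.isOfFinOrder ⟨x, hxN⟩))
end
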